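/- Big pieces via maximal truncations: Let μ be a Radon measure on ℝ^d of degree n ∈ (0,d] and let T be an n-dimensional singular integral operator with Calderón–Zygmund kernel K satisfying K(x,y) = −K(y,x). Let Q ⊂ ℝ^d be a fixed cube, q ∈ (1,∞), and let b_Q be an L^q(μ)-admissible test function on Q with constant B₁. Then there exists a small constant c₁ = c₁(q, B₁) > 0 with the following property: if there exist s > 0, B₂ < ∞ and a set E_Q ⊂ ℝ^d such that ∫_{E_Q} |b_Q| dμ ≤ c₁ ∫_Q |b_Q| dμ and sup_{λ>0} λ^s μ({x ∈ Q ∖ E_Q : T_{μ,*} b_Q(x) > λ}) ≤ B₂ μ(Q), then there exists a set G_Q ⊂ Q ∖ E_Q with μ(G_Q) ≥ c μ(Q), such that the operator T restricted to the measure μ⌊G_Q is bounded on L²(μ⌊G_Q) (i.e., the truncations T_{μ⌊G_Q, ε} are bounded on L²(μ⌊G_Q) uniformly in ε > 0), where c > 0 and the operator norm bound depend only on d, n, the kernel constants, q, B₁, s and B₂. -/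

import Mathlib

open MeasureTheory Metric Set ENNReal

noncomputable section

abbrev Pt (d : ℕ) := EuclideanSpace ℝ (Fin d)

structure Cube (d : ℕ) where
  center : Pt d
  side : ℝ

def Cube.toSet {d : ℕ} (Q : Cube d) : Set (Pt d) :=
  {x | ∀ i, |x i - Q.center i| ≤ Q.side / 2}

def Cube.scale {d : ℕ} (a : ℝ) (Q : Cube d) : Cube d := ⟨Q.center, a * Q.side⟩

def HasDegree {d : ℕ} (μ : Measure (Pt d)) (n C₀ : ℝ) : Prop :=
  ∀ (x : Pt d) (r : ℝ), 0 < r → μ (ball x r) ≤ ENNReal.ofReal (C₀ * r ^ n)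

structure IsCZKernel {d : ℕ} (K : Pt d → Pt d → ℂ) (n C α : ℝ) : Prop where
  size : ∀ x y : Pt d, x ≠ y → ‖K x y‖ ≤ C / dist x y ^ n
  smooth_fst : ∀ x x' y : Pt d, x ≠ y → 2 * dist x x' ≤ dist x y →
    ‖K x y - K x' y‖ ≤ C * dist x x' ^ α / dist x y ^ (n + α)
  smooth_snd : ∀ x y y' : Pt d, x ≠ y → 2 * dist y y' ≤ dist x y →
    ‖K x y - K x y'‖ ≤ C * dist y y' ^ α / dist x y ^ (n + α)

def truncT {d : ℕ} (μ : Measure (Pt d)) (K : Pt d → Pt d → ℂ) (ε : ℝ) (f : Pt d → ℂ)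
    (x : Pt d) : ℂ :=
  ∫ y in {y | ε < dist x y}, K x y * f y ∂μ

def maxT {d : ℕ} (μ : Measure (Pt d)) (K : Pt d → Pt d → ℂ) (δ : ℝ) (f : Pt d → ℂ)
    (x : Pt d) : ℝ≥0∞ :=
  ⨆ (ε : ℝ) (_ : δ < ε), (‖truncT μ K ε f x‖₊ : ℝ≥0∞)

def ballMax {d : ℕ} (μ : Measure (Pt d)) (f : Pt d → ℂ) (x : Pt d) : ℝ≥0∞ :=
  ⨆ (r : ℝ) (_ : 0 < r), (∫⁻ y in ball x r, ‖f y‖₊ ∂μ) / μ (ball x r)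

def cubeMax {d : ℕ} (μ : Measure (Pt d)) (p : ℝ) (f : Pt d → ℂ) (x : Pt d) : ℝ≥0∞ :=
  ⨆ (r : ℝ) (_ : 0 < r),
    ((∫⁻ y in (Cube.toSet ⟨x, 2 * r⟩), (‖f y‖₊ : ℝ≥0∞) ^ p ∂μ) / μ (Cube.toSet ⟨x, 2 * r⟩)) ^ (1 / p)

def IsAdmissible {d : ℕ} (μ : Measure (Pt d)) (Q : Cube d) (p B₁ : ℝ) (b : Pt d → ℂ) : Prop :=
  (∀ x ∉ Q.toSet, b x = 0) ∧
  (∫ x in Q.toSet, b x ∂μ = ((μ Q.toSet).toReal : ℂ)) ∧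
  (∫⁻ x in Q.toSet, (‖b x‖₊ : ℝ≥0∞) ^ p ∂μ ≤ ENNReal.ofReal B₁ * μ Q.toSet)

def IsDoubling {d : ℕ} (μ : Measure (Pt d)) (a b : ℝ) (Q : Cube d) : Prop :=
  μ (Cube.scale a Q).toSet ≤ ENNReal.ofReal b * μ Q.toSet

def SmallBoundary {d : ℕ} (μ : Measure (Pt d)) (t : ℝ) (Q : Cube d) : Prop :=
  ∀ lam : ℝ, 0 < lam →
    μ {x ∈ (Cube.scale 5 Q).toSet | infDist x (frontier Q.toSet) ≤ lam * Q.side}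
      ≤ ENNReal.ofReal (t * lam) * μ (Cube.scale 5 Q).toSet

def Cube.dyadicPiece {d : ℕ} (R : Cube d) (j : ℕ) (m : Fin d → Fin (2 ^ j)) : Cube d :=
  ⟨(WithLp.equiv 2 (Fin d → ℝ)).symm
      (fun i => R.center i - R.side / 2 + R.side / 2 ^ j * ((m i : ℝ) + 1 / 2)),
    R.side / 2 ^ j⟩

set_option linter.all false
set_option autoImplicit false
namespace BP
section mart
variable {X : Type*} [MeasurableSpace X] {𝕜 : Type*} [RCLike 𝕜]
  {ι : Type*} [Countable ι] [MeasurableSpace ι] [DiscreteMeasurableSpace ι]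
structure BM {X : Type*} [MeasurableSpace X] {𝕜 : Type*} [RCLike 𝕜] (f : X → 𝕜) : Prop where
  m : Measurable f
  b : ∃ C : ℝ, ∀ x, ‖f x‖ ≤ C
def KM {X ι Y : Type*} (p : X → ι) (u : X → Y) : Prop := ∀ x y, p x = p y → u x = u y
def q {X : Type*} [MeasurableSpace X] {𝕜 : Type*} [RCLike 𝕜] (σ : Measure X) (f : X → 𝕜) : ℝ :=
  ∫ x, ‖f x‖^2 ∂σ
def avg {X ι : Type*} [MeasurableSpace X] {𝕜 : Type*} [RCLike 𝕜] (σ : Measure X) (p : X → ι)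
    (f : X → 𝕜) (x : X) : 𝕜 :=
  ((σ.real (p ⁻¹' {p x}) : ℝ) : 𝕜)⁻¹ * ∫ y in p ⁻¹' {p x}, f y ∂σ
theorem KM.meas {Y : Type*} [MeasurableSpace Y] {p : X → ι} (hp : Measurable p) {u : X → Y}
    (h : KM p u) : Measurable u := by
  rcases isEmpty_or_nonempty X with hX | ⟨⟨x0⟩⟩
  · exact measurable_of_empty u
  · have : u = (Function.extend p u (fun _ => u x0)) ∘ p := by
      funext x
      have hf : Function.FactorsThrough u p := fun a b hab => h a b hab
      exact (hf.extend_apply _ x).symm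
    rw [this]
    exact (measurable_of_countable _).comp hp
theorem BM.int {σ : Measure X} [IsFiniteMeasure σ] {f : X → 𝕜} (h : BM f) : Integrable f σ := by
  obtain ⟨C, hC⟩ := h.b
  exact Integrable.of_bound h.m.aestronglyMeasurable C (Filter.Eventually.of_forall hC)
theorem BM.mul {f g : X → 𝕜} (hf : BM f) (hg : BM g) : BM (fun x => f x*g x) := by
  obtain ⟨C, hC⟩ := hf.b
  obtain ⟨D, hD⟩ := hg.b
  refine ⟨hf.m.mul hg.m, C*D, fun x => ?_⟩
  rw [norm_mul]
  exact mul_le_mul (hC x) (hD x) (norm_nonneg _) ((norm_nonneg _).trans (hC x))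
theorem BM.add {f g : X → 𝕜} (hf : BM f) (hg : BM g) : BM (fun x => f x+g x) := by
  obtain ⟨C, hC⟩ := hf.b
  obtain ⟨D, hD⟩ := hg.b
  exact ⟨hf.m.add hg.m, C+D, fun x => (norm_add_le _ _).trans (add_le_add (hC x) (hD x))⟩
theorem BM.sub {f g : X → 𝕜} (hf : BM f) (hg : BM g) : BM (fun x => f x-g x) := by
  obtain ⟨C, hC⟩ := hf.b
  obtain ⟨D, hD⟩ := hg.b
  exact ⟨hf.m.sub hg.m, C+D, fun x => (norm_sub_le _ _).trans (add_le_add (hC x) (hD x))⟩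
theorem BM.const (c : 𝕜) : BM (fun _ : X => c) := ⟨measurable_const, ‖c‖, fun _ => le_rfl⟩
theorem BM.sum {α : Type*} (s : Finset α) {f : α → X → 𝕜} (h : ∀ i, BM (f i)) :
    BM (fun x => ∑ i ∈ s, f i x) := by
  classical
  induction s using Finset.induction_on with
  | empty => simpa using BM.const 0
  | insert a s ha ih => simpa [Finset.sum_insert ha] using (h a).add ih
theorem BM.norm {f : X → 𝕜} (hf : BM f) : BM (fun x => ‖f x‖) := by
  obtain ⟨C, hC⟩ := hf.b
  exact ⟨hf.m.norm, C, fun x => by simpa using hC x⟩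
theorem BM.pow {f : X → 𝕜} (hf : BM f) : BM (fun x => f x^2) := by
  simpa [sq] using hf.mul hf
theorem BM.conj {f : X → 𝕜} (hf : BM f) : BM (fun x => (starRingEnd 𝕜) (f x)) := by
  obtain ⟨C, hC⟩ := hf.b
  exact ⟨RCLike.continuous_conj.measurable.comp hf.m, C, fun x => by simpa using hC x⟩
theorem BM.ofReal {f : X → ℝ} (hf : BM f) : BM (fun x => ((f x : ℝ) : 𝕜)) := by
  obtain ⟨C, hC⟩ := hf.b
  exact ⟨RCLike.continuous_ofReal.measurable.comp hf.m, C, fun x => by simpa using hC x⟩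
theorem BM.ite {f g : X → 𝕜} (hf : BM f) (hg : BM g) {P : X → Prop} [DecidablePred P]
    (hP : MeasurableSet {x | P x}) : BM (fun x => if P x then f x else g x) := by
  obtain ⟨C, hC⟩ := hf.b
  obtain ⟨D, hD⟩ := hg.b
  refine ⟨Measurable.ite hP hf.m hg.m, max C D, fun x => ?_⟩
  split_ifs
  exacts [(hC x).trans (le_max_left _ _), (hD x).trans (le_max_right _ _)]
theorem BM.of_le {f : X → 𝕜} {g : X → ℝ} (hf : Measurable f) (hg : BM g)
    (h : ∀ x, ‖f x‖ ≤ g x) : BM f := by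
  obtain ⟨C, hC⟩ := hg.b
  exact ⟨hf, C, fun x => (h x).trans ((le_abs_self _).trans (hC x))⟩
variable {σ : Measure X} [IsFiniteMeasure σ] {p p' : X → ι} (hp : Measurable p)
  (hp' : Measurable p')
theorem avg_km (f : X → 𝕜) : KM p (avg σ p f) := by
  intro x y h
  simp only [avg, h]
theorem avg_fib (hp : Measurable p) {f : X → 𝕜} (x : X) :
    ((σ.real (p ⁻¹' {p x}) : ℝ) : 𝕜)*avg σ p f x = ∫ y in p ⁻¹' {p x}, f y ∂σ := by
  unfold avg
  by_cases h : σ.real (p ⁻¹' {p x}) =0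
  · have h' : σ (p ⁻¹' {p x}) =0 := by
      simpa [Measure.real, ENNReal.toReal_eq_zero_iff] using h
    rw [Measure.restrict_eq_zero.2 h']; simp
  · rw [mul_inv_cancel_left₀]; exact_mod_cast h
theorem avg_mul {u : X → 𝕜} (hu : KM p u) (hp : Measurable p) (f : X → 𝕜) (x : X) :
    avg σ p (fun y => u y*f y) x = u x*avg σ p f x := by
  unfold avg
  have : ∫ y in p ⁻¹' {p x}, u y*f y ∂σ = ∫ y in p ⁻¹' {p x}, u x*f y ∂σ := by
    apply setIntegral_congr_fun (hp (measurableSet_singleton _))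
    intro y hy
    simp only [mem_preimage, mem_singleton_iff] at hy
    simp only [hu y x hy]
  rw [this, integral_const_mul]; ring
theorem avg_le {f : X → 𝕜} {C : ℝ} (hC0 :0 ≤ C) (hC : ∀ x, ‖f x‖ ≤ C) (x : X) :
    ‖avg σ p f x‖ ≤ C := by
  unfold avg
  rw [norm_mul, norm_inv, RCLike.norm_ofReal, abs_of_nonneg measureReal_nonneg]
  have h1 : ‖∫ y in p ⁻¹' {p x}, f y ∂σ‖ ≤ C*σ.real (p ⁻¹' {p x}) := by
    apply norm_setIntegral_le_of_norm_le_const (measure_lt_top _ _) (fun y _ => hC y)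
  rcases eq_or_lt_of_le (measureReal_nonneg :0 ≤ σ.real (p ⁻¹' {p x})) with h | h
  · rw [← h]; simpa using hC0
  · rw [inv_mul_le_iff₀ h]; linarith
theorem avg_bm (hp : Measurable p) {f : X → 𝕜} (hf : BM f) : BM (avg σ p f) := by
  obtain ⟨C, hC⟩ := hf.b
  exact ⟨(avg_km f).meas hp, |C|,
    avg_le (abs_nonneg _) (fun x => (hC x).trans (le_abs_self _))⟩
theorem int_fib (hp : Measurable p) {f : X → 𝕜} (hf : Integrable f σ) :
    ∫ x, f x ∂σ = ∑' i, ∫ x in p ⁻¹' {i}, f x ∂σ := by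
  rw [← integral_iUnion (fun i => hp (measurableSet_singleton i)) _ hf.integrableOn]
  · rw [← preimage_iUnion, iUnion_of_singleton, preimage_univ, Measure.restrict_univ]
  · intro i j hij
    exact Disjoint.preimage _ (by simpa using hij)
theorem int_avg (hp : Measurable p) {u f : X → 𝕜} (hu : KM p u) (hub : BM u) (hf : BM f) :
    ∫ x, u x*avg σ p f x ∂σ = ∫ x, u x*f x ∂σ := by
  rw [int_fib hp (hub.mul (avg_bm hp hf)).int, int_fib hp (hub.mul hf).int]
  congr 1; funext i
  rcases (p ⁻¹' {i}).eq_empty_or_nonempty with h | ⟨x, hx⟩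
  · simp [h]
  · simp only [mem_preimage, mem_singleton_iff] at hx
    subst hx
    have h1 : ∀ g : X → 𝕜, ∫ y in p ⁻¹' {p x}, u y*g y ∂σ
        = u x * ∫ y in p ⁻¹' {p x}, g y ∂σ := fun g => by
      rw [← integral_const_mul]
      apply setIntegral_congr_fun (hp (measurableSet_singleton _))
      intro y hy
      simp only [mem_preimage, mem_singleton_iff] at hy
      simp only [hu y x hy]
    rw [h1, h1, ← avg_fib hp (f := f)]
    congr 1
    have : ∫ y in p ⁻¹' {p x}, avg σ p f y ∂σ = ∫ y in p ⁻¹' {p x}, avg σ p f x ∂σ := by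
      apply setIntegral_congr_fun (hp (measurableSet_singleton _))
      intro y hy
      exact avg_km f y x hy
    rw [this, setIntegral_const, RCLike.real_smul_eq_coe_mul]
theorem avg_avg (hp : Measurable p) (hp' : Measurable p') (hn : KM p' p) {f : X → 𝕜}
    (hf : BM f) (x : X) : avg σ p (avg σ p' f) x = avg σ p f x := by
  have hk : KM p' (indicator (p ⁻¹' {p x}) (fun _ => (1 : 𝕜))) := by
    intro y z h
    have := hn y z h
    by_cases hz : p z = p x <;> simp [indicator, this, hz]
  have hb : BM (indicator (p ⁻¹' {p x}) (fun _ => (1 : 𝕜))) :=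
    ⟨hk.meas hp',1, fun y => by by_cases h : y ∈ p ⁻¹' {p x} <;> simp [h]⟩
  have h := int_avg (σ := σ) hp' hk hb hf
  have e : ∀ g : X → 𝕜, ∫ y, indicator (p ⁻¹' {p x}) (fun _ => (1 : 𝕜)) y*g y ∂σ
      = ∫ y in p ⁻¹' {p x}, g y ∂σ := by
    intro g
    rw [← integral_indicator (hp (measurableSet_singleton _))]
    congr 1; funext y
    by_cases h : y ∈ p ⁻¹' {p x} <;> simp [h]
  rw [e, e] at h
  unfold avg at h ⊢
  rw [h]
theorem q_nonneg (f : X → 𝕜) :0 ≤ q σ f := integral_nonneg fun _ => by positivity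
theorem q_pyth (hp : Measurable p) {f : X → 𝕜} (hf : BM f) :
    q σ f = q σ (avg σ p f)+q σ (fun x => f x-avg σ p f x) := by
  have hA := avg_bm (σ := σ) hp hf
  have h0 : ∫ x, (starRingEnd 𝕜) (avg σ p f x)*(f x-avg σ p f x) ∂σ =0 := by
    have := int_avg (σ := σ) hp (u := fun x => (starRingEnd 𝕜) (avg σ p f x))
      (fun x y h => by simp only [avg_km f x y h]) hA.conj hf
    simp only [mul_sub]
    rw [integral_sub (hA.conj.mul hf).int (hA.conj.mul hA).int, this, sub_self]
  have h1 : ∫ x, RCLike.re ((starRingEnd 𝕜) (avg σ p f x)*(f x-avg σ p f x)) ∂σ =0 := by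
    rw [integral_re (hA.conj.mul (hf.sub hA)).int, h0]; simp
  have h2 : q σ f = ∫ x, (‖avg σ p f x‖^2+‖f x-avg σ p f x‖^2
      +2*RCLike.re ((starRingEnd 𝕜) (avg σ p f x)*(f x-avg σ p f x))) ∂σ := by
    unfold q; congr 1; funext x
    have := RCLike.normSq_add (avg σ p f x) (f x-avg σ p f x)
    simp only [← RCLike.normSq_eq_def', add_sub_cancel] at this ⊢
    rw [this]
    have e : RCLike.re (avg σ p f x*(starRingEnd 𝕜) (f x-avg σ p f x))
        = RCLike.re ((starRingEnd 𝕜) (avg σ p f x)*(f x-avg σ p f x)) := by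
      rw [← RCLike.conj_re]; simp
    rw [e]
  have i1 := hA.norm.pow.int (σ := σ)
  have i2 := (hf.sub hA).norm.pow.int (σ := σ)
  have i3 : Integrable (fun x =>2*RCLike.re ((starRingEnd 𝕜) (avg σ p f x) *
      (f x-avg σ p f x))) σ := ((hA.conj.mul (hf.sub hA)).int.re).const_mul 2
  have i12 : Integrable (fun x => ‖avg σ p f x‖^2+‖f x-avg σ p f x‖^2) σ := i1.add i2
  rw [h2, integral_add i12 i3, integral_add i1 i2, integral_const_mul, h1]
  simp [q]
theorem q_avg_le (hp : Measurable p) {f : X → 𝕜} (hf : BM f) : q σ (avg σ p f) ≤ q σ f := by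
  rw [q_pyth hp hf]; linarith [q_nonneg (σ := σ) (fun x => f x-avg σ p f x)]
variable {π : ℕ → X → ι} (hπ : ∀ k, Measurable (π k)) (hn : ∀ k, KM (π (k+1)) (π k))
theorem km_le (hn : ∀ k, KM (π (k+1)) (π k)) {j k : ℕ} (h : j ≤ k) : KM (π k) (π j) := by
  induction h with
  | refl => exact fun _ _ h => h
  | step _ ih => exact fun x y h => ih x y (hn _ x y h)
theorem KM.mono (hn : ∀ k, KM (π (k+1)) (π k)) {Y : Type*} {u : X → Y} {j k : ℕ}
    (h : j ≤ k) (hu : KM (π j) u) : KM (π k) u := fun x y e => hu x y (km_le hn h x y e)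
theorem square_fn (hπ : ∀ k, Measurable (π k)) (hn : ∀ k, KM (π (k+1)) (π k))
    {f : X → 𝕜} (hf : BM f) (n : ℕ) :
    ∑ k ∈ Finset.range n, q σ (fun x => avg σ (π (k+1)) f x-avg σ (π k) f x) ≤ q σ f := by
  have : ∑ k ∈ Finset.range n, q σ (fun x => avg σ (π (k+1)) f x-avg σ (π k) f x)
      = q σ (avg σ (π n) f)-q σ (avg σ (π 0) f) := by
    rw [← Finset.sum_range_sub (fun k => q σ (avg σ (π k) f))]
    refine Finset.sum_congr rfl fun k _ => ?_
    have := q_pyth (σ := σ) (hπ k) (avg_bm (σ := σ) (hπ (k+1)) hf)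
    have e : avg σ (π k) (avg σ (π (k+1)) f) = avg σ (π k) f := by
      funext x; exact avg_avg (hπ k) (hπ (k+1)) (hn k) hf x
    rw [e] at this
    linarith
  rw [this]
  linarith [q_avg_le (σ := σ) (hπ n) hf, q_nonneg (σ := σ) (avg σ (π 0) f)]
end mart
section mart2
variable {X : Type*} [MeasurableSpace X] {𝕜 : Type*} [RCLike 𝕜]
  {ι : Type*} [Countable ι] [MeasurableSpace ι] [DiscreteMeasurableSpace ι]
  {σ : Measure X} [IsFiniteMeasure σ] {π : ℕ → X → ι}
theorem avg_nonneg {p : X → ι} {f : X → ℝ} (hf : ∀ x,0 ≤ f x) (x : X) :0 ≤ avg σ p f x := by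
  unfold avg
  exact mul_nonneg (inv_nonneg.2 measureReal_nonneg) (integral_nonneg hf)
theorem norm_avg_le {p : X → ι} (f : X → 𝕜) (x : X) :
    ‖avg σ p f x‖ ≤ avg σ p (fun y => ‖f y‖) x := by
  unfold avg
  rw [norm_mul, norm_inv, RCLike.norm_ofReal, abs_of_nonneg measureReal_nonneg]
  exact mul_le_mul_of_nonneg_left (norm_integral_le_integral_norm _)
    (inv_nonneg.2 measureReal_nonneg)
def mx {X ι : Type*} [MeasurableSpace X] {𝕜 : Type*} [RCLike 𝕜] (σ : Measure X)
    (π : ℕ → X → ι) (f : X → 𝕜) : ℕ → X → ℝ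
  | 0, x => avg σ (π 0) (fun y => ‖f y‖) x
  | k+1, x => max (mx σ π f k x) (avg σ (π (k+1)) (fun y => ‖f y‖) x)
theorem mx_ge (f : X → 𝕜) (k : ℕ) (x : X) :
    avg σ (π k) (fun y => ‖f y‖) x ≤ mx σ π f k x := by
  cases k with
  | zero => exact le_rfl
  | succ k => exact le_max_right _ _
theorem mx_mono (f : X → 𝕜) {j k : ℕ} (h : j ≤ k) (x : X) : mx σ π f j x ≤ mx σ π f k x := by
  induction h with
  | refl => exact le_rfl
  | step _ ih => exact ih.trans (le_max_left _ _)
theorem mx_nonneg (f : X → 𝕜) (k : ℕ) (x : X) :0 ≤ mx σ π f k x :=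
  (avg_nonneg (fun _ => norm_nonneg _) x).trans (mx_ge f k x)
theorem norm_avg_le_mx (f : X → 𝕜) (k : ℕ) (x : X) : ‖avg σ (π k) f x‖ ≤ mx σ π f k x :=
  (norm_avg_le f x).trans (mx_ge f k x)
theorem mx_km (hn : ∀ k, KM (π (k+1)) (π k)) (f : X → 𝕜) (k : ℕ) :
    KM (π k) (mx σ π f k) := by
  induction k with
  | zero => exact avg_km (fun y => ‖f y‖)
  | succ k ih =>
    intro x y h
    simp only [mx, ih x y (hn k x y h), avg_km (fun y => ‖f y‖) x y h]
theorem BM.max {f g : X → ℝ} (hf : BM f) (hg : BM g) : BM (fun x => max (f x) (g x)) := by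
  refine BM.of_le (hf.m.max hg.m) (hf.norm.add hg.norm) fun x => ?_
  rcases max_choice (f x) (g x) with h | h <;> rw [h] <;>
  linarith [norm_nonneg (f x), norm_nonneg (g x)]
theorem mx_bm (hπ : ∀ k, Measurable (π k)) {f : X → 𝕜} (hf : BM f) (k : ℕ) :
    BM (mx σ π f k) := by
  induction k with
  | zero => exact avg_bm (hπ 0) hf.norm
  | succ k ih => exact ih.max (avg_bm (hπ (k+1)) hf.norm)
theorem doob (hπ : ∀ k, Measurable (π k)) (hn : ∀ k, KM (π (k+1)) (π k)) {f : X → 𝕜}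
    (hf : BM f) (n : ℕ) : ∫ x, mx σ π f n x^2 ∂σ ≤4*q σ f := by
  set A : ℕ → X → ℝ := fun k => avg σ (π k) (fun y => ‖f y‖) with hA
  set M := mx σ π f with hM
  have hAb : ∀ k, BM (A k) := fun k => avg_bm (hπ k) hf.norm
  have hMb : ∀ k, BM (M k) := fun k => mx_bm hπ hf k
  have path : ∀ k x,4 * ∑ i ∈ Finset.range k, M i x*(A (i+1) x-A i x)
      ≤4*(M k x*A k x)-2*M k x^2 := by
    intro k x
    induction k with
    | zero => simp only [Finset.range_zero, Finset.sum_empty]; simp only [hM, hA, mx]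
              nlinarith [sq_nonneg (avg σ (π 0) (fun y => ‖f y‖) x)]
    | succ k ih =>
      rw [Finset.sum_range_succ]
      have e : M (k+1) x = max (M k x) (A (k+1) x) := rfl
      rcases le_total (M k x) (A (k+1) x) with h | h
      · rw [e, max_eq_right h]; nlinarith [sq_nonneg (A (k+1) x-M k x)]
      · rw [e, max_eq_left h]; nlinarith
  have z : ∀ i, ∫ x, M i x*(A (i+1) x-A i x) ∂σ =0 := by
    intro i
    simp only [mul_sub]
    rw [integral_sub ((hMb i).mul (hAb _)).int ((hMb i).mul (hAb _)).int]
    rw [int_avg (hπ (i+1)) ((mx_km hn f i).mono hn (Nat.le_succ i)) (hMb i) hf.norm,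
      int_avg (hπ i) (mx_km hn f i) (hMb i) hf.norm, sub_self]
  have h1 :0 ≤ ∫ x, (4*(M n x*A n x)-2*M n x^2) ∂σ := by
    have : ∫ x,4 * ∑ i ∈ Finset.range n, M i x*(A (i+1) x-A i x) ∂σ =0 := by
      rw [integral_const_mul, integral_finset_sum _ (fun i _ =>
        ((hMb i).mul ((hAb _).sub (hAb _))).int)]
      simp [z]
    rw [← this]
    refine integral_mono ?_ ?_ (path n)
    · exact ((BM.const 4).mul (BM.sum _ fun i => (hMb i).mul ((hAb _).sub (hAb _)))).int
    · exact (((BM.const 4).mul ((hMb n).mul (hAb n))).sub ((BM.const 2).mul (hMb n).pow)).int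
  have h2 : ∫ x, (4*(M n x*A n x)-2*M n x^2) ∂σ
      ≤ ∫ x, (4*A n x^2-M n x^2) ∂σ := by
    refine integral_mono ?_ ?_ ?_
    · exact (((BM.const 4).mul ((hMb n).mul (hAb n))).sub ((BM.const 2).mul (hMb n).pow)).int
    · exact (((BM.const 4).mul (hAb n).pow).sub (hMb n).pow).int
    · intro x; nlinarith [sq_nonneg (M n x-2*A n x)]
  rw [integral_sub ((BM.const 4).mul (hAb n).pow).int (hMb n).pow.int,
    integral_const_mul] at h2
  have h3 : ∫ x, A n x^2 ∂σ ≤ q σ f := by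
    have := q_avg_le (σ := σ) (hπ n) hf.norm
    simpa [q] using this
  linarith
theorem carleson (hπ : ∀ k, Measurable (π k)) (hn : ∀ k, KM (π (k+1)) (π k)) {C : ℝ} {n : ℕ}
    {s : ℕ → X → ℝ} (hs : ∀ k, BM (s k))
    (pack : ∀ j, ∀ u : X → ℝ, KM (π j) u → BM u → (∀ x,0 ≤ u x) →
      ∑ k ∈ Finset.Ico j n, ∫ x, u x*s k x ∂σ ≤ C * ∫ x, u x ∂σ)
    {A : ℕ → X → ℝ} (hAb : ∀ k, BM (A k)) (hAk : ∀ k, KM (π k) (A k)) (hA0 : ∀ k x,0 ≤ A k x)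
    (hAm : ∀ k x, A k x ≤ A (k+1) x) :
    ∑ k ∈ Finset.range n, ∫ x, A k x*s k x ∂σ ≤ C * ∫ x, A n x ∂σ := by
  have key : ∀ m j, j+m = n → ∑ k ∈ Finset.Ico j n, ∫ x, (A k x-A j x)*s k x ∂σ
      ≤ C * ∫ x, (A n x-A j x) ∂σ := by
    intro m
    induction m with
    | zero => intro j h; obtain rfl : j = n := by omega
              simp
    | succ m ih =>
      intro j h
      have h1 := ih (j+1) (by omega)
      have h2 := pack (j+1) (fun x => A (j+1) x-A j x)
        (fun x y e => by simp only [hAk (j+1) x y e, (hAk j).mono hn (Nat.le_succ j) x y e])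
        ((hAb _).sub (hAb _)) (fun x => sub_nonneg.2 (hAm j x))
      rw [Finset.sum_eq_sum_Ico_succ_bot (by omega)]
      have e1 : ∫ x, (A n x-A j x) ∂σ
          = ∫ x, (A n x-A (j+1) x) ∂σ + ∫ x, (A (j+1) x-A j x) ∂σ := by
        rw [← integral_add ((hAb _).sub (hAb _)).int ((hAb _).sub (hAb _)).int]
        congr 1; funext x; ring
      have e2 : ∀ k, ∫ x, (A k x-A j x)*s k x ∂σ = ∫ x, (A k x-A (j+1) x)*s k x ∂σ
          + ∫ x, (A (j+1) x-A j x)*s k x ∂σ := by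
        intro k
        rw [← integral_add (((hAb _).sub (hAb _)).mul (hs k)).int
          (((hAb _).sub (hAb _)).mul (hs k)).int]
        congr 1; funext x; ring
      rw [Finset.sum_congr rfl (fun k _ => e2 k), Finset.sum_add_distrib, e1, mul_add]
      simp only [sub_self, zero_mul, integral_zero, zero_add]
      linarith
  have h1 := key n 0 (by omega)
  have h2 := pack 0 (A 0) (hAk 0) (hAb 0) (hA0 0)
  rw [← Finset.range_eq_Ico] at h1 h2
  have e2 : ∀ k, ∫ x, A k x*s k x ∂σ = ∫ x, (A k x-A 0 x)*s k x ∂σ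
      + ∫ x, A 0 x*s k x ∂σ := by
    intro k
    rw [← integral_add (((hAb _).sub (hAb _)).mul (hs k)).int ((hAb _).mul (hs k)).int]
    congr 1; funext x; ring
  rw [Finset.sum_congr rfl (fun k _ => e2 k), Finset.sum_add_distrib]
  rw [integral_sub (hAb _).int (hAb _).int] at h1
  linarith
end mart2
structure TD {X : Type*} [MeasurableSpace X] (σ : Measure X) (ι : Type*) [MeasurableSpace ι] where
  π : ℕ → X → ι
  b : X → ℂ
  Tr : ℕ → X → Prop
  τ : ℝ
  N : ℕ
  mπ : ∀ k, Measurable (π k)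
  nest : ∀ k, KM (π (k+1)) (π k)
  bm : Measurable b
  b1 : ∀ x, ‖b x‖ ≤1
  τ0 :0 < τ
  tr0 : ∀ x, Tr 0 x
  anti : ∀ k x, Tr (k+1) x → Tr k x
  trk : ∀ k, KM (π k) (Tr k)
  low : ∀ k x, Tr k x → τ ≤ ‖avg σ (π k) b x‖
  trN : ∀ x, ¬ Tr N x
namespace TD
variable {X : Type*} [MeasurableSpace X]
  {ι : Type*} [Countable ι] [MeasurableSpace ι] [DiscreteMeasurableSpace ι]
  {σ : Measure X} [IsFiniteMeasure σ] (T : TD σ ι)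
open Classical in
def aa {X : Type*} [MeasurableSpace X] {σ : Measure X} {ι : Type*} [MeasurableSpace ι]
    (T : TD σ ι) (f : X → ℂ) (k : ℕ) (x : X) : ℂ :=
  if T.Tr k x then avg σ (T.π k) f x/avg σ (T.π k) T.b x else 0
def da {X : Type*} [MeasurableSpace X] {σ : Measure X} {ι : Type*} [MeasurableSpace ι]
    (T : TD σ ι) (f : X → ℂ) (k : ℕ) (x : X) : ℂ := T.aa f (k+1) x-T.aa f k x
def nt {X : Type*} [MeasurableSpace X] {σ : Measure X} {ι : Type*} [MeasurableSpace ι]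
    (T : TD σ ι) (k : ℕ) (x : X) : Prop := T.Tr k x ∧ ¬ T.Tr (k+1) x
open Classical in
def tm {X : Type*} [MeasurableSpace X] {σ : Measure X} {ι : Type*} [MeasurableSpace ι]
    (T : TD σ ι) {𝕜 : Type*} [RCLike 𝕜] (f : X → 𝕜) (k : ℕ) (x : X) : 𝕜 :=
  if T.nt k x then f x else 0
def Dl {X : Type*} [MeasurableSpace X] {σ : Measure X} {ι : Type*} [MeasurableSpace ι]
    (T : TD σ ι) (f : X → ℂ) (k : ℕ) (x : X) : ℂ := T.b x*T.da f k x+T.tm f k x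
def GG {X : Type*} [MeasurableSpace X] {σ : Measure X} {ι : Type*} [MeasurableSpace ι]
    (T : TD σ ι) (f h : X → ℂ) (k : ℕ) (x : X) : ℝ := ‖T.da f k x‖+T.tm (fun y => ‖h y‖) k x
open Classical in
def EE {X : Type*} [MeasurableSpace X] {σ : Measure X} {ι : Type*} [MeasurableSpace ι]
    (T : TD σ ι) (f : X → ℂ) (k : ℕ) (x : X) : ℂ :=
  T.b x*T.aa f k x+if T.Tr k x then 0 else f x
theorem bb : BM T.b := ⟨T.bm,1, T.b1⟩
theorem mTr (k : ℕ) : MeasurableSet {x | T.Tr k x} := by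
  have := (T.trk k).meas (T.mπ k)
  exact measurableSet_setOf.2 this
theorem mnt (k : ℕ) : MeasurableSet {x | T.nt k x} := (T.mTr k).inter (T.mTr (k+1)).compl
theorem aa_km (f : X → ℂ) (k : ℕ) : KM (T.π k) (T.aa f k) := by
  intro x y h
  have e := T.trk k x y h
  by_cases hy : T.Tr k y <;> simp [aa, avg_km f x y h, avg_km T.b x y h, e, hy]
theorem aa_norm (f : X → ℂ) (k : ℕ) (x : X) : ‖T.aa f k x‖ ≤ T.τ⁻¹*‖avg σ (T.π k) f x‖ := by
  unfold aa
  split_ifs with h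
  · rw [norm_div, div_eq_inv_mul]
    exact mul_le_mul_of_nonneg_right (inv_anti₀ T.τ0 (T.low k x h)) (norm_nonneg _)
  · simpa using mul_nonneg (inv_nonneg.2 T.τ0.le) (norm_nonneg _)
theorem aa_bm {f : X → ℂ} (hf : BM f) (k : ℕ) : BM (T.aa f k) :=
  BM.of_le ((T.aa_km f k).meas (T.mπ k))
    ((BM.const T.τ⁻¹).mul (avg_bm (σ := σ) (T.mπ k) hf).norm) (T.aa_norm f k)
theorem da_bm {f : X → ℂ} (hf : BM f) (k : ℕ) : BM (T.da f k) := (T.aa_bm hf _).sub (T.aa_bm hf _)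
theorem da_km (f : X → ℂ) (k : ℕ) : KM (T.π (k+1)) (T.da f k) := by
  intro x y h
  simp only [da, T.aa_km f (k+1) x y h, T.aa_km f k x y (T.nest k x y h)]
theorem nt_km (k : ℕ) : KM (T.π (k+1)) (T.nt k) := by
  intro x y h
  simp only [nt, T.trk (k+1) x y h, T.trk k x y (T.nest k x y h)]
theorem tm_bm {𝕜 : Type*} [RCLike 𝕜] {f : X → 𝕜} (hf : BM f) (k : ℕ) : BM (T.tm f k) := by
  classical exact hf.ite (BM.const 0) (T.mnt k)
theorem Dl_bm {f : X → ℂ} (hf : BM f) (k : ℕ) : BM (T.Dl f k) :=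
  (T.bb.mul (T.da_bm hf k)).add (T.tm_bm hf k)
theorem GG_bm {f h : X → ℂ} (hf : BM f) (hh : BM h) (k : ℕ) : BM (T.GG f h k) :=
  (T.da_bm hf k).norm.add (T.tm_bm hh.norm k)
theorem tm_nonneg (h : X → ℂ) (k : ℕ) (x : X) :0 ≤ T.tm (fun y => ‖h y‖) k x := by
  unfold tm; split_ifs; exacts [norm_nonneg _, le_rfl]
theorem GG_nonneg (f h : X → ℂ) (k : ℕ) (x : X) :0 ≤ T.GG f h k x :=
  add_nonneg (norm_nonneg _) (T.tm_nonneg h k x)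
theorem tm_norm (f : X → ℂ) (k : ℕ) (x : X) : ‖T.tm f k x‖ = T.tm (fun y => ‖f y‖) k x := by
  unfold tm; split_ifs <;> simp
theorem Dl_le (f : X → ℂ) (k : ℕ) (x : X) : ‖T.Dl f k x‖ ≤ T.GG f f k x := by
  unfold Dl GG
  refine (norm_add_le _ _).trans ?_
  rw [T.tm_norm, norm_mul]
  have := mul_le_mul_of_nonneg_right (T.b1 x) (norm_nonneg (T.da f k x))
  linarith
theorem EE_bm {f : X → ℂ} (hf : BM f) (k : ℕ) : BM (T.EE f k) := by
  classical exact (T.bb.mul (T.aa_bm hf k)).add ((BM.const 0).ite hf (T.mTr k))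
theorem EE_succ (f : X → ℂ) (k : ℕ) (x : X) : T.EE f (k+1) x-T.EE f k x = T.Dl f k x := by
  unfold EE Dl da tm nt
  have := T.anti k x
  by_cases h : T.Tr k x <;> by_cases h' : T.Tr (k+1) x <;> simp_all <;> ring
theorem Dl_sum (f : X → ℂ) (n : ℕ) (x : X) :
    ∑ k ∈ Finset.range n, T.Dl f k x = T.EE f n x-T.EE f 0 x := by
  rw [← Finset.sum_range_sub (fun k => T.EE f k x)]
  exact Finset.sum_congr rfl fun k _ => (T.EE_succ f k x).symm
theorem EE_N (f : X → ℂ) (x : X) : T.EE f T.N x = f x := by simp [EE, aa, T.trN]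
theorem EE_0 (f : X → ℂ) (x : X) : T.EE f 0 x = T.b x*T.aa f 0 x := by simp [EE, T.tr0]
theorem Tr_le {j k : ℕ} (h : j ≤ k) {x : X} (hx : T.Tr k x) : T.Tr j x := by
  induction h with
  | refl => exact hx
  | step _ ih => exact ih (T.anti _ x hx)
theorem aa_mul (f : X → ℂ) (k : ℕ) (x : X) (h : T.Tr k x) :
    T.aa f k x*avg σ (T.π k) T.b x = avg σ (T.π k) f x := by
  have : avg σ (T.π k) T.b x ≠ 0 := by
    intro h0; have := T.low k x h; rw [h0, norm_zero] at this; linarith [T.τ0]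
  simp [aa, h, this]
theorem int_EE {f u : X → ℂ} (hf : BM f) (k : ℕ) (hu : KM (T.π k) u) (hub : BM u) :
    ∫ x, u x*T.EE f k x ∂σ = ∫ x, u x*f x ∂σ := by
  classical
  have hk : KM (T.π k) (fun x => u x*T.aa f k x) := fun x y h => by
    simp only [hu x y h, T.aa_km f k x y h]
  set v : X → ℂ := fun x => if T.Tr k x then u x else 0 with hv
  have hvb : BM v := hub.ite (BM.const 0) (T.mTr k)
  have hvk : KM (T.π k) v := fun x y h => by simp only [hv, hu x y h, T.trk k x y h]
  have e1 : ∫ x, u x*T.aa f k x*T.b x ∂σ = ∫ x, v x*f x ∂σ := by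
    rw [← int_avg (T.mπ k) hk (hub.mul (T.aa_bm hf k)) T.bb,
      ← int_avg (T.mπ k) hvk hvb hf]
    congr 1; funext x
    by_cases h : T.Tr k x
    · rw [mul_assoc, T.aa_mul f k x h]; simp [hv, h]
    · simp [hv, h, aa]
  have e2 : ∀ x, u x*T.EE f k x = u x*T.aa f k x*T.b x+(u x*f x-v x*f x) := by
    intro x; simp only [EE, hv]; split_ifs <;> ring
  simp only [e2]
  rw [integral_add ((hub.mul (T.aa_bm hf k)).mul T.bb).int ((hub.mul hf).sub (hvb.mul hf)).int,
    integral_sub (hub.mul hf).int (hvb.mul hf).int, e1]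
  ring
theorem int_Dl {f u : X → ℂ} (hf : BM f) (k : ℕ) (hu : KM (T.π k) u) (hub : BM u) :
    ∫ x, u x*T.Dl f k x ∂σ =0 := by
  simp only [← T.EE_succ, mul_sub]
  rw [integral_sub (hub.mul (T.EE_bm hf _)).int (hub.mul (T.EE_bm hf _)).int,
    T.int_EE hf k hu hub, T.int_EE hf (k+1) (hu.mono T.nest (Nat.le_succ k)) hub, sub_self]
theorem avg_Dl {f : X → ℂ} (hf : BM f) {j k : ℕ} (hjk : j ≤ k) {η : X → ℂ} (hη : KM (T.π k) η)
    (hηb : BM η) (x : X) : avg σ (T.π j) (fun y => η y*T.Dl f k y) x =0 := by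
  set v : X → ℂ := fun y => (T.π j ⁻¹' {T.π j x}).indicator η y with hv
  have hm : MeasurableSet (T.π j ⁻¹' {T.π j x}) := T.mπ j (measurableSet_singleton _)
  have hvb : BM v := by classical exact (hηb.ite (BM.const 0) hm)
  have hvk : KM (T.π k) v := fun y z h => by
    have h2 := km_le T.nest hjk y z h
    by_cases hz : T.π j z = T.π j x <;> simp [hv, indicator, h2, hz, hη y z h]
  have := T.int_Dl hf k hvk hvb
  unfold avg
  rw [← integral_indicator hm]
  have e : ∀ y, (T.π j ⁻¹' {T.π j x}).indicator (fun y => η y*T.Dl f k y) y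
      = v y*T.Dl f k y := by
    intro y; by_cases h : y ∈ T.π j ⁻¹' {T.π j x} <;> simp [hv, h]
  simp only [e, this, mul_zero]
theorem GG_sq {f h : X → ℂ} (k : ℕ) (x : X) : T.GG f h k x^2 ≤
    2*T.τ⁻¹^2*‖avg σ (T.π (k+1)) f x-avg σ (T.π k) f x‖^2
    +2*T.τ⁻¹^4*(mx σ T.π f k x^2*‖avg σ (T.π (k+1)) T.b x-avg σ (T.π k) T.b x‖^2)
    +2*T.τ⁻¹^2*(mx σ T.π f k x^2*T.tm (fun _ => (1:ℝ)) k x)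
    +2*(‖h x‖^2*T.tm (fun _ => (1:ℝ)) k x) := by
  have ht := inv_pos.2 T.τ0
  have hM := norm_avg_le_mx (σ := σ) (π := T.π) f k x
  have hM0 := mx_nonneg (σ := σ) (π := T.π) f k x
  by_cases h1 : T.Tr (k+1) x
  · have h0 := T.anti k x h1
    have hnt : ¬ T.nt k x := fun h => h.2 h1
    have hb0 := T.low k x h0
    have hb1 := T.low (k+1) x h1
    set f0 := avg σ (T.π k) f x
    set f1 := avg σ (T.π (k+1)) f x
    set b0 := avg σ (T.π k) T.b x
    set b1 := avg σ (T.π (k+1)) T.b x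
    have n0 : b0 ≠ 0 := by rintro h; rw [h, norm_zero] at hb0; linarith [T.τ0]
    have n1 : b1 ≠ 0 := by rintro h; rw [h, norm_zero] at hb1; linarith [T.τ0]
    have e : T.da f k x = (f1-f0)*b1⁻¹-f0*(b1-b0)*(b0⁻¹*b1⁻¹) := by
      have : T.da f k x = f1/b1-f0/b0 := by simp [da, aa, h0, h1, f1, f0, b1, b0]
      rw [this]; field_simp; ring
    have i0 : ‖b0⁻¹‖ ≤ T.τ⁻¹ := by rw [norm_inv]; exact inv_anti₀ T.τ0 hb0
    have i1 : ‖b1⁻¹‖ ≤ T.τ⁻¹ := by rw [norm_inv]; exact inv_anti₀ T.τ0 hb1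
    have hd : ‖T.da f k x‖ ≤ T.τ⁻¹*‖f1-f0‖+T.τ⁻¹^2*(mx σ T.π f k x*‖b1-b0‖) := by
      rw [e]
      refine (norm_sub_le _ _).trans (add_le_add ?_ ?_)
      · rw [norm_mul, mul_comm]; gcongr
      · rw [norm_mul, norm_mul, norm_mul, mul_comm, sq]; gcongr
    have : T.GG f h k x = ‖T.da f k x‖ := by simp [GG, tm, hnt]
    rw [this]
    simp only [tm, hnt, if_false, mul_zero, add_zero]
    have := pow_le_pow_left₀ (norm_nonneg _) hd 2
    nlinarith [sq_nonneg (T.τ⁻¹*‖f1-f0‖-T.τ⁻¹^2*(mx σ T.π f k x*‖b1-b0‖))]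
  · by_cases h0 : T.Tr k x
    · have hnt : T.nt k x := ⟨h0, h1⟩
      have hd : ‖T.da f k x‖ ≤ T.τ⁻¹*mx σ T.π f k x := by
        have : T.da f k x = - T.aa f k x := by simp [da, aa, h1]
        rw [this, norm_neg]
        exact (T.aa_norm f k x).trans (by gcongr)
      have e : T.GG f h k x = ‖T.da f k x‖+‖h x‖ := by simp [GG, tm, hnt]
      rw [e]
      simp only [tm, hnt, if_true, mul_one]
      have h3 := pow_le_pow_left₀ (norm_nonneg _) hd 2
      have h4 : (‖T.da f k x‖+‖h x‖)^2 ≤2*‖T.da f k x‖^2+2*‖h x‖^2 := by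
        nlinarith [sq_nonneg (‖T.da f k x‖-‖h x‖)]
      rw [mul_pow] at h3
      have :0 ≤2*T.τ⁻¹^2*‖avg σ (T.π (k+1)) f x-avg σ (T.π k) f x‖^2
        +2*T.τ⁻¹^4*(mx σ T.π f k x^2 *
          ‖avg σ (T.π (k+1)) T.b x-avg σ (T.π k) T.b x‖^2) := by positivity
      linarith
    · have hnt : ¬ T.nt k x := fun h => h0 h.1
      have e : T.GG f h k x =0 := by simp [GG, tm, hnt, da, aa, h0, h1]
      rw [e]
      have :0 ≤ T.tm (fun _ => (1:ℝ)) k x := by simp [tm, hnt]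
      rw [zero_pow two_ne_zero]
      positivity
theorem sum_tm (n : ℕ) (x : X) : ∑ k ∈ Finset.range n, T.tm (fun _ => (1:ℝ)) k x ≤1 := by
  classical
  have : ∀ n, ∑ k ∈ Finset.range n, T.tm (fun _ => (1:ℝ)) k x
      =1-if T.Tr n x then 1 else 0 := by
    intro n
    induction n with
    | zero => simp [T.tr0]
    | succ n ih =>
      rw [Finset.sum_range_succ, ih]
      have := T.anti n x
      by_cases h0 : T.Tr n x <;> by_cases h1 : T.Tr (n+1) x <;> simp_all [tm, nt]
  rw [this]; split_ifs <;> norm_num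
end TD
namespace TD
variable {X : Type*} [MeasurableSpace X]
  {ι : Type*} [Countable ι] [MeasurableSpace ι] [DiscreteMeasurableSpace ι]
  {σ : Measure X} [IsFiniteMeasure σ] (T : TD σ ι)
def CC {X : Type*} [MeasurableSpace X] {σ : Measure X} {ι : Type*} [MeasurableSpace ι]
    (T : TD σ ι) : ℝ :=10*T.τ⁻¹^2+8*T.τ⁻¹^4+2
theorem CC_pos :0 < T.CC := by unfold CC; positivity
theorem int_sum_mono {s : Finset ℕ} {F G : ℕ → X → ℝ} (hF : ∀ k, BM (F k)) (hG : ∀ k, BM (G k))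
    (h : ∀ k x, F k x ≤ G k x) : ∑ k ∈ s, ∫ x, F k x ∂σ ≤ ∑ k ∈ s, ∫ x, G k x ∂σ :=
  Finset.sum_le_sum fun k _ => integral_mono (hF k).int (hG k).int (h k)
theorem _root_.BP.BM.sqrt {u : X → ℝ} (hu : BM u) : BM (fun x => √(u x)) := by
  refine BM.of_le (Real.continuous_sqrt.measurable.comp hu.m) (hu.norm.add (BM.const 1)) fun x => ?_
  rw [Real.norm_eq_abs, abs_of_nonneg (Real.sqrt_nonneg _)]
  rw [Real.sqrt_le_left (by positivity)]
  nlinarith [norm_nonneg (u x), Real.le_norm_self (u x)]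
theorem q_sqrt {u : X → ℝ} (hu : ∀ x,0 ≤ u x) (h : X → ℂ) :
    q σ (fun x => ((√(u x) : ℝ) : ℂ)*h x) = ∫ x, u x*‖h x‖^2 ∂σ := by
  unfold q; congr 1; funext x
  rw [norm_mul, mul_pow, Complex.norm_real, Real.norm_eq_abs, sq_abs, Real.sq_sqrt (hu x)]
theorem km_sqrt {p : X → ι} {u : X → ℝ} (hu : KM p u) : KM p (fun x => ((√(u x) : ℝ) : ℂ)) :=
  fun x y h => by simp only [hu x y h]
theorem pack_b (n j : ℕ) (u : X → ℝ) (hu : KM (T.π j) u) (hub : BM u) (hu0 : ∀ x,0 ≤ u x) :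
    ∑ k ∈ Finset.Ico j n, ∫ x, u x*‖avg σ (T.π (k+1)) T.b x-avg σ (T.π k) T.b x‖^2 ∂σ
      ≤1 * ∫ x, u x ∂σ := by
  have hs := square_fn (σ := σ) T.mπ T.nest ((hub.sqrt.ofReal (𝕜 := ℂ)).mul T.bb) n
  have h2 : ∑ k ∈ Finset.Ico j n, ∫ x, u x *
      ‖avg σ (T.π (k+1)) T.b x-avg σ (T.π k) T.b x‖^2 ∂σ
      = ∑ k ∈ Finset.Ico j n, q σ (fun x =>
        avg σ (T.π (k+1)) (fun x => ((√(u x) : ℝ) : ℂ)*T.b x) x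
        - avg σ (T.π k) (fun x => ((√(u x) : ℝ) : ℂ)*T.b x) x) := by
    refine Finset.sum_congr rfl fun k hk => ?_
    have hjk := (Finset.mem_Ico.1 hk).1
    rw [← q_sqrt hu0]
    congr 1; funext x
    rw [avg_mul ((km_sqrt hu).mono T.nest hjk) (T.mπ k),
      avg_mul ((km_sqrt hu).mono T.nest (hjk.trans (Nat.le_succ k))) (T.mπ (k+1)), mul_sub]
  rw [h2]
  refine (Finset.sum_le_sum_of_subset_of_nonneg ?_ fun _ _ _ => q_nonneg _).trans (hs.trans ?_)
  · intro k hk; simp at hk ⊢; exact hk.2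
  · rw [one_mul]
    refine (q_sqrt hu0 T.b).le.trans (integral_mono (hub.mul T.bb.norm.pow).int hub.int fun x => ?_)
    have := pow_le_one₀ (norm_nonneg _) (T.b1 x) (n :=2)
    exact mul_le_of_le_one_right (hu0 x) this
theorem tm1_nonneg (k : ℕ) (x : X) :0 ≤ T.tm (fun _ => (1:ℝ)) k x := by
  unfold tm; split_ifs <;> norm_num
theorem sum_int_tm {g : X → ℝ} (hg : BM g) (hg0 : ∀ x,0 ≤ g x) (n j : ℕ) :
    ∑ k ∈ Finset.Ico j n, ∫ x, g x*T.tm (fun _ => (1:ℝ)) k x ∂σ ≤1 * ∫ x, g x ∂σ := by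
  have h1 : ∀ k, BM (T.tm (fun _ => (1:ℝ)) k) := fun k => T.tm_bm (BM.const 1) k
  rw [← integral_finset_sum _ (fun k _ => (hg.mul (h1 k)).int), one_mul]
  refine integral_mono (BM.sum _ fun k => hg.mul (h1 k)).int hg.int fun x => ?_
  simp only []
  rw [← Finset.mul_sum]
  refine mul_le_of_le_one_right (hg0 x) (le_trans ?_ (T.sum_tm n x))
  exact Finset.sum_le_sum_of_subset_of_nonneg (fun k hk => by simp at hk ⊢; exact hk.2)
    fun k _ _ => T.tm1_nonneg k x
theorem sqG {f h : X → ℂ} (hf : BM f) (hh : BM h) (hfh : ∀ x, ‖f x‖ ≤ ‖h x‖) (n : ℕ) :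
    ∑ k ∈ Finset.range n, ∫ x, T.GG f h k x^2 ∂σ ≤ T.CC*q σ h := by
  have hM : ∀ k, BM (fun x => mx σ T.π f k x^2) := fun k => (mx_bm T.mπ hf k).pow
  have hA : ∀ k, BM (avg σ (T.π k) f) := fun k => avg_bm (T.mπ k) hf
  have hB : ∀ k, BM (avg σ (T.π k) T.b) := fun k => avg_bm (T.mπ k) T.bb
  have hdb : ∀ k, BM (fun x => ‖avg σ (T.π (k+1)) T.b x-avg σ (T.π k) T.b x‖^2) :=
    fun k => ((hB (k+1)).sub (hB k)).norm.pow
  have hdf : ∀ k, BM (fun x => ‖avg σ (T.π (k+1)) f x-avg σ (T.π k) f x‖^2) :=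
    fun k => ((hA (k+1)).sub (hA k)).norm.pow
  have h1 : ∀ k, BM (T.tm (fun _ => (1:ℝ)) k) := fun k => T.tm_bm (BM.const 1) k
  have b1 := fun k => (BM.const (X := X) (2*T.τ⁻¹^2)).mul (hdf k)
  have b2 := fun k => (BM.const (X := X) (2*T.τ⁻¹^4)).mul ((hM k).mul (hdb k))
  have b3 := fun k => (BM.const (X := X) (2*T.τ⁻¹^2)).mul ((hM k).mul (h1 k))
  have b4 := fun k => (BM.const (X := X) (2:ℝ)).mul (hh.norm.pow.mul (h1 k))
  have key := int_sum_mono (σ := σ) (s := Finset.range n) (fun k => (T.GG_bm hf hh k).pow)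
    (fun k => (((b1 k).add (b2 k)).add (b3 k)).add (b4 k)) (fun k x => T.GG_sq k x)
  refine key.trans ?_
  have e : ∀ k, ∫ x, (2*T.τ⁻¹^2*‖avg σ (T.π (k+1)) f x-avg σ (T.π k) f x‖^2
    +2*T.τ⁻¹^4*(mx σ T.π f k x^2*‖avg σ (T.π (k+1)) T.b x-avg σ (T.π k) T.b x‖^2)
    +2*T.τ⁻¹^2*(mx σ T.π f k x^2*T.tm (fun _ => (1:ℝ)) k x)
    +2*(‖h x‖^2*T.tm (fun _ => (1:ℝ)) k x)) ∂σ
    =2*T.τ⁻¹^2*q σ (fun x => avg σ (T.π (k+1)) f x-avg σ (T.π k) f x)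
    +2*T.τ⁻¹^4*(∫ x, mx σ T.π f k x^2 *
        ‖avg σ (T.π (k+1)) T.b x-avg σ (T.π k) T.b x‖^2 ∂σ)
    +2*T.τ⁻¹^2*(∫ x, mx σ T.π f k x^2*T.tm (fun _ => (1:ℝ)) k x ∂σ)
    +2*(∫ x, ‖h x‖^2*T.tm (fun _ => (1:ℝ)) k x ∂σ) := by
    intro k
    rw [integral_add (((b1 k).add (b2 k)).add (b3 k)).int (b4 k).int,
      integral_add ((b1 k).add (b2 k)).int (b3 k).int, integral_add (b1 k).int (b2 k).int,
      integral_const_mul, integral_const_mul, integral_const_mul, integral_const_mul, q]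
  rw [Finset.sum_congr rfl (fun k _ => e k), Finset.sum_add_distrib, Finset.sum_add_distrib,
    Finset.sum_add_distrib, ← Finset.mul_sum, ← Finset.mul_sum, ← Finset.mul_sum,
    ← Finset.mul_sum]
  have Mk : ∀ k, KM (T.π k) (fun x => mx σ T.π f k x^2) := fun k x y hxy => by
    simp only [mx_km T.nest f k x y hxy]
  have Mm : ∀ k x, mx σ T.π f k x^2 ≤ mx σ T.π f (k+1) x^2 := fun k x =>
    pow_le_pow_left₀ (mx_nonneg f k x) (mx_mono f (Nat.le_succ k) x) 2
  have c1 := square_fn (σ := σ) T.mπ T.nest hf n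
  have c2 := carleson (σ := σ) T.mπ T.nest hdb (T.pack_b n) hM Mk (fun _ _ => sq_nonneg _) Mm
  have c3 := carleson (σ := σ) (n := n) T.mπ T.nest h1
    (fun j u hu hub hu0 => T.sum_int_tm hub hu0 n j) hM Mk (fun _ _ => sq_nonneg _) Mm
  have c4 := T.sum_int_tm (σ := σ) hh.norm.pow (fun _ => sq_nonneg _) n 0
  rw [← Finset.range_eq_Ico] at c4
  have dm := doob (σ := σ) T.mπ T.nest hf n
  have qfh : q σ f ≤ q σ h := integral_mono hf.norm.pow.int hh.norm.pow.int fun x =>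
    pow_le_pow_left₀ (norm_nonneg _) (hfh x) 2
  have t2 :0 ≤ T.τ⁻¹^2 := sq_nonneg _
  have t4 :0 ≤ T.τ⁻¹^4 := by positivity
  have d1 := mul_le_mul_of_nonneg_left (c1.trans qfh) t2
  have d2 := mul_le_mul_of_nonneg_left (c2.trans (by linarith : _ ≤4*q σ h)) t4
  have d3 := mul_le_mul_of_nonneg_left (c3.trans (by linarith : _ ≤4*q σ h)) t2
  have d4 : ∑ k ∈ Finset.range n, ∫ x, ‖h x‖^2*T.tm (fun _ => (1:ℝ)) k x ∂σ ≤ q σ h := by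
    simpa [q] using c4
  unfold CC
  nlinarith
theorem aa_u {f u : X → ℂ} {j k : ℕ} (hjk : j ≤ k) (hu : KM (T.π j) u) (x : X) :
    T.aa (fun y => u y*f y) k x = u x*T.aa f k x := by
  unfold aa
  rw [avg_mul (hu.mono T.nest hjk) (T.mπ k)]
  split_ifs <;> ring
theorem sqG_w {f h : X → ℂ} (hf : BM f) (hh : BM h) (hfh : ∀ x, ‖f x‖ ≤ ‖h x‖) (n j : ℕ)
    {u : X → ℝ} (hu : KM (T.π j) u) (hub : BM u) (hu0 : ∀ x,0 ≤ u x) :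
    ∑ k ∈ Finset.Ico j n, ∫ x, u x*T.GG f h k x^2 ∂σ ≤ T.CC * ∫ x, u x*‖h x‖^2 ∂σ := by
  set v : X → ℂ := fun x => ((√(u x) : ℝ) : ℂ) with hv
  have hvn : ∀ x, ‖v x‖ = √(u x) := fun x => by
    rw [hv, Complex.norm_real, Real.norm_eq_abs, abs_of_nonneg (Real.sqrt_nonneg _)]
  have hvb : BM v := hub.sqrt.ofReal
  have := T.sqG (hvb.mul hf) (hvb.mul hh) (fun x => by
    rw [norm_mul, norm_mul]; exact mul_le_mul_of_nonneg_left (hfh x) (norm_nonneg _)) n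
  rw [hv, q_sqrt hu0] at this
  refine le_trans ?_ this
  have e : ∀ k ∈ Finset.Ico j n, ∫ x, u x*T.GG f h k x^2 ∂σ
      = ∫ x, T.GG (fun x => v x*f x) (fun x => v x*h x) k x^2 ∂σ := by
    intro k hk
    have hjk := (Finset.mem_Ico.1 hk).1
    congr 1; funext x
    have : T.GG (fun x => v x*f x) (fun x => v x*h x) k x = √(u x)*T.GG f h k x := by
      unfold GG da
      rw [T.aa_u (hjk.trans (Nat.le_succ k)) (km_sqrt hu), T.aa_u hjk (km_sqrt hu), ← mul_sub,
        norm_mul, mul_add]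
      have : ‖((√(u x) : ℝ) : ℂ)‖ = √(u x) := hvn x
      rw [this]
      congr 1
      unfold tm
      split_ifs
      · simp only [norm_mul, hvn]
      · simp
    rw [this, mul_pow, Real.sq_sqrt (hu0 x)]
  rw [Finset.sum_congr rfl e]
  exact Finset.sum_le_sum_of_subset_of_nonneg (fun k hk => by simp at hk ⊢; exact hk.2)
    fun k _ _ => integral_nonneg fun _ => sq_nonneg _
theorem dual {f w η : X → ℂ} (hf : BM f) (hw : BM w) (k : ℕ) (hη : KM (T.π k) η) (hηb : BM η) :
    ‖∫ x, w x*(η x*T.Dl f k x) ∂σ‖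
      ≤ ∫ x, ‖η x‖*(T.GG f f k x*T.GG (fun y => w y*T.b y) w k x) ∂σ := by
  classical
  set wb : X → ℂ := fun y => w y*T.b y with hwb
  have bwb : BM wb := hw.mul T.bb
  set κ := T.aa wb with hκ
  have bκ : ∀ k, BM (κ k) := T.aa_bm bwb
  set g : X → ℂ := fun x => if T.Tr (k+1) x then η x*T.da f k x else 0 with hg
  have bg : BM g := (hηb.mul (T.da_bm hf k)).ite (BM.const 0) (T.mTr (k+1))
  have kη : KM (T.π (k+1)) η := hη.mono T.nest (Nat.le_succ k)
  have kκ : KM (T.π (k+1)) (κ k) := (T.aa_km wb k).mono T.nest (Nat.le_succ k)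
  have kg : KM (T.π (k+1)) g := fun x y h => by
    simp only [hg, kη x y h, T.da_km f k x y h, T.trk (k+1) x y h]
  set r : X → ℂ := fun x => T.tm (fun x => η x*(w x-κ k x)) k x*T.Dl f k x with hr
  have br : BM r := (T.tm_bm (hηb.mul (hw.sub (bκ k))) k).mul (T.Dl_bm hf k)
  have bB := avg_bm (σ := σ) (T.mπ (k+1)) T.bb
  have e1 : ∫ x, w x*(η x*T.Dl f k x) ∂σ
      = ∫ x, (g x*(avg σ (T.π (k+1)) T.b x*(κ (k+1) x-κ k x))+r x) ∂σ := by
    have z := T.int_Dl hf k (u := fun x => η x*κ k x)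
      (fun x y h => by simp only [hη x y h, hκ, T.aa_km wb k x y h]) (hηb.mul (bκ k))
    have h1 : ∫ x, w x*(η x*T.Dl f k x) ∂σ
        = ∫ x, (g x*wb x-g x*κ k x*T.b x+r x) ∂σ := by
      rw [← sub_zero (∫ x, w x*(η x*T.Dl f k x) ∂σ), ← z,
        ← integral_sub (hw.mul (hηb.mul (T.Dl_bm hf k))).int
          ((hηb.mul (bκ k)).mul (T.Dl_bm hf k)).int]
      congr 1; funext x
      simp only [hg, hr, hwb]
      by_cases h1 : T.Tr (k+1) x
      · have hnt : ¬ T.nt k x := fun h => h.2 h1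
        simp only [h1, if_true, Dl, tm, hnt, if_false]; ring
      · by_cases h0 : T.Tr k x
        · have hnt : T.nt k x := ⟨h0, h1⟩
          simp only [h1, if_false, tm, hnt, if_true]; ring
        · have hnt : ¬ T.nt k x := fun h => h0 h.1
          simp [h1, h0, tm, hnt, Dl, da, aa]
    rw [h1, integral_add ((bg.mul bwb).sub ((bg.mul (bκ k)).mul T.bb)).int br.int,
      integral_sub (bg.mul bwb).int ((bg.mul (bκ k)).mul T.bb).int,
      ← int_avg (T.mπ (k+1)) kg bg bwb, ← int_avg (T.mπ (k+1)) (u := fun x => g x*κ k x)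
        (fun x y h => by simp only [kg x y h, kκ x y h]) (bg.mul (bκ k)) T.bb,
      integral_add (bg.mul (bB.mul ((bκ _).sub (bκ _)))).int br.int]
    congr 1
    rw [← integral_sub (bg.mul (avg_bm (T.mπ (k+1)) bwb)).int ((bg.mul (bκ k)).mul bB).int]
    congr 1; funext x
    by_cases h1 : T.Tr (k+1) x
    · rw [← T.aa_mul wb (k+1) x h1]; ring
    · simp [hg, h1]
  rw [e1]
  refine (norm_integral_le_integral_norm _).trans (integral_mono ?_ ?_ fun x => ?_)
  · exact ((bg.mul (bB.mul ((bκ _).sub (bκ _)))).add br).norm.int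
  · exact (hηb.norm.mul ((T.GG_bm hf hf k).mul (T.GG_bm bwb hw k))).int
  · simp only []
    have hG := T.GG_nonneg f f k x
    have hG2 := T.GG_nonneg wb w k x
    by_cases h1 : T.Tr (k+1) x
    · have hnt : ¬ T.nt k x := fun h => h.2 h1
      simp only [hg, hr, h1, if_true, tm, hnt, if_false, zero_mul, add_zero, GG]
      rw [norm_mul, norm_mul, norm_mul, mul_assoc]
      have hb : ‖avg σ (T.π (k+1)) T.b x‖ ≤1 := avg_le zero_le_one T.b1 x
      have : ‖avg σ (T.π (k+1)) T.b x‖*‖κ (k+1) x-κ k x‖ ≤ ‖T.da wb k x‖ :=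
        mul_le_of_le_one_left (norm_nonneg _) hb
      gcongr
    · by_cases h0 : T.Tr k x
      · have hnt : T.nt k x := ⟨h0, h1⟩
        have e : T.da wb k x = - κ k x := by simp [da, hκ, aa, h1]
        simp only [hg, hr, h1, if_false, zero_mul, zero_add, tm, hnt, if_true]
        rw [norm_mul, norm_mul, mul_assoc]
        refine mul_le_mul_of_nonneg_left ?_ (norm_nonneg _)
        rw [mul_comm]
        have h2 : ‖w x-κ k x‖ ≤ T.GG wb w k x := by
          simp only [GG, e, tm, hnt, if_true, norm_neg]
          linarith [norm_sub_le (w x) (κ k x)]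
        exact mul_le_mul (T.Dl_le f k x) h2 (norm_nonneg _) hG
      · have hnt : ¬ T.nt k x := fun h => h0 h.1
        simp only [hg, hr, h1, if_false, tm, hnt, zero_mul, add_zero, norm_zero]
        positivity
theorem dual_sum {f w : X → ℂ} (hf : BM f) (hw : BM w) {η : ℕ → X → ℂ}
    (hη : ∀ k, KM (T.π k) (η k)) (hηb : ∀ k, BM (η k)) (n : ℕ) {t : ℝ} (ht :0 < t) :
    ∑ k ∈ Finset.range n, ‖∫ x, w x*(η k x*T.Dl f k x) ∂σ‖
      ≤ t/2 * ∑ k ∈ Finset.range n, ∫ x, ‖η k x‖^2*T.GG f f k x^2 ∂σ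
        + t⁻¹/2*(T.CC*q σ w) := by
  have bwb : BM (fun y => w y*T.b y) := hw.mul T.bb
  have h1 := T.sqG bwb hw (fun x => by
    rw [norm_mul]; exact mul_le_of_le_one_right (norm_nonneg _) (T.b1 x)) n
  have h2 := mul_le_mul_of_nonneg_left h1 (by positivity :0 ≤ t⁻¹/2)
  refine le_trans ?_ (add_le_add_right h2 _)
  rw [Finset.mul_sum, Finset.mul_sum, ← Finset.sum_add_distrib]
  refine Finset.sum_le_sum fun k _ => (T.dual hf hw k (hη k) (hηb k)).trans ?_
  have bG := T.GG_bm hf hf k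
  have bH := T.GG_bm bwb hw k
  rw [← integral_const_mul, ← integral_const_mul, ← integral_add
    ((BM.const _).mul ((hηb k).norm.pow.mul bG.pow)).int ((BM.const _).mul bH.pow).int]
  refine integral_mono ((hηb k).norm.mul (bG.mul bH)).int
    (((BM.const _).mul ((hηb k).norm.pow.mul bG.pow)).add ((BM.const _).mul bH.pow)).int fun x => ?_
  simp only []
  set A := ‖η k x‖*T.GG f f k x with hA
  set B := T.GG (fun y => w y*T.b y) w k x
  have e : ‖η k x‖^2*T.GG f f k x^2 = A^2 := by rw [hA]; ring
  have e2 : ‖η k x‖*(T.GG f f k x*B) = A*B := by rw [hA]; ring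
  rw [e, e2]
  have :0 ≤ t⁻¹*(t*A-B)^2 := by positivity
  have h3 : t⁻¹*(t*A-B)^2 = t*A^2-2*(A*B)+t⁻¹*B^2 := by
    field_simp; ring
  linarith
theorem q_sum_le {f : X → ℂ} (hf : BM f) {η : ℕ → X → ℂ}
    (hη : ∀ k, KM (T.π k) (η k)) (hηb : ∀ k, BM (η k)) (n : ℕ) :
    q σ (fun x => ∑ k ∈ Finset.range n, η k x*T.Dl f k x)
      ≤ T.CC * ∑ k ∈ Finset.range n, ∫ x, ‖η k x‖^2*T.GG f f k x^2 ∂σ := by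
  set F : X → ℂ := fun x => ∑ k ∈ Finset.range n, η k x*T.Dl f k x with hF
  have bF : BM F := BM.sum _ fun k => (hηb k).mul (T.Dl_bm hf k)
  have h := T.dual_sum hf bF.conj hη hηb n T.CC_pos
  have qc : q σ (fun x => (starRingEnd ℂ) (F x)) = q σ F := by simp [q]
  rw [qc] at h
  have h1 : ((q σ F : ℝ) : ℂ) = ∑ k ∈ Finset.range n,
      ∫ x, (starRingEnd ℂ) (F x)*(η k x*T.Dl f k x) ∂σ := by
    rw [← integral_finset_sum _ (fun k _ => (bF.conj.mul ((hηb k).mul (T.Dl_bm hf k))).int)]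
    unfold q
    rw [← integral_complex_ofReal]
    congr 1; funext x
    rw [← Finset.mul_sum]; push_cast; rw [← Complex.conj_mul']
  have h2 : q σ F ≤ ∑ k ∈ Finset.range n,
      ‖∫ x, (starRingEnd ℂ) (F x)*(η k x*T.Dl f k x) ∂σ‖ := by
    have := norm_sum_le (Finset.range n)
      (fun k => ∫ x, (starRingEnd ℂ) (F x)*(η k x*T.Dl f k x) ∂σ)
    rw [← h1, Complex.norm_real, Real.norm_eq_abs] at this
    exact (le_abs_self _).trans this
  have : T.CC⁻¹/2*(T.CC*q σ F) = q σ F/2 := by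
    have := T.CC_pos; field_simp
  linarith
theorem para {f w : X → ℂ} (hf : BM f) (hw : BM w) {W : ℝ} (hW : ∀ x, ‖w x‖ ≤ W) {η : ℕ → X → ℂ}
    (hη : ∀ k, KM (T.π k) (η k)) (hηb : ∀ k, BM (η k)) {A : ℕ → X → ℝ} (hAb : ∀ k, BM (A k))
    (hAk : ∀ k, KM (T.π k) (A k)) (hηA : ∀ k x, ‖η k x‖^2 ≤ A k x)
    (hAm : ∀ k x, A k x ≤ A (k+1) x) (n : ℕ) :
    ∑ k ∈ Finset.range n, ‖∫ x, w x*(η k x*T.Dl f k x) ∂σ‖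
      ≤ T.CC*(q σ f+W^2 * ∫ x, A n x ∂σ) := by
  set wb : X → ℂ := fun y => w y*T.b y with hwb
  have bwb : BM wb := hw.mul T.bb
  have bG := T.GG_bm hf hf
  have bH := T.GG_bm bwb hw
  have hwbw : ∀ x, ‖wb x‖ ≤ ‖w x‖ := fun x => by
    rw [norm_mul]; exact mul_le_of_le_one_right (norm_nonneg _) (T.b1 x)
  have hA0 : ∀ k x,0 ≤ A k x := fun k x => (sq_nonneg _).trans (hηA k x)
  have c := carleson (σ := σ) (n := n) (C := T.CC*W^2) T.mπ T.nest (fun k => (bH k).pow)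
    (fun j u hu hub hu0 => by
      refine (T.sqG_w bwb hw hwbw n j hu hub hu0).trans ?_
      rw [mul_assoc]
      refine mul_le_mul_of_nonneg_left ?_ T.CC_pos.le
      rw [← integral_const_mul]
      refine integral_mono (hub.mul hw.norm.pow).int ((BM.const _).mul hub).int fun x => ?_
      simp only []
      rw [mul_comm]
      exact mul_le_mul_of_nonneg_right (pow_le_pow_left₀ (norm_nonneg _) (hW x) 2) (hu0 x))
    hAb hAk hA0 hAm
  have d := T.sqG hf hf (fun _ => le_rfl) n
  have h : ∑ k ∈ Finset.range n, ‖∫ x, w x*(η k x*T.Dl f k x) ∂σ‖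
      ≤ ∑ k ∈ Finset.range n, (∫ x, T.GG f f k x^2 ∂σ + ∫ x, A k x*T.GG wb w k x^2 ∂σ) := by
    refine Finset.sum_le_sum fun k _ => (T.dual hf hw k (hη k) (hηb k)).trans ?_
    rw [← integral_add (bG k).pow.int ((hAb k).mul (bH k).pow).int]
    refine integral_mono ((hηb k).norm.mul ((bG k).mul (bH k))).int
      ((bG k).pow.add ((hAb k).mul (bH k).pow)).int fun x => ?_
    simp only []
    have h1 := mul_le_mul_of_nonneg_right (hηA k x) (sq_nonneg (T.GG wb w k x))
    nlinarith [sq_nonneg (T.GG f f k x-‖η k x‖*T.GG wb w k x), sq_nonneg (T.GG f f k x),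
      mul_nonneg (sq_nonneg ‖η k x‖) (sq_nonneg (T.GG wb w k x))]
  rw [Finset.sum_add_distrib] at h
  linarith
end TD
namespace TD
variable {X : Type*} [MeasurableSpace X]
  {ι : Type*} [Countable ι] [MeasurableSpace ι] [DiscreteMeasurableSpace ι]
  {σ : Measure X} [IsFiniteMeasure σ] (T : TD σ ι)
structure Sel {X : Type*} [MeasurableSpace X] {σ : Measure X} {ι : Type*} [MeasurableSpace ι]
    (T : TD σ ι) (ε : ℕ → X → ℂ) : Prop where
  km : ∀ k, KM (T.π k) (ε k)
  le : ∀ k x, ‖ε k x‖ ≤1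
theorem Sel.bm {T : TD σ ι} {ε : ℕ → X → ℂ} (h : T.Sel ε) (k : ℕ) : BM (ε k) :=
  ⟨(h.km k).meas (T.mπ k),1, h.le k⟩
def ae {X : Type*} [MeasurableSpace X] {σ : Measure X} {ι : Type*} [MeasurableSpace ι]
    (T : TD σ ι) (ε : ℕ → X → ℂ) (f : X → ℂ) (m : ℕ) (x : X) : ℂ :=
  T.aa f 0 x + ∑ i ∈ Finset.range m, ε i x*T.da f i x
def ph {X : Type*} [MeasurableSpace X] {σ : Measure X} {ι : Type*} [MeasurableSpace ι]
    (T : TD σ ι) (ε : ℕ → X → ℂ) (f : X → ℂ) (m : ℕ) (x : X) : ℂ :=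
  ∑ i ∈ Finset.range m, ε i x*T.tm f i x
def Em {X : Type*} [MeasurableSpace X] {σ : Measure X} {ι : Type*} [MeasurableSpace ι]
    (T : TD σ ι) (ε : ℕ → X → ℂ) (f : X → ℂ) (m : ℕ) (x : X) : ℂ :=
  T.b x*T.aa f 0 x + ∑ i ∈ Finset.range m, ε i x*T.Dl f i x
theorem Em_eq (ε : ℕ → X → ℂ) (f : X → ℂ) (m : ℕ) (x : X) :
    T.Em ε f m x = T.b x*T.ae ε f m x+T.ph ε f m x := by
  unfold Em ae ph Dl
  rw [mul_add, Finset.mul_sum, add_assoc, ← Finset.sum_add_distrib]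
  congr 1
  exact Finset.sum_congr rfl fun i _ => by ring
variable {T} {ε : ℕ → X → ℂ} (hε : T.Sel ε) {f : X → ℂ} (hf : BM f)
theorem ae_km (hε : T.Sel ε) (f : X → ℂ) (m : ℕ) : KM (T.π m) (T.ae ε f m) := by
  intro x y h
  unfold ae
  rw [T.aa_km f 0 x y (km_le T.nest (Nat.zero_le m) x y h)]
  congr 1
  refine Finset.sum_congr rfl fun i hi => ?_
  have hi := Finset.mem_range.1 hi
  rw [hε.km i x y (km_le T.nest hi.le x y h), T.da_km f i x y (km_le T.nest hi x y h)]
theorem ae_bm (hε : T.Sel ε) (hf : BM f) (m : ℕ) : BM (T.ae ε f m) :=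
  (T.aa_bm hf 0).add (BM.sum _ fun i => (hε.bm i).mul (T.da_bm hf i))
theorem ph_bm (hε : T.Sel ε) (hf : BM f) (m : ℕ) : BM (T.ph ε f m) :=
  (BM.sum _ fun i => (hε.bm i).mul (T.tm_bm hf i))
theorem Em_bm (hε : T.Sel ε) (hf : BM f) (m : ℕ) : BM (T.Em ε f m) :=
  (T.bb.mul (T.aa_bm hf 0)).add (BM.sum _ fun i => (hε.bm i).mul (T.Dl_bm hf i))
theorem avg_add' {p : X → ι} {f g : X → ℂ} (hf : BM f) (hg : BM g) (x : X) :
    avg σ p (fun y => f y+g y) x = avg σ p f x+avg σ p g x := by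
  unfold avg
  rw [integral_add hf.int.integrableOn hg.int.integrableOn, mul_add]
theorem avg_sum' {p : X → ι} (s : Finset ℕ) {f : ℕ → X → ℂ} (hf : ∀ i, BM (f i)) (x : X)
    (h : ∀ i ∈ s, avg σ p (f i) x =0) : avg σ p (fun y => ∑ i ∈ s, f i y) x =0 := by
  unfold avg at h ⊢
  rw [integral_finset_sum _ (fun i _ => (hf i).int.integrableOn), Finset.mul_sum]
  exact Finset.sum_eq_zero h
theorem ae_tr (hε : T.Sel ε) (hf : BM f) (k : ℕ) (x : X) (h : T.Tr k x) :
    ‖T.ae ε f k x‖ ≤ T.τ⁻¹*mx σ T.π (T.Em ε f T.N) k x := by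
  have hkN : k ≤ T.N := by
    by_contra hk; exact T.trN x (T.Tr_le (by omega) h)
  have e : T.Em ε f T.N = fun y => (T.ae ε f k y*T.b y+T.ph ε f k y)
      + ∑ i ∈ Finset.Ico k T.N, ε i y*T.Dl f i y := by
    funext y
    rw [mul_comm (T.ae ε f k y), ← T.Em_eq ε f k y]
    unfold Em
    rw [add_assoc, Finset.sum_range_add_sum_Ico _ hkN]
  have h1 : avg σ (T.π k) (T.Em ε f T.N) x = T.ae ε f k x*avg σ (T.π k) T.b x := by
    rw [e, avg_add' (((ae_bm hε hf k).mul T.bb).add (ph_bm hε hf k))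
      (BM.sum _ fun i => (hε.bm i).mul (T.Dl_bm hf i)),
      avg_add' ((ae_bm hε hf k).mul T.bb) (ph_bm hε hf k),
      avg_mul (ae_km hε f k) (T.mπ k)]
    rw [avg_sum' _ (fun i => (hε.bm i).mul (T.Dl_bm hf i)) x (fun i hi =>
      T.avg_Dl hf (Finset.mem_Ico.1 hi).1 (hε.km i) (hε.bm i) x)]
    have : avg σ (T.π k) (T.ph ε f k) x =0 := by
      unfold avg
      rw [setIntegral_eq_zero_of_forall_eq_zero, mul_zero]
      intro y hy
      have hy' : T.Tr k y := by rw [T.trk k y x hy]; exact h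
      unfold ph
      refine Finset.sum_eq_zero fun i hi => ?_
      have : ¬ T.nt i y := fun h => h.2 (T.Tr_le (Finset.mem_range.1 hi) hy')
      simp [tm, this]
    rw [this]; ring
  have h2 := norm_avg_le_mx (σ := σ) (π := T.π) (T.Em ε f T.N) k x
  rw [h1, norm_mul] at h2
  rw [← div_eq_inv_mul, le_div_iff₀ T.τ0]
  exact (mul_le_mul_of_nonneg_left (T.low k x h) (norm_nonneg _)).trans h2
theorem ae_le (hε : T.Sel ε) (hf : BM f) (k : ℕ) (x : X) :
    ‖T.ae ε f k x‖ ≤ T.τ⁻¹*(mx σ T.π (T.Em ε f T.N) k x+mx σ T.π f k x) := by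
  have ht := inv_pos.2 T.τ0
  induction k with
  | zero =>
    refine (ae_tr hε hf 0 x (T.tr0 x)).trans ?_
    gcongr; linarith [mx_nonneg (σ := σ) (π := T.π) f 0 x]
  | succ k ih =>
    by_cases h : T.Tr (k+1) x
    · refine (ae_tr hε hf _ x h).trans ?_
      gcongr; linarith [mx_nonneg (σ := σ) (π := T.π) f (k+1) x]
    · have m1 := mx_mono (σ := σ) (π := T.π) f (Nat.le_succ k) x
      have m2 := mx_mono (σ := σ) (π := T.π) (T.Em ε f T.N) (Nat.le_succ k) x
      have e : T.ae ε f (k+1) x = T.ae ε f k x-ε k x*T.aa f k x := by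
        simp only [ae, Finset.sum_range_succ, da, aa, h, if_false]; ring
      by_cases h0 : T.Tr k x
      · rw [e, mul_add]
        refine (norm_sub_le _ _).trans (add_le_add ?_ ?_)
        · exact (ae_tr hε hf k x h0).trans (by gcongr)
        · rw [norm_mul]
          refine (mul_le_of_le_one_left (norm_nonneg _) (hε.le k x)).trans ?_
          refine (T.aa_norm f k x).trans ?_
          gcongr
          exact (norm_avg_le_mx f k x).trans m1
      · have : T.aa f k x =0 := by simp [aa, h0]
        rw [e, this, mul_zero, sub_zero]
        exact ih.trans (by gcongr)
theorem q_aa_le (T : TD σ ι) (hf : BM f) (k : ℕ) : q σ (T.aa f k) ≤ T.τ⁻¹^2*q σ f := by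
  have h := q_avg_le (σ := σ) (T.mπ k) hf
  refine le_trans ?_ (mul_le_mul_of_nonneg_left h (sq_nonneg _))
  unfold q
  rw [← integral_const_mul]
  have bA := avg_bm (σ := σ) (T.mπ k) hf
  refine integral_mono (T.aa_bm hf k).norm.pow.int ((BM.const _).mul bA.norm.pow).int fun x => ?_
  simp only [← mul_pow]
  exact pow_le_pow_left₀ (norm_nonneg _) (T.aa_norm f k x) 2
theorem q_add_le {f g : X → ℂ} (hf : BM f) (hg : BM g) :
    q σ (fun x => f x+g x) ≤2*q σ f+2*q σ g := by
  unfold q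
  rw [← integral_const_mul, ← integral_const_mul, ← integral_add
    ((BM.const _).mul hf.norm.pow).int ((BM.const _).mul hg.norm.pow).int]
  refine integral_mono (hf.add hg).norm.pow.int
    (((BM.const _).mul hf.norm.pow).add ((BM.const _).mul hg.norm.pow)).int fun x => ?_
  simp only []
  have := pow_le_pow_left₀ (norm_nonneg _) (norm_add_le (f x) (g x)) 2
  nlinarith [sq_nonneg (‖f x‖-‖g x‖)]
theorem q_b_mul (T : TD σ ι) {g : X → ℂ} (hg : BM g) : q σ (fun x => T.b x*g x) ≤ q σ g := by
  refine integral_mono (T.bb.mul hg).norm.pow.int hg.norm.pow.int fun x => ?_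
  simp only [norm_mul]
  exact pow_le_pow_left₀ (by positivity) (mul_le_of_le_one_left (norm_nonneg _) (T.b1 x)) 2
def CE {X : Type*} [MeasurableSpace X] {σ : Measure X} {ι : Type*} [MeasurableSpace ι]
    (T : TD σ ι) : ℝ :=2*T.τ⁻¹^2+2*T.CC^2
theorem q_Em_le (hε : T.Sel ε) (hf : BM f) (m : ℕ) : q σ (T.Em ε f m) ≤ T.CE*q σ f := by
  have h := q_add_le (σ := σ) (T.bb.mul (T.aa_bm hf 0))
    (BM.sum (Finset.range m) fun i => (hε.bm i).mul (T.Dl_bm hf i))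
  have h1 := (q_b_mul T (T.aa_bm hf 0)).trans (q_aa_le T hf 0)
  have h2 := T.q_sum_le hf hε.km hε.bm m
  have h3 : ∑ k ∈ Finset.range m, ∫ x, ‖ε k x‖^2*T.GG f f k x^2 ∂σ ≤ T.CC*q σ f := by
    refine le_trans ?_ (T.sqG hf hf (fun _ => le_rfl) m)
    refine int_sum_mono (fun k => (hε.bm k).norm.pow.mul (T.GG_bm hf hf k).pow)
      (fun k => (T.GG_bm hf hf k).pow) fun k x => ?_
    exact mul_le_of_le_one_left (sq_nonneg _) (pow_le_one₀ (norm_nonneg _) (hε.le k x))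
  have h4 := mul_le_mul_of_nonneg_left h3 T.CC_pos.le
  unfold Em at *
  unfold CE
  nlinarith
end TD
section form
variable {X : Type*} [MeasurableSpace X] {𝕜 : Type*} [RCLike 𝕜] {σ : Measure X} [IsFiniteMeasure σ]
theorem BM.fst {f : X → 𝕜} (hf : BM f) : BM (fun z : X × X => f z.1) :=
  ⟨hf.m.comp measurable_fst, hf.b.imp fun C hC z => hC z.1⟩
theorem BM.snd {f : X → 𝕜} (hf : BM f) : BM (fun z : X × X => f z.2) :=
  ⟨hf.m.comp measurable_snd, hf.b.imp fun C hC z => hC z.2⟩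
def fm {X : Type*} [MeasurableSpace X] (σ : Measure X) (k : X → X → ℂ) (f g : X → ℂ) : ℂ :=
  ∫ z : X × X, k z.1 z.2*(f z.2*g z.1) ∂(σ.prod σ)
variable {k : X → X → ℂ} (hk : BM (fun z : X × X => k z.1 z.2))
theorem fm_bm (hk : BM (fun z : X × X => k z.1 z.2)) {f g : X → ℂ} (hf : BM f) (hg : BM g) :
    BM (fun z : X × X => k z.1 z.2*(f z.2*g z.1)) := hk.mul (hf.snd.mul hg.fst)
theorem fm_add_left (hk : BM (fun z : X × X => k z.1 z.2)) {f f' g : X → ℂ} (hf : BM f)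
    (hf' : BM f') (hg : BM g) : fm σ k (fun x => f x+f' x) g = fm σ k f g+fm σ k f' g := by
  unfold fm
  rw [← integral_add (fm_bm hk hf hg).int (fm_bm hk hf' hg).int]
  congr 1; funext z; ring
theorem fm_add_right (hk : BM (fun z : X × X => k z.1 z.2)) {f g g' : X → ℂ} (hf : BM f)
    (hg : BM g) (hg' : BM g') : fm σ k f (fun x => g x+g' x) = fm σ k f g+fm σ k f g' := by
  unfold fm
  rw [← integral_add (fm_bm hk hf hg).int (fm_bm hk hf hg').int]
  congr 1; funext z; ring
theorem fm_smul_left (c : ℂ) (f g : X → ℂ) : fm σ k (fun x => c*f x) g = c*fm σ k f g := by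
  unfold fm
  rw [← integral_const_mul]; congr 1; funext z; ring
theorem fm_smul_right (c : ℂ) (f g : X → ℂ) : fm σ k f (fun x => c*g x) = c*fm σ k f g := by
  unfold fm
  rw [← integral_const_mul]; congr 1; funext z; ring
theorem int_swap_anti {F : X × X → ℂ} (h : ∀ z, F z.swap = - F z) :
    ∫ z, F z ∂(σ.prod σ) =0 := by
  have h1 : ∫ z, F z.swap ∂(σ.prod σ) = ∫ z, F z ∂(σ.prod σ) := integral_prod_swap F
  simp only [h, integral_neg] at h1
  exact self_eq_neg.1 h1.symm
theorem fm_swap (ha : ∀ x y, k x y = - k y x) (f g : X → ℂ) : fm σ k f g = - fm σ k g f := by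
  unfold fm
  rw [← integral_prod_swap, ← integral_neg]
  congr 1; funext z
  simp only [Prod.fst_swap, Prod.snd_swap]
  rw [ha z.2 z.1]; ring
theorem q_smul (c : ℂ) (f : X → ℂ) : q σ (fun x => c*f x) = ‖c‖^2*q σ f := by
  unfold q
  rw [← integral_const_mul]; congr 1; funext x; rw [norm_mul, mul_pow]
def NB {X : Type*} [MeasurableSpace X] (σ : Measure X) (k : X → X → ℂ) (N : ℝ) : Prop :=
  ∀ f g : X → ℂ, BM f → BM g → ‖fm σ k f g‖ ≤ N*(q σ f+q σ g)
theorem NB.scale {N : ℝ} (h : NB σ k N) {f g : X → ℂ} (hf : BM f) (hg : BM g) {t : ℝ} (ht :0 < t) :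
    ‖fm σ k f g‖ ≤ N*(t*q σ f+t⁻¹*q σ g) := by
  set c : ℂ := ((√t : ℝ) : ℂ) with hc
  have hs :0 < √t := Real.sqrt_pos.2 ht
  have c0 : c ≠ 0 := by rw [hc]; exact_mod_cast hs.ne'
  have h1 := h (fun x => c*f x) (fun x => c⁻¹*g x) ((BM.const c).mul hf) ((BM.const _).mul hg)
  rw [fm_smul_left, fm_smul_right, q_smul, q_smul, mul_inv_cancel_left₀ c0, norm_inv, inv_pow] at h1
  have : ‖c‖^2 = t := by
    rw [hc, Complex.norm_real, Real.norm_eq_abs, sq_abs, Real.sq_sqrt ht.le]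
  rwa [this] at h1
variable {κ : Type*} [Countable κ] [MeasurableSpace κ] [DiscreteMeasurableSpace κ]
theorem hasSum_fib {Y : Type*} [MeasurableSpace Y] {ν : Measure Y} [IsFiniteMeasure ν] {p : Y → κ}
    (hp : Measurable p) {f : Y → 𝕜} (hf : Integrable f ν) :
    HasSum (fun i => ∫ x in p ⁻¹' {i}, f x ∂ν) (∫ x, f x ∂ν) := by
  have := hasSum_integral_iUnion (μ := ν) (f := f) (fun i => hp (measurableSet_singleton i))
    (fun i j hij => Disjoint.preimage _ (by simpa using hij)) hf.integrableOn
  rwa [← preimage_iUnion, iUnion_of_singleton, preimage_univ, Measure.restrict_univ] at this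
open Classical in
theorem shift_bound (hk : BM (fun z : X × X => k z.1 z.2)) {N : ℝ} (hN0 :0 ≤ N) (hN : NB σ k N)
    {idx : X → κ} (hi : Measurable idx) {sh : κ → κ} (hsh : Function.Injective sh) (Z : κ → Prop)
    {u v : X → ℂ} (hu : BM u) (hv : BM v) :
    ‖∫ z : X × X, (if idx z.2 = sh (idx z.1) ∧ Z (idx z.1) then
      k z.1 z.2*(u z.2*v z.1) else 0) ∂(σ.prod σ)‖ ≤ N*(q σ u+q σ v) := by
  have m1 : Measurable (fun z : X × X => idx z.1) := hi.comp measurable_fst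
  have m2 : Measurable (fun z : X × X => idx z.2) := hi.comp measurable_snd
  have mS : MeasurableSet {z : X × X | idx z.2 = sh (idx z.1) ∧ Z (idx z.1)} := by
    have : Measurable (fun z : X × X => (idx z.1, idx z.2)) := m1.prodMk m2
    exact this (MeasurableSet.of_discrete (s := {w : κ × κ | w.2 = sh w.1 ∧ Z w.1}))
  have bF := (fm_bm hk hu hv).ite (BM.const 0) mS
  have bi : ∀ (w : X → ℂ), BM w → ∀ i, BM (fun x => if idx x = i then w x else 0) := fun w hw i =>
    hw.ite (BM.const 0) (hi (measurableSet_singleton i))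
  have e : ∀ i, ∫ z in (fun z : X × X => idx z.1) ⁻¹' {i}, (if idx z.2 = sh (idx z.1) ∧ Z (idx z.1)
      then k z.1 z.2*(u z.2*v z.1) else 0) ∂(σ.prod σ) = if Z i then
        fm σ k (fun x => if idx x = sh i then u x else 0) (fun x => if idx x = i then v x else 0)
        else 0 := by
    intro i
    rw [← integral_indicator (m1 (measurableSet_singleton i))]
    by_cases hZ : Z i
    · rw [if_pos hZ]; unfold fm
      congr 1; funext z
      by_cases h1 : idx z.1 = i
      · by_cases h2 : idx z.2 = sh i <;> simp [indicator, h1, h2, hZ]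
      · simp [indicator, h1]
    · rw [if_neg hZ]
      rw [← integral_zero (X × X) ℂ (μ := σ.prod σ)]
      congr 1; funext z
      by_cases h1 : idx z.1 = i <;> simp [indicator, h1, hZ]
  have qe : ∀ (w : X → ℂ) (i : κ), q σ (fun x => if idx x = i then w x else 0)
      = ∫ x in idx ⁻¹' {i}, ‖w x‖^2 ∂σ := by
    intro w i
    unfold q
    rw [← integral_indicator (hi (measurableSet_singleton i))]
    congr 1; funext x
    by_cases h : idx x = i <;> simp [indicator, h]
  have hsv := hasSum_fib (ν := σ) hi hv.norm.pow.int
  have hsu := hasSum_fib (ν := σ) hi hu.norm.pow.int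
  have hs0 : ∀ i,0 ≤ ∫ x in idx ⁻¹' {i}, ‖u x‖^2 ∂σ := fun i =>
    integral_nonneg fun _ => sq_nonneg _
  have hsu' := (hsu.summable.comp_injective hsh).hasSum
  have le' : ∑' i, ((fun i => ∫ x in idx ⁻¹' {i}, ‖u x‖^2 ∂σ) ∘ sh) i ≤ q σ u := by
    have := tsum_comp_le_tsum_of_inj hsu.summable hs0 hsh
    exact this.trans hsu.tsum_eq.le
  have hb := (hasSum_fib (ν := σ.prod σ) m1 bF.int)
  rw [← hb.tsum_eq]
  refine (tsum_of_norm_bounded ((hsu'.add hsv).mul_left N) fun i => ?_).trans ?_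
  · rw [e i]
    split_ifs
    · have := hN _ _ (bi u hu (sh i)) (bi v hv i)
      rwa [qe, qe] at this
    · rw [norm_zero]
      have :0 ≤ ∫ x in idx ⁻¹' {i}, ‖v x‖^2 ∂σ := integral_nonneg fun _ => sq_nonneg _
      exact mul_nonneg hN0 (add_nonneg (hs0 _) this)
  · refine mul_le_mul_of_nonneg_left (add_le_add_left le' _) hN0
def nbr {d : ℕ} (m : ℤ) (p p' : Fin d → ℤ) : Prop := ∀ i, |p i-p' i| ≤ m
open Classical in
theorem box_bound {d : ℕ} (hk : BM (fun z : X × X => k z.1 z.2)) {N : ℝ} (hN0 :0 ≤ N)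
    (hN : NB σ k N) {idx : X → Fin d → ℤ} (hi : Measurable idx)
    (Z : (Fin d → ℤ) → (Fin d → ℤ) → Prop) {u v : X → ℂ} (hu : BM u) (hv : BM v) {t : ℝ}
    (ht :0 < t) :
    ‖∫ z : X × X, (if nbr 1 (idx z.1) (idx z.2) ∧ Z (idx z.1) (idx z.2) then
      k z.1 z.2*(u z.2*v z.1) else 0) ∂(σ.prod σ)‖ ≤3^d*N*(t*q σ u+t⁻¹*q σ v) := by
  have main : ∀ u v : X → ℂ, BM u → BM v → ‖∫ z : X × X, (if nbr 1 (idx z.1) (idx z.2) ∧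
      Z (idx z.1) (idx z.2) then k z.1 z.2*(u z.2*v z.1) else 0) ∂(σ.prod σ)‖
      ≤3^d*N*(q σ u+q σ v) := by
    intro u v hu hv
    let sh : (Fin d → Fin 3) → (Fin d → ℤ) → (Fin d → ℤ) := fun s p i => p i+(s i : ℤ)-1
    have inj : ∀ s, Function.Injective (sh s) := fun s p p' h => by
      funext i; have := congrFun h i; simp only [sh] at this; omega
    have e : ∀ z : X × X, (if nbr 1 (idx z.1) (idx z.2) ∧
      Z (idx z.1) (idx z.2) then k z.1 z.2*(u z.2*v z.1) else 0)
      = ∑ s : Fin d → Fin 3, (if idx z.2 = sh s (idx z.1) ∧ Z (idx z.1) (sh s (idx z.1)) then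
        k z.1 z.2*(u z.2*v z.1) else 0) := by
      intro z
      by_cases h : nbr 1 (idx z.1) (idx z.2)
      · have hs : ∀ i, ∃ s : Fin 3, idx z.2 i = idx z.1 i+(s : ℤ)-1 := by
          intro i
          have := abs_le.1 (h i)
          refine ⟨⟨(idx z.2 i-idx z.1 i+1).toNat, by omega⟩, ?_⟩
          simp only []; omega
        choose s hs using hs
        have hs' : idx z.2 = sh s (idx z.1) := funext hs
        rw [Finset.sum_eq_single s]
        · rw [← hs']; simp [h]
        · intro s' _ hne
          rw [if_neg]
          rintro ⟨h2, _⟩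
          refine hne (funext fun i => Fin.ext ?_)
          have := congrFun (hs'.symm.trans h2) i
          simp only [sh] at this; omega
        · simp
      · rw [if_neg (fun hh => h hh.1)]
        symm
        refine Finset.sum_eq_zero fun s _ => ?_
        rw [if_neg]
        rintro ⟨h2, _⟩
        refine h fun i => ?_
        rw [h2, abs_le]; simp only [sh]
        have := (s i).2
        constructor <;> omega
    simp only [e]
    have mI : ∀ s, MeasurableSet {z : X × X | idx z.2 = sh s (idx z.1) ∧
        Z (idx z.1) (sh s (idx z.1))} := fun s => by
      have : Measurable (fun z : X × X => (idx z.1, idx z.2)) :=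
        (hi.comp measurable_fst).prodMk (hi.comp measurable_snd)
      exact this (MeasurableSet.of_discrete
        (s := {w : (Fin d → ℤ) × (Fin d → ℤ) | w.2 = sh s w.1 ∧ Z w.1 (sh s w.1)}))
    rw [integral_finset_sum _ (fun s _ => ((fm_bm hk hu hv).ite (BM.const 0) (mI s)).int)]
    refine (norm_sum_le _ _).trans ?_
    refine (Finset.sum_le_sum (g := fun _ => N*(q σ u+q σ v)) fun s _ =>
      le_of_eq_of_le (congrArg norm (congrArg (integral (σ.prod σ)) (funext fun z => by congr))) (shift_bound hk hN0 hN hi (inj s) (fun p => Z p (sh s p)) hu hv)).trans ?_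
    simp [mul_assoc]
  set c : ℂ := ((√t : ℝ) : ℂ) with hc
  have hs :0 < √t := Real.sqrt_pos.2 ht
  have c0 : c ≠ 0 := by rw [hc]; exact_mod_cast hs.ne'
  have h1 := main (fun x => c*u x) (fun x => c⁻¹*v x) ((BM.const c).mul hu) ((BM.const _).mul hv)
  rw [q_smul, q_smul, norm_inv, inv_pow] at h1
  have e2 : ‖c‖^2 = t := by
    rw [hc, Complex.norm_real, Real.norm_eq_abs, sq_abs, Real.sq_sqrt ht.le]
  rw [e2] at h1
  convert h1 using 5 with z
  field_simp
end form
section form2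
variable {X : Type*} [MeasurableSpace X] {σ : Measure X} [IsFiniteMeasure σ]
theorem q_mono {u v : X → ℂ} (hu : BM u) (hv : BM v) (h : ∀ x, ‖u x‖ ≤ ‖v x‖) : q σ u ≤ q σ v :=
  integral_mono hu.norm.pow.int hv.norm.pow.int fun x => pow_le_pow_left₀ (norm_nonneg _) (h x) 2
theorem nbr_symm {d : ℕ} {m : ℤ} {p p' : Fin d → ℤ} (h : nbr m p p') : nbr m p' p := fun i => by
  rw [abs_sub_comm]; exact h i
theorem nbr_trans {d : ℕ} {m m' : ℤ} {p p' p'' : Fin d → ℤ} (h : nbr m p p') (h' : nbr m' p' p'') :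
    nbr (m+m') p p'' := fun i => by
  have := abs_add_le (p i-p' i) (p' i-p'' i)
  rw [sub_add_sub_cancel] at this
  exact this.trans (add_le_add (h i) (h' i))
variable {k : X → X → ℂ}
open Classical in
theorem nb_bound {d : ℕ} (hk : BM (fun z : X × X => k z.1 z.2)) {N : ℝ} (hN0 :0 ≤ N)
    (hN : NB σ k N) {idx : X → Fin d → ℤ} (hi : Measurable idx)
    (B B' : (Fin d → ℤ) → Prop) {L L' : Set X} (mL : MeasurableSet L) (mL' : MeasurableSet L')
    {u v : X → ℂ} (hu : BM u) (hv : BM v)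
    (hB : ∀ x y, nbr 1 (idx x) (idx y) → B (idx x) ∨ B (idx y) → x ∈ L)
    (hB' : ∀ x y, nbr 1 (idx x) (idx y) → B' (idx x) ∨ B' (idx y) → y ∈ L')
    (hz : ∀ x y, nbr 1 (idx x) (idx y) → ¬ (B (idx x) ∨ B (idx y)) → ¬ (B' (idx x) ∨ B' (idx y)) →
      k y x*(u x*v y) = - (k x y*(u y*v x)))
    {t : ℝ} (ht :0 < t) :
    ‖∫ z : X × X, (if nbr 1 (idx z.1) (idx z.2) then k z.1 z.2*(u z.2*v z.1) else 0)
      ∂(σ.prod σ)‖ ≤3^d*N*(t*q σ u+t⁻¹*q σ (fun x => if x ∈ L then v x else 0)) +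
        3^d*N*(t⁻¹*q σ (fun x => if x ∈ L' then u x else 0)+t*q σ v) := by
  have bv : BM (fun x => if x ∈ L then v x else 0) := hv.ite (BM.const 0) mL
  have bu : BM (fun x => if x ∈ L' then u x else 0) := hu.ite (BM.const 0) mL'
  obtain ⟨Z2, hZ2⟩ : ∃ Z : (Fin d → ℤ) → (Fin d → ℤ) → Prop, ∀ p p', Z p p' ↔ (B p ∨ B p') := ⟨_, fun _ _ => Iff.rfl⟩
  obtain ⟨Z3, hZ3⟩ : ∃ Z : (Fin d → ℤ) → (Fin d → ℤ) → Prop, ∀ p p', Z p p' ↔ (¬ (B p ∨ B p') ∧ (B' p ∨ B' p')) := ⟨_, fun _ _ => Iff.rfl⟩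
  obtain ⟨Z1, hZ1⟩ : ∃ Z : (Fin d → ℤ) → (Fin d → ℤ) → Prop, ∀ p p', Z p p' ↔ (¬ (B p ∨ B p') ∧ ¬ (B' p ∨ B' p')) := ⟨_, fun _ _ => Iff.rfl⟩
  have mI : ∀ Z : (Fin d → ℤ) → (Fin d → ℤ) → Prop, MeasurableSet {z : X × X |
      nbr 1 (idx z.1) (idx z.2) ∧ Z (idx z.1) (idx z.2)} := fun Z => by
    have : Measurable (fun z : X × X => (idx z.1, idx z.2)) :=
      (hi.comp measurable_fst).prodMk (hi.comp measurable_snd)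
    exact this (MeasurableSet.of_discrete
      (s := {w : (Fin d → ℤ) × (Fin d → ℤ) | nbr 1 w.1 w.2 ∧ Z w.1 w.2}))
  have b1 := (fm_bm hk hu hv).ite (BM.const 0) (mI Z1)
  have b2 := (fm_bm hk hu bv).ite (BM.const 0) (mI Z2)
  have b3 := (fm_bm hk bu hv).ite (BM.const 0) (mI Z3)
  have e : ∀ z : X × X, (if nbr 1 (idx z.1) (idx z.2) then k z.1 z.2*(u z.2*v z.1) else 0)
      = (if nbr 1 (idx z.1) (idx z.2) ∧ Z1 (idx z.1) (idx z.2) then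
          k z.1 z.2*(u z.2*v z.1) else 0)
      + ((if nbr 1 (idx z.1) (idx z.2) ∧ Z2 (idx z.1) (idx z.2) then
          k z.1 z.2*(u z.2*(fun x => if x ∈ L then v x else 0) z.1) else 0)
      + (if nbr 1 (idx z.1) (idx z.2) ∧ Z3 (idx z.1) (idx z.2) then
          k z.1 z.2*((fun x => if x ∈ L' then u x else 0) z.2*v z.1) else 0)) := by
    intro z
    by_cases h : nbr 1 (idx z.1) (idx z.2)
    · by_cases h2 : B (idx z.1) ∨ B (idx z.2)
      · have := hB _ _ h h2
        simp [-not_or, hZ1, hZ2, hZ3, h, h2, this]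
      · by_cases h3 : B' (idx z.1) ∨ B' (idx z.2)
        · have := hB' _ _ h h3
          simp [-not_or, hZ1, hZ2, hZ3, h, h2, h3, this]
        · simp [-not_or, hZ1, hZ2, hZ3, h, h2, h3]
    · simp [h]
  simp only [e]
  rw [integral_add b1.int (b2.add b3).int, integral_add b2.int b3.int, int_swap_anti, zero_add]
  · refine (norm_add_le _ _).trans (add_le_add ?_ ?_)
    · exact box_bound hk hN0 hN hi Z2 hu bv ht
    · have := box_bound hk hN0 hN hi Z3 bu hv (inv_pos.2 ht)
      rwa [inv_inv] at this
  · intro z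
    simp only [Prod.fst_swap, Prod.snd_swap]
    by_cases h : nbr 1 (idx z.1) (idx z.2) ∧ Z1 (idx z.1) (idx z.2)
    · have h' : nbr 1 (idx z.2) (idx z.1) ∧ Z1 (idx z.2) (idx z.1) :=
        ⟨nbr_symm h.1, (hZ1 _ _).2 ⟨fun hh => ((hZ1 _ _).1 h.2).1 hh.symm,
          fun hh => ((hZ1 _ _).1 h.2).2 hh.symm⟩⟩
      rw [if_pos h, if_pos h']
      exact hz _ _ h.1 ((hZ1 _ _).1 h.2).1 ((hZ1 _ _).1 h.2).2
    · have h' : ¬ (nbr 1 (idx z.2) (idx z.1) ∧ Z1 (idx z.2) (idx z.1)) := fun hh =>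
        h ⟨nbr_symm hh.1, (hZ1 _ _).2 ⟨fun h4 => ((hZ1 _ _).1 hh.2).1 h4.symm,
          fun h4 => ((hZ1 _ _).1 hh.2).2 h4.symm⟩⟩
      rw [if_neg h, if_neg h', neg_zero]
theorem schur_one {P : X → X → ℝ} (hP : BM (fun z : X × X => P z.1 z.2)) (P0 : ∀ x y,0 ≤ P x y)
    (Ps : ∀ x y, P x y = P y x) {A : ℝ} (hA : ∀ x, ∫ y, P x y ∂σ ≤ A) {a c : X → ℝ} (ha : BM a)
    (hc : BM c) :
    ∫ z : X × X, P z.1 z.2*((a z.2+a z.1)*c z.1) ∂(σ.prod σ) ≤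
      A*(∫ x, a x^2 ∂σ + ∫ x, c x^2 ∂σ) := by
  have key : ∀ s : X → ℝ, BM s → (∀ x,0 ≤ s x) →
      ∫ z : X × X, P z.1 z.2*s z.1 ∂(σ.prod σ) ≤ A * ∫ x, s x ∂σ := by
    intro s hs s0
    have hb : BM (fun z : X × X => P z.1 z.2*s z.1) := hP.mul hs.fst
    rw [integral_prod _ hb.int, ← integral_const_mul]
    refine integral_mono hb.int.integral_prod_left ((BM.const A).mul hs).int fun x => ?_
    simp only [integral_mul_const]
    exact mul_le_mul_of_nonneg_right (hA x) (s0 x)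
  have key2 : ∀ s : X → ℝ, BM s → (∀ x,0 ≤ s x) →
      ∫ z : X × X, P z.1 z.2*s z.2 ∂(σ.prod σ) ≤ A * ∫ x, s x ∂σ := by
    intro s hs s0
    rw [← integral_prod_swap]
    simp only [Prod.fst_swap, Prod.snd_swap]
    refine le_trans (le_of_eq ?_) (key s hs s0)
    congr 1; funext z; rw [Ps]
  have h1 := key _ ha.pow fun x => sq_nonneg _
  have h2 := key2 _ ha.pow fun x => sq_nonneg _
  have h3 := key _ hc.pow fun x => sq_nonneg _
  have i1 : BM (fun z : X × X => P z.1 z.2*a z.1^2) := hP.mul ha.pow.fst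
  have i2 : BM (fun z : X × X => P z.1 z.2*a z.2^2) := hP.mul ha.pow.snd
  have i3 : BM (fun z : X × X => P z.1 z.2*c z.1^2) := hP.mul hc.pow.fst
  have : ∫ z : X × X, P z.1 z.2*((a z.2+a z.1)*c z.1) ∂(σ.prod σ) ≤
      ∫ z : X × X, (2⁻¹*(P z.1 z.2*a z.1^2)+(2⁻¹*(P z.1 z.2*a z.2^2)
        + P z.1 z.2*c z.1^2)) ∂(σ.prod σ) := by
    refine integral_mono (hP.mul ((ha.snd.add ha.fst).mul hc.fst)).int
      (((BM.const _).mul i1).add (((BM.const _).mul i2).add i3)).int fun z => ?_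
    simp only []
    have := mul_nonneg (P0 z.1 z.2) (add_nonneg (sq_nonneg (a z.2-c z.1)) (sq_nonneg (a z.1-c z.1)))
    nlinarith
  rw [integral_add ((BM.const _).mul i1).int (((BM.const _).mul i2).add i3).int,
    integral_add ((BM.const _).mul i2).int i3.int, integral_const_mul, integral_const_mul] at this
  linarith
theorem geo_sum {γ : ℝ} (g0 :0 < γ) (g1 : γ <1) {a : ℕ → ℝ} (ha : ∀ i,0 ≤ a i) {e : ℕ} (he : e ≤1)
    (n : ℕ) : ∑ k ∈ Finset.range n, ∑ i ∈ Finset.range (k+e), γ^(k-i)*a i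
      ≤ (1-γ)⁻¹ * ∑ i ∈ Finset.range n, a i := by
  have h1 : ∀ k ∈ Finset.range n, ∑ i ∈ Finset.range (k+e), γ^(k-i)*a i
      ≤ ∑ i ∈ Finset.range n, if i ≤ k then γ^(k-i)*a i else 0 := by
    intro k hk
    have hk := Finset.mem_range.1 hk
    rw [← Finset.sum_filter]
    refine Finset.sum_le_sum_of_subset_of_nonneg (fun i hi => ?_)
      (fun i _ _ => mul_nonneg (pow_nonneg g0.le _) (ha i))
    simp only [Finset.mem_range, Finset.mem_filter] at hi ⊢
    omega
  refine (Finset.sum_le_sum h1).trans ?_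
  rw [Finset.sum_comm, Finset.mul_sum]
  refine Finset.sum_le_sum fun i _ => ?_
  rw [← Finset.sum_filter, ← Finset.sum_mul]
  refine mul_le_mul_of_nonneg_right ?_ (ha i)
  have : ∑ k ∈ Finset.range n with i ≤ k, γ^(k-i) ≤ ∑ j ∈ Finset.range n, γ^j := by
    rw [← Finset.sum_image (f := fun j => γ^j) (g := fun k => k-i)]
    · refine Finset.sum_le_sum_of_subset_of_nonneg (fun j hj => ?_) (fun _ _ _ => pow_nonneg g0.le _)
      simp only [Finset.mem_image, Finset.mem_filter, Finset.mem_range] at hj ⊢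
      omega
    · intro x hx y hy h
      simp only [Finset.coe_filter, Finset.mem_range, mem_setOf_eq] at hx hy h
      omega
  refine this.trans ?_
  rw [← tsum_geometric_of_lt_one g0.le g1]
  exact (summable_geometric_of_lt_one g0.le g1).sum_le_tsum _ (fun _ _ => pow_nonneg g0.le _)
theorem geo_sum2 {γ : ℝ} (g0 :0 < γ) (g1 : γ <1) {e : ℕ} (he : e ≤1)
    (k : ℕ) : ∑ i ∈ Finset.range (k+e), γ^(k-i) ≤ (1-γ)⁻¹ := by
  have : ∑ i ∈ Finset.range (k+e), γ^(k-i) ≤ ∑ i ∈ Finset.range (k+1), γ^(k-i) :=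
    Finset.sum_le_sum_of_subset_of_nonneg (Finset.range_mono (by omega))
      (fun _ _ _ => pow_nonneg g0.le _)
  refine this.trans ?_
  have h2 := Finset.sum_range_reflect (fun j => γ^j) (k+1)
  simp only [Nat.add_sub_cancel] at h2
  rw [h2, ← tsum_geometric_of_lt_one g0.le g1]
  exact (summable_geometric_of_lt_one g0.le g1).sum_le_tsum _ (fun _ _ => pow_nonneg g0.le _)
theorem schur_sum {P : ℕ → X → X → ℝ} (hP : ∀ j, BM (fun z : X × X => P j z.1 z.2))
    (P0 : ∀ j x y,0 ≤ P j x y) (Ps : ∀ j x y, P j x y = P j y x) {A : ℝ} (A0 :0 ≤ A)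
    (hA : ∀ j x, ∫ y, P j x y ∂σ ≤ A)
    {a c : ℕ → X → ℝ} (ha : ∀ i, BM (a i)) (hc : ∀ i, BM (c i))
    {γ C : ℝ} (g0 :0 < γ) (g1 : γ <1) (C0 :0 ≤ C) {e : ℕ} (he : e ≤1) {F : ℕ → X × X → ℂ}
    (hF : ∀ k z, ‖F k z‖ ≤ ∑ i ∈ Finset.range (k+e),
      C*γ^(k-i)*(P k z.1 z.2*((a i z.2+a i z.1)*c k z.1))) (n : ℕ) :
    ∑ k ∈ Finset.range n, ‖∫ z, F k z ∂(σ.prod σ)‖ ≤ C*A*(1-γ)⁻¹ *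
      (∑ i ∈ Finset.range n, ∫ x, a i x^2 ∂σ + ∑ i ∈ Finset.range n, ∫ x, c i x^2 ∂σ) := by
  have b : ∀ k i, BM (fun z : X × X => C*γ^(k-i)*(P k z.1 z.2*((a i z.2+a i z.1)*c k z.1))) :=
    fun k i => (BM.const _).mul ((hP k).mul (((ha i).snd.add (ha i).fst).mul (hc k).fst))
  have h1 : ∀ k, ‖∫ z, F k z ∂(σ.prod σ)‖ ≤ ∑ i ∈ Finset.range (k+e),
      C*A*(γ^(k-i) * ∫ x, a i x^2 ∂σ+γ^(k-i) * ∫ x, c k x^2 ∂σ) := by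
    intro k
    refine (norm_integral_le_of_norm_le (BM.sum _ (b k)).int (Filter.Eventually.of_forall (hF k))).trans ?_
    rw [integral_finset_sum _ (fun i _ => (b k i).int)]
    refine Finset.sum_le_sum fun i _ => ?_
    rw [integral_const_mul]
    have := mul_le_mul_of_nonneg_left (schur_one (hP k) (P0 k) (Ps k) (hA k) (ha i) (hc k))
      (mul_nonneg C0 (pow_nonneg g0.le (k-i)))
    refine this.trans (le_of_eq (by ring))
  refine (Finset.sum_le_sum fun k _ => h1 k).trans ?_
  simp only [← Finset.mul_sum, Finset.sum_add_distrib]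
  rw [mul_assoc (C*A)]
  refine mul_le_mul_of_nonneg_left ?_ (mul_nonneg C0 A0)
  rw [mul_add]
  refine add_le_add (geo_sum g0 g1 (fun i => integral_nonneg fun _ => sq_nonneg _) he n) ?_
  rw [Finset.mul_sum]
  refine Finset.sum_le_sum fun k _ => ?_
  rw [← Finset.sum_mul]
  exact mul_le_mul_of_nonneg_right (geo_sum2 g0 g1 he k) (integral_nonneg fun _ => sq_nonneg _)
end form2
section core
variable {X : Type*} [PseudoMetricSpace X] [MeasurableSpace X]
structure KH {X : Type*} [PseudoMetricSpace X] [MeasurableSpace X] (σ : Measure X)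
    (k : X → X → ℂ) (Φ : X → ℝ) (P : ℕ → X → X → ℝ) (ℓ : ℕ → ℝ) (b : X → ℂ) (γ A W D θ : ℝ) :
    Prop where
  bm : BM (fun z : X × X => k z.1 z.2)
  anti : ∀ x y, k x y = - k y x
  ph0 : ∀ x,0 ≤ Φ x
  sup : ∀ x y,2*dist x y ≤ Φ y → k x y =0
  far : ∀ j x x' y (m : ℕ), dist x x' ≤ D*ℓ j →3*D*ℓ j ≤ dist x y →
    ℓ j^2*2^m ≤ (dist x y+Φ y)^2 → ‖k x y-k x' y‖ ≤ A*γ^m*P j x y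
  mid : ∀ j x y, θ*ℓ j ≤ dist x y → dist x y ≤5*D*ℓ j → ‖k x y‖ ≤ A*P j x y
  pbm : ∀ j, BM (fun z : X × X => P j z.1 z.2)
  p0 : ∀ j x y,0 ≤ P j x y
  ps : ∀ j x y, P j x y = P j y x
  pA : ∀ j x, ∫ y, P j x y ∂σ ≤ A
  tb : ∀ x, ‖∫ y, k x y*b y ∂σ‖ ≤ W
  hl : ∀ j, ℓ j =2*ℓ (j+1)
  l0 : ∀ j,0 < ℓ j
  A0 :0 ≤ A
  g0 :0 < γ
  g1 : γ <1
  D1 :1 ≤ D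
structure BH {X : Type*} [PseudoMetricSpace X] [MeasurableSpace X] {d : ℕ} (ℓ : ℕ → ℝ) (θ : ℝ)
    (idx : ℕ → X → Fin d → ℤ) : Prop where
  m : ∀ j, Measurable (idx j)
  near : ∀ j x y (m : ℕ), dist x y ≤ m*(θ*ℓ j) → nbr m (idx j x) (idx j y)
  back : ∀ j x y (m : ℕ), nbr m (idx j x) (idx j y) → dist x y ≤ d*(m+1)*(θ*ℓ j)
  th0 :0 < θ
  th :8*d*θ ≤1
structure LH {X : Type*} [PseudoMetricSpace X] [MeasurableSpace X] {σ : Measure X} {ι : Type*}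
    [MeasurableSpace ι] (d : ℕ) (Φ : X → ℝ) (ℓ : ℕ → ℝ) (D θ : ℝ) (T : TD σ ι) (f : X → ℂ)
    (Lam : ℕ → Set X) : Prop where
  g0 : ∀ x y, T.π 0 x = T.π 0 y
  dm : ∀ k x y, T.π k x = T.π k y → dist x y ≤ D*ℓ k
  sup : ∀ i y s, f y ≠ 0 → T.nt i y → s ≤ ℓ i →
    (∀ z, dist z y < s → T.π (i+1) z = T.π (i+1) y) → s ≤ Φ y
  mL : ∀ k, MeasurableSet (Lam k)
  lam : ∀ k x z, dist z x ≤ d*(4*d+3)*(θ*ℓ k) → T.π (k+1) z ≠ T.π (k+1) x → x ∈ Lam k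
def GD {X : Type*} [PseudoMetricSpace X] [MeasurableSpace X] {σ : Measure X} {ι : Type*}
    [MeasurableSpace ι] (ℓ : ℕ → ℝ) (r : ℕ) (T : TD σ ι) (ε' : ℕ → X → ℂ) : Prop :=
  ∀ k x m z, ε' k x ≠ 0 →1 ≤ m → m+r ≤ k → T.π m z ≠ T.π m x → ℓ k*ℓ m ≤ dist z x^2
theorem lpow {ℓ : ℕ → ℝ} (hl : ∀ j, ℓ j =2*ℓ (j+1)) (i j : ℕ) : ℓ i =2^j*ℓ (i+j) := by
  induction j with
  | zero => simp
  | succ j ih => rw [ih, hl (i+j), pow_succ, ← add_assoc]; ring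
theorem lanti {ℓ : ℕ → ℝ} (hl : ∀ j, ℓ j =2*ℓ (j+1)) (l0 : ∀ j,0 < ℓ j) {i k : ℕ}
    (h : i ≤ k) : ℓ k ≤ ℓ i := by
  obtain ⟨j, rfl⟩ := Nat.exists_eq_add_of_le h
  rw [lpow hl i j]
  exact le_mul_of_one_le_left (l0 _).le (one_le_pow₀ (by norm_num))
def rp {X ι : Type*} (p : X → ι) (x : X) : X := @Function.invFun _ _ ⟨x⟩ p (p x)
theorem rp_km {X ι : Type*} (p : X → ι) : KM p (rp p) := fun x y h => by unfold rp; rw [h]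
theorem rp_eq {X ι : Type*} (p : X → ι) (x : X) : p (rp p x) = p x :=
  @Function.invFun_eq _ _ ⟨x⟩ p (p x) ⟨x, rfl⟩
variable {ι : Type*} [Countable ι] [MeasurableSpace ι] [DiscreteMeasurableSpace ι]
  {σ : Measure X} [IsFiniteMeasure σ] {k : X → X → ℂ} {Φ : X → ℝ} {P : ℕ → X → X → ℝ} {ℓ : ℕ → ℝ}
  {b : X → ℂ} {γ A W D θ : ℝ} {d r : ℕ} {idx : ℕ → X → Fin d → ℤ}
  {T T' : TD σ ι} {f g : X → ℂ} {Lam Lam' : ℕ → Set X} {ε ε' : ℕ → X → ℂ}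
theorem KH.sup' (K : KH σ k Φ P ℓ b γ A W D θ) {x y : X} (h :2*dist x y ≤ Φ x) : k x y =0 := by
  rw [K.anti, K.sup y x (by rwa [dist_comm]), neg_zero]
theorem good_cell (K : KH σ k Φ P ℓ b γ A W D θ) (L : LH d Φ ℓ D θ T f Lam)
    (L' : LH d Φ ℓ D θ T' g Lam') (hr :225*D^2 <2^r) (G : GD ℓ r T ε') {j : ℕ} {x x' : X}
    (hx : ε' j x ≠ 0) (h : T'.π j x' = T'.π j x) : T.π (j-r) x' = T.π (j-r) x := by
  by_contra hne
  rcases Nat.eq_zero_or_pos (j-r) with h0 | h0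
  · rw [h0] at hne; exact hne (L.g0 _ _)
  · have h1 := G j x (j-r) x' hx h0 (by omega) hne
    have h2 := L'.dm j _ _ h
    have h3 := lpow K.hl (j-r) r
    rw [Nat.sub_add_cancel (by omega)] at h3
    have l0 := K.l0 j
    have h4 : dist x' x^2 ≤ (D*ℓ j)^2 := pow_le_pow_left₀ dist_nonneg h2 2
    rw [h3] at h1
    have : (2:ℝ)^r*ℓ j^2 ≤ D^2*ℓ j^2 := by nlinarith
    have := le_of_mul_le_mul_right this (by positivity)
    nlinarith [sq_nonneg D]
open Classical in
def VV {X : Type*} [MeasurableSpace X] {σ : Measure X} {ι : Type*} [MeasurableSpace ι]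
    (T : TD σ ι) (f : X → ℂ) (ε : ℕ → X → ℂ) (r j i : ℕ) (x y : X) : ℂ :=
  ε i y*T.Dl f i y-if i+r < j then T.b y*(ε i x*T.da f i x) else 0
theorem VV_le (hε : T.Sel ε) (j i : ℕ) (x y : X) :
    ‖VV T f ε r j i x y‖ ≤ T.GG f f i y+T.GG f f i x := by
  unfold VV
  refine (norm_sub_le _ _).trans (add_le_add ?_ ?_)
  · rw [norm_mul]
    exact (mul_le_of_le_one_left (norm_nonneg _) (hε.le i y)).trans (T.Dl_le f i y)
  · split_ifs
    · rw [norm_mul, norm_mul]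
      have h1 := mul_le_of_le_one_left (norm_nonneg (T.da f i x)) (hε.le i x)
      have h2 := mul_le_of_le_one_left (mul_nonneg (norm_nonneg (ε i x)) (norm_nonneg (T.da f i x)))
        (T.b1 y)
      have h3 : ‖T.da f i x‖ ≤ T.GG f f i x := le_add_of_nonneg_right (T.tm_nonneg f i x)
      linarith
    · rw [norm_zero]; exact T.GG_nonneg f f i x
theorem VV_test (K : KH σ k Φ P ℓ b γ A W D θ) (L : LH d Φ ℓ D θ T f Lam) (hε : T.Sel ε)
    (G : GD ℓ r T ε') {j i : ℕ} {x y : X} (hx : ε' j x ≠ 0) (hi : i+r < j)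
    (h : VV T f ε r j i x y ≠ 0) : ℓ j^2*2^(j-i-1) ≤ (dist x y+Φ y)^2 := by
  have hl : ℓ (i+1) =2^(j-i-1)*ℓ j := by
    have := lpow K.hl (i+1) (j-i-1); rwa [show i+1+(j-i-1) = j by omega] at this
  rw [show ℓ j^2*2^(j-i-1) = ℓ j*ℓ (i+1) by rw [hl]; ring]
  have p0 := K.ph0 y
  have d0 :0 ≤ dist x y := dist_nonneg
  by_cases hc : T.π (i+1) y = T.π (i+1) x
  · have e1 := hε.km i _ _ (T.nest i _ _ hc)
    have e2 := T.da_km f i _ _ hc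
    have e3 : VV T f ε r j i x y = ε i y*T.tm f i y := by
      unfold VV TD.Dl; rw [if_pos hi, e1, e2]; ring
    rw [e3] at h
    have h4 := right_ne_zero_of_mul h
    have hnt : T.nt i y := by by_contra hh; simp [TD.tm, hh] at h4
    have hf : f y ≠ 0 := by simpa [TD.tm, hnt] using h4
    have la := lanti K.hl K.l0 (show i+1 ≤ j by omega)
    have la' := lanti K.hl K.l0 (show i ≤ i+1 by omega)
    have lj := K.l0 j
    have li := K.l0 (i+1)
    set t := √(ℓ j*ℓ (i+1)) with ht
    have t2 : t^2 = ℓ j*ℓ (i+1) := Real.sq_sqrt (by positivity)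
    have t0 :0 ≤ t := Real.sqrt_nonneg _
    have hs := L.sup i y (t-dist x y) hf hnt (by
      have : t ≤ ℓ (i+1) := by
        rw [ht]; refine Real.sqrt_le_iff.2 ⟨li.le, by nlinarith⟩
      linarith) (fun z hz => by
      by_contra hne
      rw [hc] at hne
      have h5 := G j x (i+1) z hx (by omega) (by omega) hne
      have h6 : dist z x < t := by
        have := dist_triangle z y x; rw [dist_comm y x] at this; linarith
      have h7 : (0:ℝ) ≤ dist z x := dist_nonneg
      nlinarith)
    rw [← t2]
    exact pow_le_pow_left₀ t0 (by linarith) 2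
  · refine (G j x (i+1) y hx (by omega) (by omega) hc).trans ?_
    rw [dist_comm]
    exact pow_le_pow_left₀ dist_nonneg (by linarith) 2
theorem VV_near (K : KH σ k Φ P ℓ b γ A W D θ) (L : LH d Φ ℓ D θ T f Lam) (hε : T.Sel ε)
    (hr :225*D^2 <2^r) (G : GD ℓ r T ε') {j i : ℕ} {x y : X} (hx : ε' j x ≠ 0)
    (hi : i+r < j) (hd : dist x y ≤5*D*ℓ j) : k x y*VV T f ε r j i x y =0 := by
  by_contra h
  have h1 := VV_test K L hε G hx hi (right_ne_zero_of_mul h)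
  have h2 : Φ y <2*dist x y := by
    by_contra hh; exact left_ne_zero_of_mul h (K.sup x y (not_lt.1 hh))
  have p0 := K.ph0 y
  have lj := K.l0 j
  have h3 : (dist x y+Φ y)^2 ≤ (15*D*ℓ j)^2 := pow_le_pow_left₀ (by positivity) (by linarith) 2
  have h4 : (2:ℝ)^r ≤2^(j-i-1) := pow_le_pow_right₀ (by norm_num) (by omega)
  have h5 : ℓ j^2*2^r ≤ ℓ j^2*(225*D^2) := by
    have := mul_le_mul_of_nonneg_left h4 (sq_nonneg (ℓ j))
    nlinarith
  have := le_of_mul_le_mul_left h5 (by positivity)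
  linarith
theorem Em_VV (L : LH d Φ ℓ D θ T f Lam) {e : ℕ} (j : ℕ) (x y : X) :
    T.Em ε f (j+e) y-T.b y*T.ae ε f (j-r) x
      = ∑ i ∈ Finset.range (j+e), VV T f ε r j i x y := by
  unfold TD.Em TD.ae VV
  rw [Finset.sum_sub_distrib, T.aa_km f 0 x y (L.g0 x y), mul_add, Finset.mul_sum,
    ← Finset.sum_filter]
  have : Finset.range (j-r) = Finset.filter (fun i => i+r < j) (Finset.range (j+e)) := by
    ext i; simp only [Finset.mem_range, Finset.mem_filter]; omega
  rw [this]; ring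
def uk {X : Type*} [MeasurableSpace X] {σ : Measure X} {ι : Type*} [MeasurableSpace ι]
    (T : TD σ ι) (f : X → ℂ) (ε : ℕ → X → ℂ) (r e j : ℕ) (y : X) : ℂ :=
  ∑ i ∈ Finset.Ico (j-r) (j+e), ε i y*T.Dl f i y
theorem near_eq (K : KH σ k Φ P ℓ b γ A W D θ) (L : LH d Φ ℓ D θ T f Lam) (hε : T.Sel ε)
    (hr :225*D^2 <2^r) (G : GD ℓ r T ε') {e j : ℕ} {x y : X} (hx : ε' j x ≠ 0)
    (hd : dist x y ≤5*D*ℓ j) :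
    k x y*(T.Em ε f (j+e) y-T.b y*T.ae ε f (j-r) x) = k x y*uk T f ε r e j y := by
  rw [Em_VV L (r := r), uk, Finset.mul_sum, Finset.mul_sum]
  symm
  have hs : Finset.Ico (j-r) (j+e) ⊆ Finset.range (j+e) := by
    intro i; simp only [Finset.mem_range, Finset.mem_Ico]; omega
  rw [← Finset.sum_subset hs]
  · refine Finset.sum_congr rfl fun i hi => ?_
    simp only [Finset.mem_Ico] at hi
    unfold VV; rw [if_neg (by omega), sub_zero]
  · intro i h1 h2
    simp only [Finset.mem_range, Finset.mem_Ico] at h1 h2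
    exact VV_near K L hε hr G hx (by omega) hd
end core
section core2
variable {X : Type*} [PseudoMetricSpace X] [MeasurableSpace X]
  {ι : Type*} [Countable ι] [MeasurableSpace ι] [DiscreteMeasurableSpace ι]
  {σ : Measure X} [IsFiniteMeasure σ] {k : X → X → ℂ} {Φ : X → ℝ} {P : ℕ → X → X → ℝ} {ℓ : ℕ → ℝ}
  {b : X → ℂ} {γ A W D θ : ℝ} {d r : ℕ} {idx : ℕ → X → Fin d → ℤ}
  {T T' : TD σ ι} {f g : X → ℂ} {Lam Lam' : ℕ → Set X} {ε ε' : ℕ → X → ℂ}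
def bad {X : Type*} [MeasurableSpace X] {σ : Measure X} {ι : Type*} [MeasurableSpace ι] {d : ℕ}
    (T : TD σ ι) (idx : ℕ → X → Fin d → ℤ) (j : ℕ) (p : Fin d → ℤ) : Prop :=
  ∃ z z', nbr (4*d+1) p (idx j z) ∧ nbr (4*d+1) p (idx j z') ∧ T.π (j+1) z ≠ T.π (j+1) z'
theorem bad_lam (I : BH ℓ θ idx) (L : LH d Φ ℓ D θ T f Lam) {j : ℕ} {x y : X}
    (h : nbr 1 (idx j x) (idx j y)) (hb : bad T idx j (idx j x) ∨ bad T idx j (idx j y)) :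
    x ∈ Lam j := by
  have h0 : nbr 1 (idx j x) (idx j x) := fun i => by simp
  have key : ∀ w, nbr 1 (idx j x) (idx j w) → bad T idx j (idx j w) → x ∈ Lam j := by
    rintro w hw ⟨z, z', h1, h2, h3⟩
    have a1 : ∀ z, nbr (4*d+1) (idx j w) (idx j z) → T.π (j+1) z ≠ T.π (j+1) x → x ∈ Lam j := by
      intro z h1 h4
      have := nbr_symm (nbr_trans hw h1)
      have h5 := I.back j z x (4*d+2) (by
        intro i; have := this i; push_cast; linarith)
      refine L.lam j x z (h5.trans (le_of_eq ?_)) h4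
      push_cast; ring
    by_cases h4 : T.π (j+1) z = T.π (j+1) x
    · exact a1 z' h2 fun h5 => h3 (h4.trans h5.symm)
    · exact a1 z h1 h4
  rcases hb with hb | hb
  exacts [key x h0 hb, key y h hb]
theorem bad_cell {j : ℕ} {p : Fin d → ℤ} (hb : ¬ bad T idx j p) {z z' : X}
    (h : nbr (4*d+1) p (idx j z)) (h' : nbr (4*d+1) p (idx j z')) :
    T.π (j+1) z = T.π (j+1) z' := by
  by_contra hh; exact hb ⟨z, z', h, h', hh⟩
theorem tz (K : KH σ k Φ P ℓ b γ A W D θ) (I : BH ℓ θ idx) (L : LH d Φ ℓ D θ T f Lam) {i j : ℕ}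
    (hij : i ≤ j) {w : X} (hb : ¬ bad T idx j (idx j w)) (hw : Φ w <4*d*(θ*ℓ j)) :
    T.tm f i w =0 := by
  unfold TD.tm
  split_ifs with hnt
  · by_contra hf
    have := L.sup i w (4*d*(θ*ℓ j)) hf hnt (by
      have := lanti K.hl K.l0 hij
      have := mul_le_mul_of_nonneg_right I.th (K.l0 j).le
      have := K.l0 j
      nlinarith) (fun z hz => by
        have h1 := I.near j w z (4*d) (by rw [dist_comm]; push_cast; exact hz.le)
        exact km_le T.nest (Nat.succ_le_succ hij) _ _ (bad_cell hb (fun i => (h1 i).trans (by push_cast; omega))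
          (fun i => by simp; positivity)))
    linarith
  · rfl
theorem nb_anti (K : KH σ k Φ P ℓ b γ A W D θ) (I : BH ℓ θ idx) (L : LH d Φ ℓ D θ T f Lam)
    (L' : LH d Φ ℓ D θ T' g Lam') (hε : T.Sel ε) (hε' : T'.Sel ε') (hb : T.b = b) (hb' : T'.b = b)
    {e j : ℕ} (he : e ≤1) {x y : X} (h : nbr 1 (idx j x) (idx j y))
    (h1 : ¬ (bad T idx j (idx j x) ∨ bad T idx j (idx j y)))
    (h2 : ¬ (bad T' idx j (idx j x) ∨ bad T' idx j (idx j y))) :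
    k y x*(uk T f ε r e j x*(ε' j y*T'.Dl g j y)) =
      - (k x y*(uk T f ε r e j y*(ε' j x*T'.Dl g j x))) := by
  rw [K.anti y x]
  by_cases hk : k x y =0
  · simp [hk]
  push Not at h1 h2
  have hd := I.back j x y 1 (by exact_mod_cast h)
  have hx : Φ x <4*d*(θ*ℓ j) := by
    have : Φ x <2*dist x y := by by_contra hh; exact hk (K.sup' (not_lt.1 hh))
    push_cast at hd; linarith
  have hy : Φ y <4*d*(θ*ℓ j) := by
    have : Φ y <2*dist x y := by by_contra hh; exact hk (K.sup _ _ (not_lt.1 hh))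
    push_cast at hd; linarith
  have n0 : nbr (4*d+1) (idx j x) (idx j x) := fun i => by simp; positivity
  have n1 : nbr (4*d+1) (idx j x) (idx j y) := fun i => (h i).trans (by omega)
  have c1 : T.π (j+1) x = T.π (j+1) y := bad_cell h1.1 n0 n1
  have c2 : T'.π (j+1) x = T'.π (j+1) y := bad_cell h2.1 n0 n1
  have u1 : ∀ w, (¬ bad T idx j (idx j w)) → Φ w <4*d*(θ*ℓ j) →
      uk T f ε r e j w = b w * ∑ i ∈ Finset.Ico (j-r) (j+e), ε i w*T.da f i w := by
    intro w hw hw'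
    unfold uk TD.Dl
    rw [Finset.mul_sum]
    refine Finset.sum_congr rfl fun i hi => ?_
    simp only [Finset.mem_Ico] at hi
    rw [tz K I L (by omega) hw hw', hb]; ring
  have v1 : ∀ w, (¬ bad T' idx j (idx j w)) → Φ w <4*d*(θ*ℓ j) →
      T'.Dl g j w = b w*T'.da g j w := by
    intro w hw hw'
    unfold TD.Dl
    rw [tz K I L' le_rfl hw hw', hb', add_zero]
  rw [u1 x h1.1 hx, u1 y h1.2 hy, v1 x h2.1 hx, v1 y h2.2 hy, T'.da_km g j _ _ c2,
    hε'.km j _ _ (T'.nest j _ _ c2)]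
  have : ∑ i ∈ Finset.Ico (j-r) (j+e), ε i x*T.da f i x
      = ∑ i ∈ Finset.Ico (j-r) (j+e), ε i y*T.da f i y := by
    refine Finset.sum_congr rfl fun i hi => ?_
    simp only [Finset.mem_Ico] at hi
    have hi' : i+1 ≤ j+1 := by omega
    have c3 := km_le T.nest hi' _ _ c1
    rw [T.da_km f i _ _ c3, hε.km i _ _ (T.nest i _ _ c3)]
  rw [this]; ring
theorem uk_bm (hε : T.Sel ε) (hf : BM f) (e j : ℕ) : BM (uk T f ε r e j) :=
  BM.sum _ fun i => (hε.bm i).mul (T.Dl_bm hf i)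
def et {X : Type*} [MeasurableSpace X] {σ : Measure X} {ι : Type*} [MeasurableSpace ι]
    (T : TD σ ι) (f : X → ℂ) (ε ε' : ℕ → X → ℂ) (r j : ℕ) (x : X) : ℂ :=
  T.ae ε f (j-r) x*ε' j x
theorem et_km (K : KH σ k Φ P ℓ b γ A W D θ) (L : LH d Φ ℓ D θ T f Lam)
    (L' : LH d Φ ℓ D θ T' g Lam') (hε : T.Sel ε) (hε' : T'.Sel ε') (hr :225*D^2 <2^r)
    (G : GD ℓ r T ε') (j : ℕ) : KM (T'.π j) (et T f ε ε' r j) := by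
  intro x y h
  unfold et
  rw [hε'.km j x y h]
  by_cases hy : ε' j y =0
  · simp [hy]
  · rw [ae_km' hε f h (good_cell K L L' hr G hy h)]
where
  ae_km' {x y : X} {j : ℕ} (hε : T.Sel ε) (f : X → ℂ) (h : T'.π j x = T'.π j y)
    (h2 : T.π (j-r) x = T.π (j-r) y) : T.ae ε f (j-r) x = T.ae ε f (j-r) y :=
    TD.ae_km hε f _ _ _ h2
open Classical in
def sk {X : Type*} [PseudoMetricSpace X] [MeasurableSpace X] {σ : Measure X} {ι : Type*}
    [MeasurableSpace ι] {d : ℕ} (T' : TD σ ι) (k : X → X → ℂ) (idx : ℕ → X → Fin d → ℤ) (ℓ : ℕ → ℝ)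
    (D : ℝ) (j : ℕ) (x y : X) : ℂ :=
  if 4*D*ℓ j < dist (rp (T'.π j) x) y then k x y-k (rp (T'.π j) x) y
  else if nbr 1 (idx j x) (idx j y) then 0 else k x y
open Classical in
theorem sk_le (K : KH σ k Φ P ℓ b γ A W D θ) (I : BH ℓ θ idx) (L : LH d Φ ℓ D θ T f Lam)
    (L' : LH d Φ ℓ D θ T' g Lam') (hε : T.Sel ε) (hr :225*D^2 <2^r) (G : GD ℓ r T ε')
    {i j : ℕ} {x y : X} (hx : ε' j x ≠ 0) :
    ‖sk T' k idx ℓ D j x y*VV T f ε r j i x y‖ ≤ A*γ⁻¹^(r+1)*γ^(j-i) *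
      (P j x y*(T.GG f f i y+T.GG f f i x)) := by
  have g0 := K.g0
  have A0 := K.A0
  have p0 := K.p0 j x y
  have V0 :0 ≤ T.GG f f i y+T.GG f f i x :=
    add_nonneg (T.GG_nonneg f f i y) (T.GG_nonneg f f i x)
  have hgi :1 ≤ γ⁻¹ := (one_le_inv₀ g0).2 K.g1.le
  by_cases h0 : sk T' k idx ℓ D j x y*VV T f ε r j i x y =0
  · rw [h0, norm_zero]; positivity
  have hV := right_ne_zero_of_mul h0
  have hdx := L'.dm j x _ (rp_eq (T'.π j) x).symm
  have lj := K.l0 j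
  have D1 := K.D1
  have main : ∀ m : ℕ, ‖sk T' k idx ℓ D j x y‖ ≤ A*γ^m*P j x y → j-i ≤ m+r+1 →
     ‖sk T' k idx ℓ D j x y*VV T f ε r j i x y‖ ≤ A*γ⁻¹^(r+1)*γ^(j-i) *
      (P j x y*(T.GG f f i y+T.GG f f i x)) := by
    intro m hm hmr
    have h1 : γ^m ≤ γ⁻¹^(r+1)*γ^(j-i) := by
      have : γ^(m+r+1) ≤ γ^(j-i) := pow_le_pow_of_le_one g0.le K.g1.le hmr
      calc γ^m = γ⁻¹^(r+1)*γ^(m+r+1) := by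
            rw [add_assoc m, pow_add γ m, inv_pow]; field_simp
        _ ≤ _ := by gcongr
    rw [norm_mul]
    calc _ ≤ (A*γ^m*P j x y)*(T.GG f f i y+T.GG f f i x) :=
          mul_le_mul hm (VV_le hε j i x y) (norm_nonneg _) (by positivity)
      _ ≤ (A*(γ⁻¹^(r+1)*γ^(j-i))*P j x y)*(T.GG f f i y+T.GG f f i x) := by gcongr
      _ = _ := by ring
  have tri := dist_triangle (rp (T'.π j) x) x y
  rw [dist_comm _ x] at tri
  have tri2 := dist_triangle x (rp (T'.π j) x) y
  by_cases hfar :4*D*ℓ j < dist (rp (T'.π j) x) y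
  · have es : sk T' k idx ℓ D j x y = k x y-k (rp (T'.π j) x) y := if_pos hfar
    have hrho :3*D*ℓ j ≤ dist x y := by linarith
    by_cases hi : i+r < j
    · refine main (j-i-1) ?_ (by omega)
      rw [es]
      exact K.far j x _ y _ hdx hrho (VV_test K L hε G hx hi hV)
    · refine main 0 ?_ (by omega)
      rw [es]
      refine K.far j x _ y _ hdx hrho ?_
      have := K.ph0 y
      rw [pow_zero, mul_one]
      exact pow_le_pow_left₀ lj.le (by nlinarith) 2
  · have es : sk T' k idx ℓ D j x y = if nbr 1 (idx j x) (idx j y) then 0 else k x y := if_neg hfar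
    have hnb : ¬ nbr 1 (idx j x) (idx j y) := by
      intro h; rw [es, if_pos h, zero_mul] at h0; exact h0 rfl
    rw [if_neg hnb] at es
    have hd5 : dist x y ≤5*D*ℓ j := by linarith
    have hi : ¬ (i+r < j) := by
      intro hi
      rw [es, VV_near K L hε hr G hx hi hd5] at h0; exact h0 rfl
    refine main 0 ?_ (by omega)
    rw [es, pow_zero, mul_one]
    refine K.mid j x y ?_ hd5
    by_contra hh
    exact hnb (by exact_mod_cast I.near j x y 1 (by push_cast; linarith))
end core2
section core3
variable {X : Type*} [PseudoMetricSpace X] [MeasurableSpace X] [OpensMeasurableSpace X]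
  [SecondCountableTopology X]
  {ι : Type*} [Countable ι] [MeasurableSpace ι] [DiscreteMeasurableSpace ι]
  {σ : Measure X} [IsFiniteMeasure σ] {k : X → X → ℂ} {Φ : X → ℝ} {P : ℕ → X → X → ℝ} {ℓ : ℕ → ℝ}
  {b : X → ℂ} {γ A W D θ : ℝ} {d r : ℕ} {idx : ℕ → X → Fin d → ℤ}
  {T T' : TD σ ι} {f g : X → ℂ} {Lam Lam' : ℕ → Set X} {ε ε' : ℕ → X → ℂ}
theorem km_prod {p : X → ι} (hp : Measurable p) {z : X → X} (hz : KM p z)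
    (hk : BM (fun z : X × X => k z.1 z.2)) : BM (fun w : X × X => k (z w.1) w.2) :=
  ⟨hk.m.comp (((hz.meas hp).comp measurable_fst).prodMk measurable_snd),
    hk.b.imp fun C hC w => hC (z w.1, w.2)⟩
theorem nbr_meas (I : BH ℓ θ idx) (j : ℕ) :
    MeasurableSet {z : X × X | nbr 1 (idx j z.1) (idx j z.2)} := by
  have : Measurable (fun z : X × X => (idx j z.1, idx j z.2)) :=
    ((I.m j).comp measurable_fst).prodMk ((I.m j).comp measurable_snd)
  exact this (MeasurableSet.of_discrete (s := {w : (Fin d → ℤ) × (Fin d → ℤ) | nbr 1 w.1 w.2}))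
theorem far_meas {p : X → ι} (hp : Measurable p) {z : X → X} (hz : KM p z) (c : ℝ) :
    MeasurableSet {w : X × X | c < dist (z w.1) w.2} :=
  measurableSet_lt measurable_const (((hz.meas hp).comp measurable_fst).dist measurable_snd)
theorem sk_bm (K : KH σ k Φ P ℓ b γ A W D θ) (I : BH ℓ θ idx) (T' : TD σ ι) (j : ℕ) :
    BM (fun z : X × X => sk T' k idx ℓ D j z.1 z.2) := by
  classical
  exact (K.bm.sub (km_prod (T'.mπ j) (rp_km _) K.bm)).ite
    ((BM.const 0).ite K.bm (nbr_meas I j)) (far_meas (T'.mπ j) (rp_km _) _)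
def UU {X : Type*} [MeasurableSpace X] {σ : Measure X} {ι : Type*} [MeasurableSpace ι]
    (T T' : TD σ ι) (f g : X → ℂ) (ε ε' : ℕ → X → ℂ) (r e j : ℕ) (z : X × X) : ℂ :=
  (T.Em ε f (j+e) z.2*ε' j z.1-T.b z.2*et T f ε ε' r j z.1)*T'.Dl g j z.1
open Classical in
def nbF {X : Type*} [MeasurableSpace X] {σ : Measure X} {ι : Type*} [MeasurableSpace ι] {d : ℕ}
    (T T' : TD σ ι) (k : X → X → ℂ) (idx : ℕ → X → Fin d → ℤ) (f g : X → ℂ) (ε ε' : ℕ → X → ℂ)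
    (r e j : ℕ) (z : X × X) : ℂ :=
  if nbr 1 (idx j z.1) (idx j z.2) then
    k z.1 z.2*(uk T f ε r e j z.2*(ε' j z.1*T'.Dl g j z.1)) else 0
theorem w_bm (K : KH σ k Φ P ℓ b γ A W D θ) (hb : BM b) : BM (fun x => ∫ y, k x y*b y ∂σ) :=
  ⟨((K.bm.mul hb.snd).m.stronglyMeasurable.integral_prod_right' (ν := σ)).measurable, W, K.tb⟩
theorem et_bm (hε : T.Sel ε) (hε' : T'.Sel ε') (hf : BM f) (j : ℕ) : BM (et T f ε ε' r j) :=
  (TD.ae_bm hε hf _).mul (hε'.bm j)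
open Classical in
theorem split (K : KH σ k Φ P ℓ b γ A W D θ) (I : BH ℓ θ idx) (L : LH d Φ ℓ D θ T f Lam)
    (L' : LH d Φ ℓ D θ T' g Lam') (hε : T.Sel ε) (hε' : T'.Sel ε') (hr :225*D^2 <2^r)
    (G : GD ℓ r T ε') (hf : BM f) (hg : BM g) (hb : T.b = b) (e j : ℕ) :
    fm σ k (T.Em ε f (j+e)) (fun x => ε' j x*T'.Dl g j x) =
      ∫ x, (∫ y, k x y*b y ∂σ)*(et T f ε ε' r j x*T'.Dl g j x) ∂σ
      + (∫ z : X × X, sk T' k idx ℓ D j z.1 z.2*UU T T' f g ε ε' r e j z ∂(σ.prod σ)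
      + ∫ z : X × X, nbF T T' k idx f g ε ε' r e j z ∂(σ.prod σ)) := by
  have bE := TD.Em_bm hε hf (j+e)
  have bD := T'.Dl_bm hg j
  have be := et_bm (r := r) hε hε' hf j
  have bb : BM b := hb ▸ T.bb
  have bU : BM (UU T T' f g ε ε' r e j) :=
    ((bE.snd.mul (hε'.bm j).fst).sub (T.bb.snd.mul be.fst)).mul bD.fst
  have bz := km_prod (T'.mπ j) (rp_km (T'.π j)) K.bm
  have b1 : BM (fun z : X × X => k z.1 z.2*(b z.2*(et T f ε ε' r j z.1*T'.Dl g j z.1))) :=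
    K.bm.mul (bb.snd.mul (be.fst.mul bD.fst))
  have b2 : BM (fun z : X × X => if 4*D*ℓ j < dist (rp (T'.π j) z.1) z.2 then
      k (rp (T'.π j) z.1) z.2*UU T T' f g ε ε' r e j z else 0) :=
    (bz.mul bU).ite (BM.const 0) (far_meas (T'.mπ j) (rp_km _) _)
  have b3 := (sk_bm K I T' j).mul bU
  have b4 : BM (nbF T T' k idx f g ε ε' r e j) := by
    unfold nbF
    exact (K.bm.mul ((uk_bm (r := r) hε hf e j).snd.mul ((hε'.bm j).fst.mul bD.fst))).ite
      (BM.const 0) (nbr_meas I j)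
  have pt : ∀ z : X × X, k z.1 z.2*(T.Em ε f (j+e) z.2*(ε' j z.1*T'.Dl g j z.1)) =
      (k z.1 z.2*(b z.2*(et T f ε ε' r j z.1*T'.Dl g j z.1))
      + (if 4*D*ℓ j < dist (rp (T'.π j) z.1) z.2 then
      k (rp (T'.π j) z.1) z.2*UU T T' f g ε ε' r e j z else 0))
      + (sk T' k idx ℓ D j z.1 z.2*UU T T' f g ε ε' r e j z
      + nbF T T' k idx f g ε ε' r e j z) := by
    rintro ⟨x, y⟩
    have D1 := K.D1
    have lj := K.l0 j
    have hdx := L'.dm j x _ (rp_eq (T'.π j) x).symm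
    have tri := dist_triangle (rp (T'.π j) x) x y
    rw [dist_comm _ x] at tri
    have tri2 := dist_triangle x (rp (T'.π j) x) y
    simp only [UU, nbF, sk, hb]
    by_cases hfar :4*D*ℓ j < dist (rp (T'.π j) x) y
    · have hnb : ¬ nbr 1 (idx j x) (idx j y) := by
        intro h
        have h1 := I.back j x y 1 (by exact_mod_cast h)
        have h2 := mul_le_mul_of_nonneg_right I.th lj.le
        push_cast at h1
        nlinarith
      simp only [if_pos hfar, if_neg hnb]; ring
    · simp only [if_neg hfar]
      by_cases hnb : nbr 1 (idx j x) (idx j y)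
      · simp only [if_pos hnb]
        by_cases hx : ε' j x =0
        · simp [et, hx]
        · have := near_eq K L hε hr G (e := e) hx (show dist x y ≤5*D*ℓ j by linarith)
          rw [hb] at this
          unfold et
          linear_combination (ε' j x*T'.Dl g j x)*this
      · simp only [if_neg hnb]; ring
  unfold fm
  simp only [pt]
  rw [integral_add (b1.add b2).int (b3.add b4).int, integral_add b1.int b2.int,
    integral_add b3.int b4.int]
  have z2 : ∫ z : X × X, (if 4*D*ℓ j < dist (rp (T'.π j) z.1) z.2 then
      k (rp (T'.π j) z.1) z.2*UU T T' f g ε ε' r e j z else 0) ∂(σ.prod σ) =0 := by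
    rw [integral_prod_symm _ b2.int]
    refine integral_eq_zero_of_ae (Filter.Eventually.of_forall fun y => ?_)
    set v : X → ℂ := fun x => if 4*D*ℓ j < dist (rp (T'.π j) x) y then
      k (rp (T'.π j) x) y*(T.Em ε f (j+e) y*ε' j x-T.b y*et T f ε ε' r j x) else 0 with hv
    have vk : KM (T'.π j) v := fun x x' h => by
      simp only [hv, rp_km _ x x' h, hε'.km j x x' h, et_km K L L' hε hε' hr G j x x' h]
    have vb : BM v := by
      refine ⟨vk.meas (T'.mπ j), ?_⟩
      obtain ⟨C, hC⟩ := (bz.mul ((bE.snd.mul (hε'.bm j).fst).sub (T.bb.snd.mul be.fst))).b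
      refine ⟨max C 0, fun x => ?_⟩
      simp only [hv]
      split_ifs
      · exact (hC (x, y)).trans (le_max_left _ _)
      · simp
    have := T'.int_Dl hg j vk vb
    simp only [Pi.zero_apply]
    refine Eq.trans ?_ this
    congr 1; funext x
    simp only [hv, UU]; split_ifs <;> ring
  have z1 : ∫ z : X × X, k z.1 z.2*(b z.2*(et T f ε ε' r j z.1*T'.Dl g j z.1)) ∂(σ.prod σ)
      = ∫ x, (∫ y, k x y*b y ∂σ)*(et T f ε ε' r j x*T'.Dl g j x) ∂σ := by
    rw [integral_prod _ b1.int]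
    congr 1; funext x
    rw [← integral_mul_const]
    congr 1; funext y; ring
  rw [z1, z2, add_zero]
end core3
theorem band_sum {c : ℕ → ℝ} (c0 : ∀ i,0 ≤ c i) {r e : ℕ} (he : e ≤1) (n : ℕ) :
    ∑ j ∈ Finset.range n, ∑ i ∈ Finset.Ico (j-r) (j+e), c i ≤ (r+1) * ∑ i ∈ Finset.range n, c i := by
  have h1 : ∀ j ∈ Finset.range n, ∑ i ∈ Finset.Ico (j-r) (j+e), c i ≤
      ∑ i ∈ Finset.range n, if i < j+e ∧ j ≤ i+r then c i else 0 := by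
    intro j hj
    rw [← Finset.sum_filter]
    refine Finset.sum_le_sum_of_subset_of_nonneg (fun i hi => ?_) (fun i _ _ => c0 i)
    simp only [Finset.mem_Ico, Finset.mem_filter, Finset.mem_range] at *
    omega
  refine (Finset.sum_le_sum h1).trans ?_
  rw [Finset.sum_comm, Finset.mul_sum]
  refine Finset.sum_le_sum fun i _ => ?_
  rw [← Finset.sum_filter, Finset.sum_const, nsmul_eq_mul]
  refine mul_le_mul_of_nonneg_right ?_ (c0 i)
  have : (Finset.filter (fun j => i < j+e ∧ j ≤ i+r) (Finset.range n)).card ≤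
      (Finset.Icc (i+1-e) (i+r)).card := Finset.card_le_card fun j hj => by
    simp only [Finset.mem_Icc, Finset.mem_filter, Finset.mem_range] at *
    omega
  rw [Nat.card_Icc] at this
  exact_mod_cast this.trans (by omega)
section core4
variable {X : Type*} [PseudoMetricSpace X] [MeasurableSpace X] [OpensMeasurableSpace X]
  [SecondCountableTopology X]
  {ι : Type*} [Countable ι] [MeasurableSpace ι] [DiscreteMeasurableSpace ι]
  {σ : Measure X} [IsFiniteMeasure σ] {k : X → X → ℂ} {Φ : X → ℝ} {P : ℕ → X → X → ℝ} {ℓ : ℕ → ℝ}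
  {b : X → ℂ} {γ A W D θ : ℝ} {d r : ℕ} {idx : ℕ → X → Fin d → ℤ}
  {T T' : TD σ ι} {f g : X → ℂ} {Lam Lam' : ℕ → Set X} {ε ε' : ℕ → X → ℂ}
def eA (T : TD σ ι) (f : X → ℂ) (ε ε' : ℕ → X → ℂ) (r : ℕ) : ℕ → X → ℝ
  | 0, x => ‖et T f ε ε' r 0 x‖^2
  | j+1, x => max (eA T f ε ε' r j x) (‖et T f ε ε' r (j+1) x‖^2)
theorem eA_le (hε : T.Sel ε) (hε' : T'.Sel ε') (hf : BM f) (j : ℕ) (x : X) :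
    eA T f ε ε' r j x ≤ (T.τ⁻¹*(mx σ T.π (T.Em ε f T.N) j x+mx σ T.π f j x))^2 := by
  have ht := (inv_pos.2 T.τ0).le
  have key : ∀ j, ‖et T f ε ε' r j x‖^2 ≤
      (T.τ⁻¹*(mx σ T.π (T.Em ε f T.N) j x+mx σ T.π f j x))^2 := by
    intro j
    refine pow_le_pow_left₀ (norm_nonneg _) ?_ 2
    unfold et
    rw [norm_mul]
    refine (mul_le_of_le_one_right (norm_nonneg _) (hε'.le j x)).trans ?_
    refine (TD.ae_le hε hf _ x).trans ?_
    have h1 := mx_mono (σ := σ) (π := T.π) (T.Em ε f T.N) (Nat.sub_le j r) x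
    have h2 := mx_mono (σ := σ) (π := T.π) f (Nat.sub_le j r) x
    gcongr
  induction j with
  | zero => exact key 0
  | succ j ih =>
    refine max_le (ih.trans ?_) (key _)
    have h1 := mx_mono (σ := σ) (π := T.π) (T.Em ε f T.N) (Nat.le_succ j) x
    have h2 := mx_mono (σ := σ) (π := T.π) f (Nat.le_succ j) x
    have h3 := mx_nonneg (σ := σ) (π := T.π) (T.Em ε f T.N) j x
    have h4 := mx_nonneg (σ := σ) (π := T.π) f j x
    gcongr
theorem core_para (K : KH σ k Φ P ℓ b γ A W D θ) (L : LH d Φ ℓ D θ T f Lam)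
    (L' : LH d Φ ℓ D θ T' g Lam') (hε : T.Sel ε) (hε' : T'.Sel ε') (hr :225*D^2 <2^r)
    (G : GD ℓ r T ε') (hf : BM f) (hg : BM g) (hb : T.b = b) (n : ℕ) :
    ∑ j ∈ Finset.range n, ‖∫ x, (∫ y, k x y*b y ∂σ)*(et T f ε ε' r j x*T'.Dl g j x) ∂σ‖ ≤
      T'.CC*(q σ g+W^2*(8*T.τ⁻¹^2*(T.CE+1)*q σ f)) := by
  have bb : BM b := hb ▸ T.bb
  have hb1 := et_bm (r := r) hε hε' hf
  have hk1 := et_km K L L' hε hε' hr G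
  have hAb : ∀ j, BM (eA T f ε ε' r j) := by
    intro j
    induction j with
    | zero => exact (hb1 0).norm.pow
    | succ j ih => exact ih.max (hb1 (j+1)).norm.pow
  have hAk : ∀ j, KM (T'.π j) (eA T f ε ε' r j) := by
    intro j
    induction j with
    | zero => intro x y h; simp only [eA, hk1 0 x y h]
    | succ j ih =>
      intro x y h
      simp only [eA, hk1 (j+1) x y h, ih x y (T'.nest j x y h)]
  have h := T'.para (W := W) (η := et T f ε ε' r) (A := eA T f ε ε' r) hg (w_bm K bb) K.tb hk1 hb1 hAb hAk
    (fun j x => by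
      cases j with
      | zero => exact le_rfl
      | succ j => exact le_max_right _ _) (fun j x => le_max_left _ _) n
  refine h.trans ?_
  have bE := TD.Em_bm hε hf T.N
  have m1 := mx_bm (σ := σ) T.mπ bE n
  have m2 := mx_bm (σ := σ) T.mπ hf n
  have i1 : ∫ x, eA T f ε ε' r n x ∂σ ≤ ∫ x,2*T.τ⁻¹^2*(mx σ T.π (T.Em ε f T.N) n x^2+mx σ T.π f n x^2) ∂σ := by
    refine integral_mono (hAb n).int ((BM.const _).mul (m1.pow.add m2.pow)).int fun x => ?_
    refine (eA_le hε hε' hf n x).trans ?_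
    have :0 ≤ T.τ⁻¹^2 := by positivity
    rw [mul_pow]
    nlinarith [sq_nonneg (mx σ T.π (T.Em ε f T.N) n x-mx σ T.π f n x)]
  rw [integral_const_mul, integral_add m1.pow.int m2.pow.int] at i1
  have d1 := doob (σ := σ) T.mπ T.nest bE n
  have d2 := doob (σ := σ) T.mπ T.nest hf n
  have d3 := TD.q_Em_le hε hf T.N
  have := T'.CC_pos
  have t2 :0 ≤ T.τ⁻¹^2 := by positivity
  have : ∫ x, eA T f ε ε' r n x ∂σ ≤8*T.τ⁻¹^2*(T.CE+1)*q σ f := by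
    refine i1.trans ?_
    have : (2*T.τ⁻¹^2)*(∫ x, mx σ T.π (T.Em ε f T.N) n x^2 ∂σ + ∫ x, mx σ T.π f n x^2 ∂σ)
      ≤ (2*T.τ⁻¹^2)*(4*(T.CE*q σ f)+4*q σ f) := by gcongr; linarith
    linarith
  gcongr
theorem core_schur (K : KH σ k Φ P ℓ b γ A W D θ) (I : BH ℓ θ idx) (L : LH d Φ ℓ D θ T f Lam)
    (L' : LH d Φ ℓ D θ T' g Lam') (hε : T.Sel ε) (hε' : T'.Sel ε') (hr :225*D^2 <2^r)
    (G : GD ℓ r T ε') (hf : BM f) (hg : BM g) {e : ℕ} (he : e ≤1) (n : ℕ) :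
    ∑ j ∈ Finset.range n,
      ‖∫ z : X × X, sk T' k idx ℓ D j z.1 z.2*UU T T' f g ε ε' r e j z ∂(σ.prod σ)‖ ≤
      A*γ⁻¹^(r+1)*A*(1-γ)⁻¹*(T.CC*q σ f+T'.CC*q σ g) := by
  have g0 := K.g0
  have g1 := K.g1
  have A0 := K.A0
  refine (schur_sum K.pbm K.p0 K.ps A0 K.pA (T.GG_bm hf hf) (T'.GG_bm hg hg) g0 g1
    (C := A*γ⁻¹^(r+1)) (by positivity) he ?_ n).trans ?_
  · rintro j ⟨x, y⟩
    simp only [UU]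
    have nn : ∀ i,0 ≤ A*γ⁻¹^(r+1)*γ^(j-i) *
        (P j x y*((T.GG f f i y+T.GG f f i x)*T'.GG g g j x)) := fun i => by
      have := K.p0 j x y
      have := T.GG_nonneg f f i y
      have := T.GG_nonneg f f i x
      have := T'.GG_nonneg g g j x
      positivity
    by_cases hx : ε' j x =0
    · simp only [et, hx]
      simpa using Finset.sum_nonneg fun i _ => nn i
    have hV := Em_VV L (ε := ε) (r := r) (e := e) j x y
    have : sk T' k idx ℓ D j x y*((T.Em ε f (j+e) y*ε' j x-T.b y*et T f ε ε' r j x)*T'.Dl g j x)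
        = ∑ i ∈ Finset.range (j+e), sk T' k idx ℓ D j x y*VV T f ε r j i x y*(ε' j x*T'.Dl g j x) := by
      rw [← Finset.sum_mul, ← Finset.mul_sum, ← hV]
      unfold et; ring
    rw [this]
    refine (norm_sum_le _ _).trans (Finset.sum_le_sum fun i _ => ?_)
    rw [norm_mul, norm_mul (ε' j x)]
    have h1 := sk_le K I L L' hε hr G (i := i) (y := y) hx
    have h2 : ‖ε' j x‖*‖T'.Dl g j x‖ ≤ T'.GG g g j x :=
      (mul_le_of_le_one_left (norm_nonneg _) (hε'.le j x)).trans (T'.Dl_le g j x)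
    refine (mul_le_mul h1 h2 (by positivity) ((norm_nonneg _).trans h1)).trans (le_of_eq (by ring))
  · have h1 := T.sqG hf hf (fun _ => le_rfl) n
    have h2 := T'.sqG hg hg (fun _ => le_rfl) n
    have :0 <1-γ := by linarith
    gcongr
open Classical in
def R1 (T' : TD σ ι) (g : X → ℂ) (Lam : ℕ → Set X) (n : ℕ) : ℝ :=
  ∑ j ∈ Finset.range n, ∫ x, (if x ∈ Lam j then T'.GG g g j x^2 else 0) ∂σ
open Classical in
def R2 (T : TD σ ι) (f : X → ℂ) (Lam : ℕ → Set X) (r n : ℕ) : ℝ :=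
  ∑ j ∈ Finset.range n, ∑ i ∈ Finset.Ico (j-r) (j+1),
    ∫ x, (if x ∈ Lam j then T.GG f f i x^2 else 0) ∂σ
open Classical in
theorem q_uk_le (hε : T.Sel ε) (hf : BM f) {e : ℕ} (he : e ≤1) (j : ℕ) {S : Set X}
    (mS : MeasurableSet S) : q σ (fun x => if x ∈ S then uk T f ε r e j x else 0) ≤
      (r+1) * ∑ i ∈ Finset.Ico (j-r) (j+e), ∫ x, (if x ∈ S then T.GG f f i x^2 else 0) ∂σ := by
  have bG : ∀ i, BM (fun x => if x ∈ S then T.GG f f i x^2 else 0) :=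
    fun i => (T.GG_bm hf hf i).pow.ite (BM.const 0) mS
  have bU : BM (fun x => if x ∈ S then uk T f ε r e j x else 0) := (uk_bm hε hf e j).ite (BM.const 0) mS
  rw [← integral_finset_sum _ fun i _ => (bG i).int, ← integral_const_mul]
  unfold q
  refine integral_mono bU.norm.pow.int
    ((BM.const _).mul (BM.sum _ bG)).int fun x => ?_
  by_cases hx : x ∈ S
  · simp only [if_pos hx]
    have h1 : ‖uk T f ε r e j x‖ ≤ ∑ i ∈ Finset.Ico (j-r) (j+e), T.GG f f i x := by
      unfold uk
      refine (norm_sum_le _ _).trans (Finset.sum_le_sum fun i _ => ?_)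
      rw [norm_mul]
      exact (mul_le_of_le_one_left (norm_nonneg _) (hε.le i x)).trans (T.Dl_le f i x)
    have h2 := sq_sum_le_card_mul_sum_sq (s := Finset.Ico (j-r) (j+e)) (f := fun i => T.GG f f i x)
    have h3 : (((Finset.Ico (j-r) (j+e)).card : ℕ) : ℝ) ≤ r+1 := by
      rw [Nat.card_Ico]; exact_mod_cast (by omega : j+e-(j-r) ≤ r+1)
    refine (pow_le_pow_left₀ (norm_nonneg _) h1 2).trans (h2.trans ?_)
    exact mul_le_mul_of_nonneg_right h3 (Finset.sum_nonneg fun _ _ => sq_nonneg _)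
  · simp [hx]
open Classical in
theorem core_nb (K : KH σ k Φ P ℓ b γ A W D θ) (I : BH ℓ θ idx) (L : LH d Φ ℓ D θ T f Lam)
    (L' : LH d Φ ℓ D θ T' g Lam') (hε : T.Sel ε) (hε' : T'.Sel ε') (hf : BM f) (hg : BM g)
    (hb : T.b = b) (hb' : T'.b = b) {e : ℕ} (he : e ≤1) {N : ℝ} (N0 :0 ≤ N) (hN : NB σ k N)
    {t : ℝ} (ht :0 < t) (n : ℕ) :
    ∑ j ∈ Finset.range n, ‖∫ z : X × X, nbF T T' k idx f g ε ε' r e j z ∂(σ.prod σ)‖ ≤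
      3^d*N*(t*((r+1)^2*T.CC*q σ f+T'.CC*q σ g) +
        t⁻¹*(R1 T' g Lam n+(r+1)*R2 T f Lam' r n)) := by
  have bv : ∀ j, BM (fun x => ε' j x*T'.Dl g j x) := fun j => (hε'.bm j).mul (T'.Dl_bm hg j)
  have bu := uk_bm (r := r) hε hf e
  have bG := T.GG_bm hf hf
  have bG' := T'.GG_bm hg hg
  have step : ∀ j ∈ Finset.range n, ‖∫ z : X × X, nbF T T' k idx f g ε ε' r e j z ∂(σ.prod σ)‖ ≤
      3^d*N*(t*((r+1) * ∑ i ∈ Finset.Ico (j-r) (j+e), ∫ x, T.GG f f i x^2 ∂σ)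
        + t * ∫ x, T'.GG g g j x^2 ∂σ+t⁻¹ * ∫ x, (if x ∈ Lam j then T'.GG g g j x^2 else 0) ∂σ
        + t⁻¹*((r+1) * ∑ i ∈ Finset.Ico (j-r) (j+1), ∫ x, (if x ∈ Lam' j then T.GG f f i x^2 else 0) ∂σ)) := by
    intro j _
    have h := nb_bound K.bm N0 hN (I.m j) (bad T idx j) (bad T' idx j) (L.mL j) (L'.mL j) (bu j) (bv j)
      (fun x y h1 h2 => bad_lam I L h1 h2)
      (fun x y h1 h2 => bad_lam I L' (nbr_symm h1) h2.symm)
      (fun x y h0 h1 h2 => nb_anti K I L L' hε hε' hb hb' he h0 h1 h2) ht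
    have q1 : q σ (uk T f ε r e j) ≤ (r+1) * ∑ i ∈ Finset.Ico (j-r) (j+e), ∫ x, T.GG f f i x^2 ∂σ := by
      simpa using q_uk_le (r := r) hε hf he j (MeasurableSet.univ (α := X))
    have q2 : q σ (fun x => if x ∈ Lam' j then uk T f ε r e j x else 0) ≤
        (r+1) * ∑ i ∈ Finset.Ico (j-r) (j+1), ∫ x, (if x ∈ Lam' j then T.GG f f i x^2 else 0) ∂σ := by
      refine (q_uk_le (r := r) hε hf he j (L'.mL j)).trans ?_
      refine mul_le_mul_of_nonneg_left (Finset.sum_le_sum_of_subset_of_nonneg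
        (Finset.Ico_subset_Ico_right (by omega)) fun i _ _ => integral_nonneg fun x => ?_) (by positivity)
      dsimp only; split_ifs <;> positivity
    have vle : ∀ x, ‖ε' j x*T'.Dl g j x‖^2 ≤ T'.GG g g j x^2 := fun x => by
      refine pow_le_pow_left₀ (norm_nonneg _) ?_ 2
      rw [norm_mul]
      exact (mul_le_of_le_one_left (norm_nonneg _) (hε'.le j x)).trans (T'.Dl_le g j x)
    have q3 : q σ (fun x => ε' j x*T'.Dl g j x) ≤ ∫ x, T'.GG g g j x^2 ∂σ :=
      integral_mono (bv j).norm.pow.int (bG' j).pow.int vle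
    have q4 : q σ (fun x => if x ∈ Lam j then ε' j x*T'.Dl g j x else 0) ≤
        ∫ x, (if x ∈ Lam j then T'.GG g g j x^2 else 0) ∂σ := by
      have b1 : BM (fun x => if x ∈ Lam j then ε' j x*T'.Dl g j x else 0) := (bv j).ite (BM.const 0) (L.mL j)
      have b2 : BM (fun x => if x ∈ Lam j then T'.GG g g j x^2 else 0) := (bG' j).pow.ite (BM.const 0) (L.mL j)
      refine integral_mono b1.norm.pow.int b2.int fun x => ?_
      dsimp only
      split_ifs
      · exact vle x
      · simp
    unfold nbF
    refine h.trans ?_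
    rw [← mul_add]
    have ti := (inv_pos.2 ht).le
    refine mul_le_mul_of_nonneg_left ?_ (by positivity)
    have a1 := mul_le_mul_of_nonneg_left q1 ht.le
    have a2 := mul_le_mul_of_nonneg_left q2 ti
    have a3 := mul_le_mul_of_nonneg_left q3 ht.le
    have a4 := mul_le_mul_of_nonneg_left q4 ti
    linarith
  refine (Finset.sum_le_sum step).trans ?_
  rw [← Finset.mul_sum]
  refine mul_le_mul_of_nonneg_left ?_ (by positivity)
  simp only [Finset.sum_add_distrib, ← Finset.mul_sum]
  have s1 := (band_sum (c := fun i => ∫ x, T.GG f f i x^2 ∂σ)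
    (fun i => integral_nonneg fun x => sq_nonneg _) (r := r) he n)
  have s2 := T.sqG hf hf (fun _ => le_rfl) n
  have s3 := T'.sqG hg hg (fun _ => le_rfl) n
  have r0 : (0:ℝ) ≤ r+1 := by positivity
  have s4 : (r+1 : ℝ) * ∑ j ∈ Finset.range n, ∑ i ∈ Finset.Ico (j-r) (j+e), ∫ x, T.GG f f i x^2 ∂σ ≤
      (r+1)^2*T.CC*q σ f := by
    refine (mul_le_mul_of_nonneg_left (s1.trans (mul_le_mul_of_nonneg_left s2 r0)) r0).trans (le_of_eq (by ring))
  have a1 := mul_le_mul_of_nonneg_left s4 ht.le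
  have a2 := mul_le_mul_of_nonneg_left s3 ht.le
  unfold R1 R2
  linarith
theorem core (K : KH σ k Φ P ℓ b γ A W D θ) (I : BH ℓ θ idx) (L : LH d Φ ℓ D θ T f Lam)
    (L' : LH d Φ ℓ D θ T' g Lam') (hε : T.Sel ε) (hε' : T'.Sel ε') (hr :225*D^2 <2^r)
    (G : GD ℓ r T ε') (hf : BM f) (hg : BM g)
    (hb : T.b = b) (hb' : T'.b = b) {e : ℕ} (he : e ≤1) {N : ℝ} (N0 :0 ≤ N) (hN : NB σ k N)
    {t : ℝ} (ht :0 < t) (n : ℕ) :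
    ∑ j ∈ Finset.range n, ‖fm σ k (T.Em ε f (j+e)) (fun x => ε' j x*T'.Dl g j x)‖ ≤
      T'.CC*(q σ g+W^2*(8*T.τ⁻¹^2*(T.CE+1)*q σ f)) +
      (A*γ⁻¹^(r+1)*A*(1-γ)⁻¹*(T.CC*q σ f+T'.CC*q σ g) +
      3^d*N*(t*((r+1)^2*T.CC*q σ f+T'.CC*q σ g) +
        t⁻¹*(R1 T' g Lam n+(r+1)*R2 T f Lam' r n))) := by
  refine le_trans ?_ (add_le_add (core_para K L L' hε hε' hr G hf hg hb n)
    (add_le_add (core_schur K I L L' hε hε' hr G hf hg he n)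
      (core_nb (r := r) K I L L' hε hε' hf hg hb hb' he N0 hN ht n)))
  rw [← Finset.sum_add_distrib, ← Finset.sum_add_distrib]
  refine Finset.sum_le_sum fun j _ => ?_
  rw [split K I L L' hε hε' hr G hf hg hb e j]
  exact (norm_add_le _ _).trans (add_le_add le_rfl (norm_add_le _ _))
theorem good_form (K : KH σ k Φ P ℓ b γ A W D θ) (I : BH ℓ θ idx) (L : LH d Φ ℓ D θ T f Lam)
    (L' : LH d Φ ℓ D θ T' g Lam') (hε : T.Sel ε) (hε' : T'.Sel ε') (hr :225*D^2 <2^r)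
    (G : GD ℓ r T ε') (G' : GD ℓ r T' ε) (hf : BM f) (hg : BM g)
    (hb : T.b = b) (hb' : T'.b = b) (hτ : T'.τ = T.τ) {N : ℝ} (N0 :0 ≤ N) (hN : NB σ k N)
    {t : ℝ} (ht :0 < t) (n : ℕ) :
    ‖fm σ k (T.Em ε f n) (T'.Em ε' g n)‖ ≤
      2*(T.CC*(1+W^2*(8*T.τ⁻¹^2*(T.CE+1)))+A*γ⁻¹^(r+1)*A*(1-γ)⁻¹*T.CC
        +3^d*N*(t*((r+1)^2*T.CC)))*(q σ f+q σ g) +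
      3^d*N*t⁻¹*(r+1)*2*(R1 T' g Lam n+R2 T f Lam' r n+R1 T f Lam' n+R2 T' g Lam r n) := by
  have bE := fun n => TD.Em_bm hε hf n
  have bE' := fun n => TD.Em_bm hε' hg n
  have bd : ∀ j, BM (fun x => ε j x*T.Dl f j x) := fun j => (hε.bm j).mul (T.Dl_bm hf j)
  have bd' : ∀ j, BM (fun x => ε' j x*T'.Dl g j x) := fun j => (hε'.bm j).mul (T'.Dl_bm hg j)
  have sE : ∀ n, T.Em ε f (n+1) = fun x => T.Em ε f n x+ε n x*T.Dl f n x := fun n => by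
    funext x; simp only [TD.Em, Finset.sum_range_succ]; ring
  have sE' : ∀ n, T'.Em ε' g (n+1) = fun x => T'.Em ε' g n x+ε' n x*T'.Dl g n x := fun n => by
    funext x; simp only [TD.Em, Finset.sum_range_succ]; ring
  have tele : ‖fm σ k (T.Em ε f n) (T'.Em ε' g n)‖ ≤
      ∑ j ∈ Finset.range n, ‖fm σ k (T.Em ε f (j+0)) (fun x => ε' j x*T'.Dl g j x)‖ +
      ∑ j ∈ Finset.range n, ‖fm σ k (T'.Em ε' g (j+1)) (fun x => ε j x*T.Dl f j x)‖ := by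
    induction n with
    | zero =>
      simp only [Finset.range_zero, Finset.sum_empty, add_zero]
      have : fm σ k (T.Em ε f 0) (T'.Em ε' g 0) =0 := by
        unfold fm
        refine int_swap_anti fun z => ?_
        have c1 := T.aa_km f 0 z.1 z.2 (L.g0 _ _)
        have c2 := T'.aa_km g 0 z.1 z.2 (L'.g0 _ _)
        simp only [TD.Em, Finset.range_zero, Finset.sum_empty, add_zero, Prod.fst_swap, Prod.snd_swap, hb, hb',
          K.anti z.2 z.1, c1, c2]
        ring
      rw [this, norm_zero]
    | succ n ih =>
      have e1 : fm σ k (T.Em ε f (n+1)) (T'.Em ε' g (n+1)) = fm σ k (T.Em ε f n) (T'.Em ε' g n) +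
          fm σ k (T.Em ε f n) (fun x => ε' n x*T'.Dl g n x)-fm σ k (T'.Em ε' g (n+1)) (fun x => ε n x*T.Dl f n x) := by
        conv_lhs => rw [sE n, fm_add_left K.bm (bE n) (bd n) (bE' _), fm_swap K.anti (fun x => ε n x*T.Dl f n x)]
        conv_lhs => enter [1]; rw [sE' n, fm_add_right K.bm (bE n) (bE' n) (bd' n)]
        ring
      rw [e1, Finset.sum_range_succ, Finset.sum_range_succ]
      refine (norm_sub_le _ _).trans ?_
      have := norm_add_le (fm σ k (T.Em ε f n) (T'.Em ε' g n)) (fm σ k (T.Em ε f n) (fun x => ε' n x*T'.Dl g n x))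
      simp only [add_zero] at ih ⊢
      linarith
  refine tele.trans ((add_le_add (core K I L L' hε hε' hr G hf hg hb hb' (by omega) N0 hN ht n)
    (core K I L' L hε' hε hr G' hg hf hb' hb (by omega) N0 hN ht n)).trans ?_)
  have cc : T'.CC = T.CC := by unfold TD.CC; rw [hτ]
  have ce : T'.CE = T.CE := by unfold TD.CE; rw [hτ, cc]
  rw [cc, ce, hτ]
  have nR : ∀ (T : TD σ ι) f Lam,0 ≤ R1 T f Lam n := fun T f Lam => Finset.sum_nonneg fun j _ =>
    integral_nonneg fun x => by dsimp only; split_ifs <;> positivity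
  have nR2 : ∀ (T : TD σ ι) f Lam,0 ≤ R2 T f Lam r n := fun T f Lam => Finset.sum_nonneg fun j _ =>
    Finset.sum_nonneg fun i _ => integral_nonneg fun x => by dsimp only; split_ifs <;> positivity
  have q0 := q_nonneg (σ := σ) f
  have q0' := q_nonneg (σ := σ) g
  have CCp := T.CC_pos
  have CEp :0 ≤ T.CE := by unfold TD.CE; positivity
  have A0 := K.A0
  have g0 := K.g0
  have g1 :0 ≤ (1-γ)⁻¹ := inv_nonneg.2 (by linarith [K.g1])
  have r0 : (0:ℝ) ≤ r := Nat.cast_nonneg r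
  have rr : T.CC ≤ (r+1)^2*T.CC := le_mul_of_one_le_left CCp.le (by nlinarith)
  have x1 : T.CC*(q σ g+W^2*(8*T.τ⁻¹^2*(T.CE+1)*q σ f))+T.CC*(q σ f+W^2*(8*T.τ⁻¹^2*(T.CE+1)*q σ g))
    = (T.CC*(1+W^2*(8*T.τ⁻¹^2*(T.CE+1))))*(q σ f+q σ g) := by ring
  have x1' :0 ≤ (T.CC*(1+W^2*(8*T.τ⁻¹^2*(T.CE+1))))*(q σ f+q σ g) := by positivity
  have x2 : t*((r+1)^2*T.CC*q σ f+T.CC*q σ g)+t⁻¹*(R1 T' g Lam n+(r+1)*R2 T f Lam' r n) +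
     (t*((r+1)^2*T.CC*q σ g+T.CC*q σ f)+t⁻¹*(R1 T f Lam' n+(r+1)*R2 T' g Lam r n)) ≤
     2*(t*((r+1)^2*T.CC))*(q σ f+q σ g) +
      t⁻¹*(r+1)*2*(R1 T' g Lam n+R2 T f Lam' r n+R1 T f Lam' n+R2 T' g Lam r n) := by
    have ti := (inv_pos.2 ht).le
    have y1 : t*(T.CC*(q σ f+q σ g)) ≤ t*((r+1)^2*T.CC*(q σ f+q σ g)) := by gcongr
    have y2 : ∀ a b : ℝ,0 ≤ a →0 ≤ b → t⁻¹*(a+(r+1)*b) ≤ t⁻¹*(r+1)*2*(a+b) := by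
      intro a b ha hb
      rw [mul_assoc, mul_assoc]
      refine mul_le_mul_of_nonneg_left ?_ ti
      nlinarith [mul_nonneg r0 ha, mul_nonneg r0 hb]
    have := y2 _ _ (nR T' g Lam) (nR2 T f Lam')
    have := y2 _ _ (nR T f Lam') (nR2 T' g Lam)
    linarith
  have x3 := mul_le_mul_of_nonneg_left x2 (show 0 ≤3^d*N by positivity)
  linarith only [x1, x1', x3]
end core4
def cC (τ : ℝ) : ℝ :=10*τ⁻¹^2+8*τ⁻¹^4+2
def cE (τ : ℝ) : ℝ :=2*τ⁻¹^2+2*cC τ^2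
def c1 (τ W A γ : ℝ) (r : ℕ) : ℝ :=
  2*(cC τ*(1+W^2*(8*τ⁻¹^2*(cE τ+1)))+A*γ⁻¹^(r+1)*A*(1-γ)⁻¹*cC τ)
def c2 (τ : ℝ) (d r : ℕ) : ℝ :=2*3^d*(r+1)^2*cC τ+cE τ+1
def c3 (τ : ℝ) (d r : ℕ) : ℝ :=2*3^d*(r+1)+cC τ
theorem cC_pos (τ : ℝ) :0 < cC τ := by unfold cC; positivity
theorem cE_nn (τ : ℝ) :0 ≤ cE τ := by unfold cE; positivity
theorem c2_pos (τ : ℝ) (d r : ℕ) :0 < c2 τ d r := by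
  have := cC_pos τ; have := cE_nn τ; unfold c2; positivity
theorem c3_pos (τ : ℝ) (d r : ℕ) :0 < c3 τ d r := by have := cC_pos τ; unfold c3; positivity
section core5
variable {X : Type*} [PseudoMetricSpace X] [MeasurableSpace X] [OpensMeasurableSpace X]
  [SecondCountableTopology X]
  {ι : Type*} [Countable ι] [MeasurableSpace ι] [DiscreteMeasurableSpace ι]
  {σ : Measure X} [IsFiniteMeasure σ] {k : X → X → ℂ} {Φ : X → ℝ} {P : ℕ → X → X → ℝ} {ℓ : ℕ → ℝ}
  {b : X → ℂ} {γ A W D θ : ℝ} {d r : ℕ} {idx : ℕ → X → Fin d → ℤ}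
def RB (T : TD σ ι) (f : X → ℂ) (ε : ℕ → X → ℂ) : ℝ :=
  ∑ k ∈ Finset.range T.N, ∫ x, ‖1-ε k x‖^2*T.GG f f k x^2 ∂σ
theorem q_bad {T : TD σ ι} {f : X → ℂ} {ε : ℕ → X → ℂ} (hε : T.Sel ε) (hf : BM f) :
    q σ (fun x => f x-T.Em ε f T.N x) ≤ T.CC*RB T f ε := by
  have h := T.q_sum_le hf (η := fun k x =>1-ε k x)
    (fun k x y h => by simp only [hε.km k x y h]) (fun k => (BM.const 1).sub (hε.bm k)) T.N
  refine le_trans (le_of_eq ?_) h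
  congr 1; funext x
  have := T.Dl_sum f T.N x
  rw [T.EE_N, T.EE_0] at this
  simp only [sub_mul, one_mul, Finset.sum_sub_distrib, this, TD.Em]
  ring
theorem pair {T T' : TD σ ι} {f g : X → ℂ} {Lam Lam' : ℕ → Set X} {ε ε' : ℕ → X → ℂ}
    (K : KH σ k Φ P ℓ b γ A W D θ) (I : BH ℓ θ idx) (L : LH d Φ ℓ D θ T f Lam)
    (L' : LH d Φ ℓ D θ T' g Lam') (hε : T.Sel ε) (hε' : T'.Sel ε') (hr :225*D^2 <2^r)
    (G : GD ℓ r T ε') (G' : GD ℓ r T' ε) (hf : BM f) (hg : BM g)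
    (hb : T.b = b) (hb' : T'.b = b) (hτ : T'.τ = T.τ) (hNN : T'.N = T.N) {N : ℝ} (N0 :0 ≤ N) (hN : NB σ k N)
    {t : ℝ} (ht :0 < t) :
    ‖fm σ k f g‖ ≤ (c1 T.τ W A γ r+N*t*c2 T.τ d r)*(q σ f+q σ g)+N*t⁻¹*c3 T.τ d r *
      (R1 T' g Lam T.N+R2 T f Lam' r T.N+(R1 T f Lam' T.N+R2 T' g Lam r T.N)+(RB T f ε+RB T' g ε')) := by
  have h := good_form K I L L' hε hε' hr G G' hf hg hb hb' hτ N0 hN ht T.N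
  have bE := TD.Em_bm hε hf T.N
  have bE' := TD.Em_bm hε' hg T.N
  have e1 : fm σ k f g = fm σ k (T.Em ε f T.N) (T'.Em ε' g T.N)+fm σ k (T.Em ε f T.N) (fun x => g x-T'.Em ε' g T.N x)
      + fm σ k (fun x => f x-T.Em ε f T.N x) g := by
    rw [← fm_add_right K.bm bE bE' (hg.sub bE')]
    simp only [add_sub_cancel]
    rw [← fm_add_left K.bm bE (hf.sub bE) hg]
    simp only [add_sub_cancel]
  have h1 := hN.scale bE (hg.sub bE') ht
  have h2 := hN.scale (hf.sub bE) hg (inv_pos.2 ht)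
  rw [inv_inv] at h2
  have h3 := q_bad hε hf
  have h4 := q_bad hε' hg
  have h5 := TD.q_Em_le hε hf T.N
  rw [hNN] at h4
  have cc' : T'.CC = T.CC := by unfold TD.CC; rw [hτ]
  have cc : T.CC = cC T.τ := rfl
  have ce : T.CE = cE T.τ := rfl
  rw [cc'] at h4
  rw [cc] at h h3 h4
  rw [ce] at h h5
  rw [e1]
  refine (norm_add_le _ _).trans ((add_le_add ((norm_add_le _ _).trans (add_le_add h h1)) h2).trans ?_)
  have q0 := q_nonneg (σ := σ) f
  have q0' := q_nonneg (σ := σ) g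
  have cp := cC_pos T.τ
  have ep := cE_nn T.τ
  have ti := (inv_pos.2 ht).le
  have nR : ∀ (T : TD σ ι) f Lam n,0 ≤ R1 T f Lam n := fun T f Lam n => Finset.sum_nonneg fun j _ =>
    integral_nonneg fun x => by dsimp only; split_ifs <;> positivity
  have nR2 : ∀ (T : TD σ ι) f Lam n,0 ≤ R2 T f Lam r n := fun T f Lam n => Finset.sum_nonneg fun j _ =>
    Finset.sum_nonneg fun i _ => integral_nonneg fun x => by dsimp only; split_ifs <;> positivity
  have nB : ∀ (T : TD σ ι) f ε,0 ≤ RB T f ε := fun T f ε => Finset.sum_nonneg fun j _ =>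
    integral_nonneg fun x => by positivity
  have sR := add_nonneg (add_nonneg (nR T' g Lam T.N) (nR2 T f Lam' T.N)) (add_nonneg (nR T f Lam' T.N) (nR2 T' g Lam T.N))
  have sB := add_nonneg (nB T f ε) (nB T' g ε')
  set SR := R1 T' g Lam T.N+R2 T f Lam' r T.N+(R1 T f Lam' T.N+R2 T' g Lam r T.N) with hSR
  have hSR' : R1 T' g Lam T.N+R2 T f Lam' r T.N+R1 T f Lam' T.N+R2 T' g Lam r T.N = SR := by rw [hSR]; ring
  rw [hSR']
  unfold c1 c2 c3
  have z1 := mul_le_mul_of_nonneg_left h5 (mul_nonneg N0 ht.le)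
  have z2 := mul_le_mul_of_nonneg_left h3 (mul_nonneg N0 ti)
  have z3 := mul_le_mul_of_nonneg_left h4 (mul_nonneg N0 ti)
  have y1 :0 ≤ N*t⁻¹*cC T.τ*SR := by positivity
  have y2 :0 ≤ N*t⁻¹*(2*3^d*(r+1))*(RB T f ε+RB T' g ε') := by positivity
  have y3 :0 ≤ N*t*q σ f := by positivity
  have y4 :0 ≤ N*t*(cE T.τ*q σ g) := by positivity
  linarith only [z1, z2, z3, y1, y2, y3, y4]
open Classical in
theorem ind_sum {Ω : Type*} [Fintype Ω] {u : Ω → X → ℝ} {F : X → ℝ} (hu : ∀ ω, BM (u ω)) (hF : BM F)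
    (F0 : ∀ x,0 ≤ F x) {p : ℝ} (h : ∀ x, ∑ ω, u ω x ≤ p) :
    ∑ ω, ∫ x, u ω x*F x ∂σ ≤ p * ∫ x, F x ∂σ := by
  rw [← integral_finset_sum _ fun ω _ => ((hu ω).mul hF).int, ← integral_const_mul]
  refine integral_mono (BM.sum _ fun ω => (hu ω).mul hF).int ((BM.const _).mul hF).int fun x => ?_
  dsimp only
  rw [← Finset.sum_mul]
  exact mul_le_mul_of_nonneg_right (h x) (F0 x)
open Classical in
theorem absorb {Ω : Type*} [Fintype Ω] (T : Ω → TD σ ι) (Lam : Ω → ℕ → Set X)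
    (U : Ω → Set X) (ε : Ω → Ω → ℕ → X → ℂ) {τ η t pl pb N : ℝ} {n : ℕ}
    (K : KH σ k Φ P ℓ b γ A W D θ) (I : BH ℓ θ idx)
    (L : ∀ ω f, (∀ x, x ∉ U ω → f x =0) → LH d Φ ℓ D θ (T ω) f (Lam ω))
    (hb : ∀ ω, (T ω).b = b) (hτ : ∀ ω, (T ω).τ = τ) (hn : ∀ ω, (T ω).N = n)
    (hε : ∀ ω ω', (T ω).Sel (ε ω ω')) (hG : ∀ ω ω', GD ℓ r (T ω') (ε ω ω'))
    (hr :225*D^2 <2^r) (mU : ∀ ω, MeasurableSet (U ω)) (hη :0 < η)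
    (hU : ∀ x, η*Fintype.card Ω ≤ ∑ ω, if x ∈ U ω then (1:ℝ) else 0)
    (hpl : ∀ j x, j < n → ∑ ω, (if x ∈ Lam ω j then (1:ℝ) else 0) ≤ pl*Fintype.card Ω)
    (hpb : ∀ j x ω, j < n → ∑ ω', ‖1-ε ω ω' j x‖^2 ≤ pb*Fintype.card Ω) (pb0 :0 ≤ pb) (pl0 :0 ≤ pl)
    (N0 :0 ≤ N) (hN : NB σ k N) (ht :0 < t) [Nonempty Ω] :
    NB σ k ((c1 τ W A γ r+N*(t*c2 τ d r+t⁻¹*c3 τ d r*(cC τ*((r+2)*pl+pb))))*η⁻¹) := by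
  intro f g hf hg
  set M : ℝ := ((Fintype.card Ω : ℕ) : ℝ) with hM
  have M0 :0 < M := by rw [hM]; exact_mod_cast Fintype.card_pos
  set cnt : X → ℝ := fun x => ∑ ω, if x ∈ U ω then (1:ℝ) else 0 with hcnt
  have cm : BM cnt := BM.sum _ fun ω => (BM.const 1).ite (BM.const 0) (mU ω)
  have c0 : ∀ x,0 < cnt x := fun x => (mul_pos hη M0).trans_le (hU x)
  have cir : BM (fun x => (cnt x)⁻¹) := by
    refine ⟨cm.m.inv, (η*M)⁻¹, fun x => ?_⟩
    show ‖(cnt x)⁻¹‖ ≤ _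
    rw [norm_inv, Real.norm_of_nonneg (c0 x).le]
    exact inv_anti₀ (by positivity) (hU x)
  have cim : BM (fun x => (((cnt x)⁻¹ : ℝ) : ℂ)) := by
    refine BM.ofReal cir
  have hw : ∀ ω, BM (fun x => if x ∈ U ω then (((cnt x)⁻¹ : ℝ) : ℂ) else 0) := fun ω =>
    cim.ite (BM.const 0) (mU ω)
  set pc : (X → ℂ) → Ω → X → ℂ := fun f ω x => (if x ∈ U ω then (((cnt x)⁻¹ : ℝ) : ℂ) else 0)*f x with hpc
  have pcb : ∀ f, BM f → ∀ ω, BM (pc f ω) := fun f hf ω => (hw ω).mul hf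
  have pcs : ∀ f x, ∑ ω, pc f ω x = f x := by
    intro f x
    simp only [hpc]
    rw [← Finset.sum_mul]
    have : ∑ ω, (if x ∈ U ω then (((cnt x)⁻¹ : ℝ) : ℂ) else 0) = (((cnt x)⁻¹*cnt x : ℝ) : ℂ) := by
      have h0 : (cnt x)⁻¹*cnt x = ∑ ω, (if x ∈ U ω then (cnt x)⁻¹ else 0) := by
        conv_lhs => enter [2]; rw [hcnt]
        simp only [Finset.mul_sum, mul_ite, mul_one, mul_zero]
      rw [h0, Complex.ofReal_sum]
      refine Finset.sum_congr rfl fun ω _ => ?_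
      split_ifs <;> simp
    rw [this, inv_mul_cancel₀ (c0 x).ne']; simp
  have pcq : ∀ f, BM f → M * ∑ ω, q σ (pc f ω) ≤ η⁻¹*q σ f := by
    intro f hf
    have h1 : ∀ ω, q σ (pc f ω) = ∫ x, (if x ∈ U ω then (cnt x)⁻¹^2 else 0)*‖f x‖^2 ∂σ := fun ω => by
      unfold q; congr 1; funext x
      simp only [hpc, norm_mul, mul_pow]
      congr 1
      split_ifs
      · rw [Complex.norm_real, Real.norm_eq_abs, sq_abs]
      · simp
    simp only [h1]
    have h2 := ind_sum (σ := σ) (u := fun ω x => if x ∈ U ω then (cnt x)⁻¹^2 else 0) (F := fun x => ‖f x‖^2)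
      (p := (η*M)⁻¹) (fun ω => by
        refine BM.ite ?_ (BM.const 0) (mU ω)
        exact cir.pow) hf.norm.pow (fun x => sq_nonneg _) (fun x => by
        have : ∑ ω, (if x ∈ U ω then (cnt x)⁻¹^2 else 0) = (cnt x)⁻¹^2*cnt x := by
          conv_rhs => enter [2]; rw [hcnt]
          simp only [Finset.mul_sum]
          refine Finset.sum_congr rfl fun ω _ => ?_
          split_ifs <;> simp
        rw [this, sq, mul_assoc, inv_mul_cancel₀ (c0 x).ne', mul_one]
        exact inv_anti₀ (by positivity) (hU x))
    refine (mul_le_mul_of_nonneg_left h2 M0.le).trans (le_of_eq ?_)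
    unfold q; field_simp
  have key : ∀ ω ω', _ := fun ω ω' => pair K I (L ω (pc f ω) fun x hx => by simp [hpc, hx])
    (L ω' (pc g ω') fun x hx => by simp [hpc, hx]) (hε ω ω') (hε ω' ω) hr (hG ω' ω) (hG ω ω')
    (pcb f hf ω) (pcb g hg ω') (hb ω) (hb ω') ((hτ ω').trans (hτ ω).symm) ((hn ω').trans (hn ω).symm) N0 hN ht
  simp only [hτ, hn] at key
  have e0 : ‖fm σ k f g‖ ≤ ∑ ω, ∑ ω', ‖fm σ k (pc f ω) (pc g ω')‖ := by
    have : fm σ k f g = ∑ ω, ∑ ω', fm σ k (pc f ω) (pc g ω') := by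
      unfold fm
      simp only [← integral_finset_sum _ fun ω' _ => (fm_bm K.bm (pcb f hf _) (pcb g hg ω')).int]
      rw [← integral_finset_sum _ fun ω _ => (BM.sum _ fun ω' => fm_bm K.bm (pcb f hf ω) (pcb g hg ω')).int]
      congr 1; funext z
      simp only [← Finset.mul_sum, ← Finset.sum_mul, pcs]
    rw [this]
    exact (norm_sum_le _ _).trans (Finset.sum_le_sum fun ω _ => norm_sum_le _ _)
  refine e0.trans ((Finset.sum_le_sum fun ω _ => Finset.sum_le_sum fun ω' _ => key ω ω').trans ?_)
  simp only [Finset.sum_add_distrib, ← Finset.mul_sum]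
  have cp := cC_pos τ
  have sq' : ∀ f, BM f → ∀ ω, ∑ j ∈ Finset.range n, ∫ x, (T ω).GG (pc f ω) (pc f ω) j x^2 ∂σ ≤ cC τ*q σ (pc f ω) := by
    intro f hf ω
    have := (T ω).sqG (pcb f hf ω) (pcb f hf ω) (fun _ => le_rfl) n
    rwa [show (T ω).CC = cC τ by rw [← hτ ω]; rfl] at this
  have GB : ∀ f, BM f → ∀ ω j, BM (fun x => (T ω).GG (pc f ω) (pc f ω) j x^2) := fun f hf ω j =>
    ((T ω).GG_bm (pcb f hf ω) (pcb f hf ω) j).pow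
  have mL : ∀ ω j, MeasurableSet (Lam ω j) := fun ω j => (L ω (fun _ =>0) fun _ _ => rfl).mL j
  have lamS : ∀ f, BM f → ∀ ω' i j, j < n → ∑ ω, ∫ x, (if x ∈ Lam ω j then (T ω').GG (pc f ω') (pc f ω') i x^2 else 0) ∂σ
      ≤ pl*M * ∫ x, (T ω').GG (pc f ω') (pc f ω') i x^2 ∂σ := by
    intro f hf ω' i j hj
    have := ind_sum (σ := σ) (u := fun ω x => if x ∈ Lam ω j then (1:ℝ) else 0) (F := _)
      (fun ω => (BM.const 1).ite (BM.const 0) (mL ω j)) (GB f hf ω' i) (fun x => sq_nonneg _) (fun x => hpl j x hj)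
    simpa only [ite_mul, one_mul, zero_mul] using this
  have r1 : ∀ f, BM f → ∀ ω', ∑ ω, R1 (T ω') (pc f ω') (Lam ω) n ≤ pl*M*(cC τ*q σ (pc f ω')) := by
    intro f hf ω'
    unfold R1
    rw [Finset.sum_comm]
    refine (Finset.sum_le_sum fun j hj => lamS f hf ω' j j (Finset.mem_range.1 hj)).trans ?_
    rw [← Finset.mul_sum]
    exact mul_le_mul_of_nonneg_left (sq' f hf ω') (by positivity)
  have r2 : ∀ f, BM f → ∀ ω', ∑ ω, R2 (T ω') (pc f ω') (Lam ω) r n ≤ pl*M*((r+1)*(cC τ*q σ (pc f ω'))) := by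
    intro f hf ω'
    unfold R2
    rw [Finset.sum_comm]
    refine (Finset.sum_le_sum (g := fun j => ∑ i ∈ Finset.Ico (j-r) (j+1), pl*M * ∫ x, (T ω').GG (pc f ω') (pc f ω') i x^2 ∂σ)
      fun j hj => ?_).trans ?_
    · rw [Finset.sum_comm]
      exact Finset.sum_le_sum fun i _ => lamS f hf ω' i j (Finset.mem_range.1 hj)
    · simp only [← Finset.mul_sum]
      refine mul_le_mul_of_nonneg_left ?_ (by positivity)
      refine (band_sum (fun i => integral_nonneg fun x => sq_nonneg _) le_rfl n).trans ?_
      exact mul_le_mul_of_nonneg_left (sq' f hf ω') (by positivity)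
  have rb : ∀ f, BM f → ∀ ω, ∑ ω', RB (T ω) (pc f ω) (ε ω ω') ≤ pb*M*(cC τ*q σ (pc f ω)) := by
    intro f hf ω
    unfold RB
    rw [Finset.sum_comm, hn]
    refine (Finset.sum_le_sum fun j hj => ind_sum (fun ω' => ((BM.const 1).sub ((hε ω ω').bm j)).norm.pow)
      (GB f hf ω j) (fun x => sq_nonneg _) (fun x => hpb j x ω (Finset.mem_range.1 hj))).trans ?_
    rw [← Finset.mul_sum]
    exact mul_le_mul_of_nonneg_left (sq' f hf ω) (by positivity)
  have S : ∀ {F : Ω → ℝ} {a : ℝ} {f : X → ℂ}, (∀ ω, F ω ≤ a*q σ (pc f ω)) → ∑ ω, F ω ≤ a * ∑ ω, q σ (pc f ω) :=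
    fun h => (Finset.sum_le_sum fun ω _ => h ω).trans (by rw [Finset.mul_sum])
  have s1 := S (F := fun ω' => ∑ ω, R1 (T ω') (pc g ω') (Lam ω) n) (a := pl*M*cC τ) (f := g) fun ω' => (r1 g hg ω').trans (le_of_eq (by ring))
  have s2 := S (F := fun ω => ∑ ω', R1 (T ω) (pc f ω) (Lam ω') n) (a := pl*M*cC τ) (f := f) fun ω' => (r1 f hf ω').trans (le_of_eq (by ring))
  have s3 := S (F := fun ω' => ∑ ω, R2 (T ω') (pc g ω') (Lam ω) r n) (a := pl*M*((r+1)*cC τ)) (f := g) fun ω' => (r2 g hg ω').trans (le_of_eq (by ring))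
  have s4 := S (F := fun ω => ∑ ω', R2 (T ω) (pc f ω) (Lam ω') r n) (a := pl*M*((r+1)*cC τ)) (f := f) fun ω' => (r2 f hf ω').trans (le_of_eq (by ring))
  have s5 := S (F := fun ω' => ∑ ω, RB (T ω') (pc g ω') (ε ω' ω)) (a := pb*M*cC τ) (f := g) fun ω' => (rb g hg ω').trans (le_of_eq (by ring))
  have s6 := S (F := fun ω => ∑ ω', RB (T ω) (pc f ω) (ε ω ω')) (a := pb*M*cC τ) (f := f) fun ω' => (rb f hf ω').trans (le_of_eq (by ring))
  rw [Finset.sum_comm] at s1 s3 s5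
  simp only [Finset.sum_const, Finset.card_univ, nsmul_eq_mul, ← hM, ← Finset.mul_sum]
  have pf := pcq f hf
  have pg := pcq g hg
  have c1p :0 ≤ c1 τ W A γ r := by
    have := cE_nn τ; have := K.A0; have := K.g0
    have g1 :0 ≤ (1-γ)⁻¹ := inv_nonneg.2 (by linarith [K.g1])
    unfold c1; positivity
  have c2p := c2_pos τ d r
  have c3p := c3_pos τ d r
  set Sf := ∑ ω, q σ (pc f ω)
  set Sg := ∑ ω, q σ (pc g ω)
  have a1 := mul_le_mul_of_nonneg_left (add_le_add pf pg) (show 0 ≤ c1 τ W A γ r+N*t*c2 τ d r+N*t⁻¹*c3 τ d r*(cC τ*((r+2)*pl+pb)) by positivity)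
  have a2 := mul_le_mul_of_nonneg_left (add_le_add (add_le_add (add_le_add s1 s4) (add_le_add s2 s3)) (add_le_add s6 s5)) (show 0 ≤ N*t⁻¹*c3 τ d r by positivity)
  linarith only [a1, a2]
end core5
section supp
structure CK {X : Type*} [MetricSpace X] [MeasurableSpace X] (K : X → X → ℂ) (n C α : ℝ) : Prop where
  m : Measurable (fun z : X × X => K z.1 z.2)
  anti : ∀ x y, K x y = - K y x
  size : ∀ x y, ‖K x y‖ ≤ C/dist x y^n
  sm : ∀ x x' y, x ≠ y →2*dist x x' ≤ dist x y →
    ‖K x y-K x' y‖ ≤ C*((dist x x'/dist x y)^α/dist x y^n)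
  n0 :0 < n
  C0 :0 < C
  a0 :0 < α
  a1 : α ≤1
def sw {X : Type*} [MetricSpace X] (Φ : X → ℝ) (x y : X) : ℝ := max 0 (1-Φ x*Φ y/dist x y^2)
def sK {X : Type*} [MetricSpace X] (K : X → X → ℂ) (Φ : X → ℝ) (x y : X) : ℂ := K x y*(sw Φ x y : ℝ)
def sP {X : Type*} [MetricSpace X] (Φ : X → ℝ) (ℓ : ℕ → ℝ) (n β : ℝ) (j : ℕ) (x y : X) : ℝ :=
  (ℓ j/(ℓ j+dist x y+Φ x+Φ y))^β/(ℓ j+dist x y+Φ x+Φ y)^n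
def sS (n β : ℝ) : ℝ :=2^β*2^n*(1-(1/2 : ℝ)^β)⁻¹
variable {X : Type*} [MetricSpace X] [MeasurableSpace X] [OpensMeasurableSpace X]
  [SecondCountableTopology X] {σ : Measure X} [IsFiniteMeasure σ] {K : X → X → ℂ} {n C α : ℝ}
  {Φ : X → ℝ}
theorem shell {x : X} {R0 Λ β n : ℝ} (hR :0 < R0) (hL :0 ≤ Λ) (hb :0 < β) (hn :0 ≤ n)
    (hg : ∀ R, R0 ≤ R → σ.real (ball x R) ≤ Λ*R^n) :
    ∫ y, (R0/(R0+dist x y))^β/(R0+dist x y)^n ∂σ ≤ Λ*sS n β := by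
  set w : ℝ := (1/2 : ℝ)^β with hw
  have w0 :0 < w := by positivity
  have w1 : w <1 := Real.rpow_lt_one (by norm_num) (by norm_num) hb
  set c : ℕ → ℝ := fun j =>2^β*2^n*w^j/(2^j*R0)^n with hc
  have c0 : ∀ j,0 ≤ c j := fun j => by positivity
  have pt : ∀ y, ENNReal.ofReal ((R0/(R0+dist x y))^β/(R0+dist x y)^n) ≤
      ∑' j : ℕ, (ball x (2^j*R0)).indicator (fun _ => ENNReal.ofReal (c j)) y := by
    intro y
    have ex : ∃ j : ℕ, dist x y <2^j*R0 := by
      obtain ⟨j, hj⟩ := pow_unbounded_of_one_lt (dist x y/R0) (one_lt_two (α := ℝ))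
      exact ⟨j, by rwa [div_lt_iff₀ hR] at hj⟩
    classical
    obtain ⟨j, h1, h2⟩ : ∃ j : ℕ, dist x y <2^j*R0 ∧ 2^j*R0 ≤2*(R0+dist x y) := by
      refine ⟨Nat.find ex, Nat.find_spec ex, ?_⟩
      rcases hj : Nat.find ex with _ | j
      · have := dist_nonneg (x := x) (y := y); simp; linarith
      · have := Nat.find_min ex (m := j) (by omega)
        rw [not_lt] at this
        rw [pow_succ]; linarith
    refine le_trans ?_ (ENNReal.le_tsum j)
    rw [indicator_of_mem (by rwa [mem_ball, dist_comm])]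
    refine ENNReal.ofReal_le_ofReal ?_
    have L0 :0 < R0+dist x y := by have := dist_nonneg (x := x) (y := y); linarith
    have e : c j = (R0/(2^j*R0/2))^β/(2^j*R0/2)^n := by
      have : R0/(2^j*R0/2) =2*(1/2)^j := by field_simp; rw [← mul_pow]; norm_num
      rw [this, Real.mul_rpow (by norm_num) (by positivity), Real.div_rpow (by positivity) (by norm_num), hc, hw,
        ← Real.rpow_natCast ((1/2 : ℝ)) j, ← Real.rpow_mul (by norm_num), mul_comm (j:ℝ) β, Real.rpow_mul (by norm_num), Real.rpow_natCast]
      field_simp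
    rw [e]
    have h3 :2^j*R0/2 ≤ R0+dist x y := by linarith
    gcongr
  have hm : ∀ y,0 ≤ (R0/(R0+dist x y))^β/(R0+dist x y)^n := fun y => by positivity
  rw [integral_eq_lintegral_of_nonneg_ae (Filter.Eventually.of_forall hm) (by
    have : Measurable fun y => dist x y := measurable_const.dist measurable_id
    exact (((measurable_const.div (measurable_const.add this)).pow_const _).div ((measurable_const.add this).pow_const _)).aestronglyMeasurable)]
  have S0 :0 ≤ Λ*sS n β := by
    have :0 <1-w := by linarith
    unfold sS; rw [← hw]; positivity
  refine ENNReal.toReal_le_of_le_ofReal S0 ((lintegral_mono pt).trans ?_)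
  rw [lintegral_tsum fun j => (measurable_const.indicator measurableSet_ball).aemeasurable]
  have : ∀ j, ∫⁻ y, (ball x (2^j*R0)).indicator (fun _ => ENNReal.ofReal (c j)) y ∂σ ≤
      ENNReal.ofReal (Λ*(2^β*2^n)*w^j) := by
    intro j
    rw [lintegral_indicator measurableSet_ball, setLIntegral_const, ← ofReal_measureReal,
      ← ENNReal.ofReal_mul (c0 j)]
    refine ENNReal.ofReal_le_ofReal ?_
    have p :0 < ((2:ℝ)^j*R0)^n := by positivity
    refine (mul_le_mul_of_nonneg_left (hg _ (le_mul_of_one_le_left hR.le (one_le_pow₀ (by norm_num)))) (c0 j)).trans (le_of_eq ?_)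
    simp only [hc]; field_simp
  refine (ENNReal.tsum_le_tsum this).trans (le_of_eq ?_)
  rw [← ENNReal.ofReal_tsum_of_nonneg (fun j => by positivity) ((summable_geometric_of_lt_one w0.le w1).mul_left _),
    tsum_mul_left, tsum_geometric_of_lt_one w0.le w1]
  congr 1; unfold sS; ring
theorem sw_nn (x y : X) :0 ≤ sw Φ x y := le_max_left _ _
theorem sw_le (hp : ∀ x,0 ≤ Φ x) (x y : X) : sw Φ x y ≤1 := by
  refine max_le zero_le_one (sub_le_self _ ?_)
  have := hp x; have := hp y; positivity
theorem sK_lt (hL : ∀ x y, Φ x ≤ Φ y+dist x y) (H : CK K n C α) {x y : X} (h : sK K Φ x y ≠ 0) :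
    0 < dist x y ∧ Φ x <2*dist x y ∧ Φ y <2*dist x y := by
  have h1 : K x y ≠ 0 := fun e => h (by simp [sK, e])
  have h2 : x ≠ y := fun e => by
    subst e; exact h1 (by have := H.anti x x; exact self_eq_neg.1 this)
  have h3 :0 < dist x y := dist_pos.2 h2
  have h4 :0 <1-Φ x*Φ y/dist x y^2 := by
    by_contra e; exact h (by simp [sK, sw, max_eq_left (not_lt.1 e)])
  have h5 : Φ x*Φ y < dist x y^2 := by
    rw [sub_pos, div_lt_one (by positivity)] at h4; exact h4
  have := hL x y; have h7 := hL y x; rw [dist_comm] at h7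
  refine ⟨h3, ?_, ?_⟩ <;> by_contra e <;> rw [not_lt] at e <;> nlinarith
theorem sK_le (hp : ∀ x,0 ≤ Φ x) (H : CK K n C α) (x y : X) : ‖sK K Φ x y‖ ≤ C/dist x y^n := by
  unfold sK
  rw [norm_mul, Complex.norm_real, Real.norm_of_nonneg (sw_nn x y)]
  exact (mul_le_of_le_one_right (norm_nonneg _) (sw_le hp x y)).trans (H.size x y)
theorem sK_bd {δ : ℝ} (d0 :0 < δ) (hδ : ∀ x, δ ≤ Φ x)
    (hL : ∀ x y, Φ x ≤ Φ y+dist x y) (H : CK K n C α) (x y : X) : ‖sK K Φ x y‖ ≤ C/(δ/2)^n := by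
  by_cases h : sK K Φ x y =0
  · rw [h, norm_zero]; have := H.C0; positivity
  · obtain ⟨h1, h2, -⟩ := sK_lt hL H h
    refine (sK_le (fun x => d0.le.trans (hδ x)) H _ _).trans ?_
    have := hδ x; have := H.C0; have := H.n0.le
    have : δ/2 ≤ dist x y := by linarith
    gcongr
theorem sK_bm (hm : Measurable Φ) {δ : ℝ} (d0 :0 < δ) (hδ : ∀ x, δ ≤ Φ x)
    (hL : ∀ x y, Φ x ≤ Φ y+dist x y) (H : CK K n C α) : BM (fun z : X × X => sK K Φ z.1 z.2) := by
  refine ⟨?_, C/(δ/2)^n, fun z => sK_bd d0 hδ hL H _ _⟩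
  unfold sK sw
  refine H.m.mul (Complex.measurable_ofReal.comp (measurable_const.max (measurable_const.sub ?_)))
  exact ((hm.comp measurable_fst).mul (hm.comp measurable_snd)).div (measurable_dist.pow_const 2)
theorem sK_anti (H : CK K n C α) (x y : X) : sK K Φ x y = - sK K Φ y x := by
  unfold sK sw; rw [H.anti, dist_comm x y, mul_comm (Φ x)]; ring
def kA (n C α D θ : ℝ) : ℝ := C*(1+64*2^n)*8^(α+n)*D+C*(θ⁻¹+26*D)^(2*α+n)
def kW (n C α Λ W0 : ℝ) : ℝ := W0+11*3^n*C*(Λ*3^n*sS n α)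
theorem sw_diff {Φ : X → ℝ} (hp : ∀ x,0 ≤ Φ x) (hL : ∀ x y, Φ x ≤ Φ y+dist x y) {x x' y : X}
    (h0 :0 < dist x y) (h :3*dist x x' ≤ dist x y) (h1 : Φ x ≤4*dist x y) (h2 : Φ y ≤8/3*dist x y) :
    |sw Φ x y-sw Φ x' y| ≤64*(dist x x'/dist x y) := by
  set ρ := dist x y
  set ρ' := dist x' y with hρ'
  set u := dist x x' with hu
  have u0 :0 ≤ u := dist_nonneg
  have t1 : ρ ≤ u+ρ' := dist_triangle _ _ _
  have t2 : ρ' ≤ u+ρ := by have := dist_triangle x' x y; rwa [dist_comm x' x] at this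
  have p1 := hp x; have p2 := hp y; have p3 := hp x'
  have l1 := hL x x'; have l2 := hL x' x; rw [dist_comm] at l2
  have r0 :0 < ρ' := by linarith
  have e1 : |sw Φ x y-sw Φ x' y| ≤ |Φ x'*Φ y/ρ'^2-Φ x*Φ y/ρ^2| := by
    unfold sw
    refine (abs_max_sub_max_le_max _ _ _ _).trans ?_
    rw [sub_self, abs_zero, max_eq_right (abs_nonneg _)]
    exact le_of_eq (by congr 1; ring)
  refine e1.trans ?_
  have e2 : Φ x'*Φ y/ρ'^2-Φ x*Φ y/ρ^2 =
      Φ y*((Φ x'-Φ x)*ρ^2+Φ x*((ρ-ρ')*(ρ+ρ')))/(ρ^2*ρ'^2) := by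
    field_simp; ring
  rw [e2, abs_div, abs_of_pos (show 0 < ρ^2*ρ'^2 by positivity), abs_mul, abs_of_nonneg p2]
  have e3 : |(Φ x'-Φ x)*ρ^2+Φ x*((ρ-ρ')*(ρ+ρ'))| ≤ u*ρ^2+4*ρ*(u*(7/3*ρ)) := by
    refine (abs_add_le _ _).trans (add_le_add ?_ ?_)
    · rw [abs_mul, abs_of_nonneg (sq_nonneg ρ)]
      exact mul_le_mul_of_nonneg_right (abs_le.2 ⟨by linarith, by linarith⟩) (sq_nonneg _)
    · rw [abs_mul, abs_mul, abs_of_nonneg p1, abs_of_nonneg (show 0 ≤ ρ+ρ' by linarith)]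
      have : |ρ-ρ'| ≤ u := abs_le.2 ⟨by linarith, by linarith⟩
      have : ρ+ρ' ≤7/3*ρ := by linarith
      gcongr
  have e4 :4/9*ρ^2 ≤ ρ'^2 := by nlinarith
  calc _ ≤8/3*ρ*(u*ρ^2+4*ρ*(u*(7/3*ρ)))/(ρ^2*(4/9*ρ^2)) := by gcongr
    _ = (62 : ℝ)*(u/ρ) := by field_simp; ring
    _ ≤ _ := by have :0 ≤ u/ρ := by positivity
                linarith
theorem sK_far (hp : ∀ x,0 ≤ Φ x) (hL : ∀ x y, Φ x ≤ Φ y+dist x y) (H : CK K n C α) {D l : ℝ} (hD :1 ≤ D)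
    (l0 :0 < l) {x x' y : X} (h1 : dist x x' ≤ D*l) (h2 :3*D*l ≤ dist x y) :
    ‖sK K Φ x y-sK K Φ x' y‖ ≤ C*(1+64*2^n)*8^(α+n)*D *
      ((l/(l+dist x y+Φ x+Φ y))^α/(l+dist x y+Φ x+Φ y)^n) := by
  have a0 := H.a0; have C0 := H.C0; have n0 := H.n0
  have p1 := hp x; have p2 := hp y; have p3 := hp x'
  have Dl : l ≤ D*l := le_mul_of_one_le_left l0.le hD
  have r0 :0 < dist x y := by nlinarith
  by_cases hz : sK K Φ x y =0 ∧ sK K Φ x' y =0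
  · rw [hz.1, hz.2, sub_zero, norm_zero]; positivity
  set ρ := dist x y with hρ
  have u0 :0 ≤ dist x x' := dist_nonneg
  set u := dist x x' with hu
  have t1 : ρ ≤ u+dist x' y := dist_triangle _ _ _
  have t2 : dist x' y ≤ u+ρ := by have := dist_triangle x' x y; rwa [dist_comm x' x] at this
  have l1 := hL x y
  have cy : Φ y ≤8/3*ρ := by
    rw [not_and_or] at hz
    rcases hz with h | h
    · have := (sK_lt hL H h).2.2; linarith
    · have := (sK_lt hL H h).2.2; linarith
  have cx : Φ x ≤4*ρ := by linarith
  have dw := sw_diff hp hL r0 (by linarith) cx cy (x' := x')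
  have hxy : x ≠ y := dist_pos.1 r0
  have b1 := H.sm x x' y hxy (by linarith)
  have t0 :0 ≤ u/ρ := by positivity
  have t1' : u/ρ ≤1 := by rw [div_le_one r0]; linarith
  have b2 : u/ρ ≤ (u/ρ)^α := by
    rcases t0.eq_or_lt with h | h
    · rw [← h]; positivity
    · conv_lhs => rw [← Real.rpow_one (u/ρ)]
      exact Real.rpow_le_rpow_of_exponent_ge h t1' H.a1
  have b3 : ‖K x' y‖ ≤ C*2^n/ρ^n := by
    refine (H.size x' y).trans ?_
    have : C*2^n/ρ^n = C/(ρ/2)^n := by rw [Real.div_rpow r0.le (by norm_num)]; field_simp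
    rw [this]
    have : ρ/2 ≤ dist x' y := by linarith
    gcongr
  have main : ‖sK K Φ x y-sK K Φ x' y‖ ≤ C*(1+64*2^n)*((u/ρ)^α/ρ^n) := by
    have e : sK K Φ x y-sK K Φ x' y = (K x y-K x' y)*(sw Φ x y : ℝ) +
      K x' y*((sw Φ x y-sw Φ x' y : ℝ) : ℂ) := by unfold sK; push_cast; ring
    rw [e]
    refine (norm_add_le _ _).trans ?_
    rw [norm_mul, norm_mul, Complex.norm_real, Complex.norm_real, Real.norm_of_nonneg (sw_nn x y), Real.norm_eq_abs]
    calc _ ≤ C*((u/ρ)^α/ρ^n)*1+C*2^n/ρ^n*(64*(u/ρ)^α) := by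
          gcongr
          · exact sw_nn x y
          · exact sw_le hp x y
          · linarith
      _ = _ := by ring
  refine main.trans ?_
  have L0 :0 < l+ρ+Φ x+Φ y := by linarith
  have L8 : l+ρ+Φ x+Φ y ≤8*ρ := by nlinarith
  have e5 : (u/ρ)^α/ρ^n ≤8^(α+n)*D*((l/(l+ρ+Φ x+Φ y))^α/(l+ρ+Φ x+Φ y)^n) := by
    have e :8^(α+n)*D^α*((l/(l+ρ+Φ x+Φ y))^α/(l+ρ+Φ x+Φ y)^n) =
       (D*l/((l+ρ+Φ x+Φ y)/8))^α/((l+ρ+Φ x+Φ y)/8)^n := by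
      rw [Real.div_rpow (x := D*l) (by positivity) (by positivity), Real.mul_rpow (by positivity) (by positivity),
        Real.div_rpow (x := l+ρ+Φ x+Φ y) (by positivity) (by positivity), Real.div_rpow (x := l+ρ+Φ x+Φ y) (by positivity) (by positivity),
        Real.div_rpow (x := l) (by positivity) (by positivity), Real.rpow_add (by norm_num)]
      field_simp
    have hDa : D^α ≤ D := by
      conv_rhs => rw [← Real.rpow_one D]
      exact Real.rpow_le_rpow_of_exponent_le hD H.a1
    calc _ ≤ (D*l/((l+ρ+Φ x+Φ y)/8))^α/((l+ρ+Φ x+Φ y)/8)^n := by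
          have : (l+ρ+Φ x+Φ y)/8 ≤ ρ := by linarith
          gcongr
      _ = _ := e.symm
      _ ≤ _ := by gcongr
  calc _ ≤ C*(1+64*2^n)*(8^(α+n)*D*((l/(l+ρ+Φ x+Φ y))^α/(l+ρ+Φ x+Φ y)^n)) := by gcongr
    _ = _ := by ring
theorem sK_tb (hp : ∀ x,0 ≤ Φ x) (hL : ∀ x y, Φ x ≤ Φ y+dist x y) (H : CK K n C α) {x x0 : X} (y : X)
    (r0 :0 < Φ x) (h : dist x x0 ≤2*Φ x) [Decidable (8*Φ x < dist x0 y)] :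
    ‖sK K Φ x y-if 8*Φ x < dist x0 y then K x0 y else 0‖ ≤11*3^n*C *
      ((Φ x/(Φ x+dist x y))^α/(Φ x+dist x y)^n) := by
  have a0 := H.a0; have C0 := H.C0; have n0 := H.n0; have a1 := H.a1
  set a := Φ x with ha
  have t1 := dist_triangle x x0 y
  have t2 := dist_triangle x0 x y
  rw [dist_comm x0 x] at t2
  have ρ0 :0 ≤ dist x y := dist_nonneg
  set ρ := dist x y with hρ
  split_ifs with h8
  · have r6 :6*a < ρ := by linarith
    have rp :0 < ρ := by linarith
    have e : sK K Φ x y-K x0 y = (K x y-K x0 y)-K x y*((1-sw Φ x y : ℝ) : ℂ) := by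
      unfold sK; push_cast; ring
    have b1 := H.sm x x0 y (dist_pos.1 rp) (by linarith)
    have b1' : ‖K x y-K x0 y‖ ≤ C*(2*(a/ρ)^α/ρ^n) := by
      refine b1.trans (mul_le_mul_of_nonneg_left ?_ C0.le)
      have : (2*a/ρ)^α ≤2*(a/ρ)^α := by
        rw [mul_div_assoc, Real.mul_rpow (by norm_num) (by positivity)]
        gcongr
        conv_rhs => rw [← Real.rpow_one 2]
        exact Real.rpow_le_rpow_of_exponent_le (by norm_num) a1
      calc _ ≤ (2*a/ρ)^α/ρ^n := by gcongr
        _ ≤ _ := by gcongr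
    have b2 :1-sw Φ x y ≤2*(a/ρ)^α := by
      have l1 := hL y x; rw [dist_comm y x] at l1
      have s1 :1-sw Φ x y ≤ Φ x*Φ y/ρ^2 := by
        have := le_max_right 0 (1-Φ x*Φ y/dist x y^2)
        unfold sw; linarith
      have s2 : Φ x*Φ y/ρ^2 ≤2*(a/ρ) := by
        rw [div_le_iff₀ (by positivity)]
        have :2*(a/ρ)*ρ^2 =2*a*ρ := by field_simp
        rw [this, ← ha]; nlinarith
      have s3 : a/ρ ≤ (a/ρ)^α := by
        conv_lhs => rw [← Real.rpow_one (a/ρ)]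
        exact Real.rpow_le_rpow_of_exponent_ge (by positivity) (by rw [div_le_one rp]; linarith) a1
      linarith
    rw [e]
    refine (norm_sub_le _ _).trans ?_
    rw [norm_mul, Complex.norm_real, Real.norm_of_nonneg (sub_nonneg.2 (sw_le hp x y))]
    have f1 : (a/ρ)^α/ρ^n ≤2*2^n*((a/(a+ρ))^α/(a+ρ)^n) := by
      have e :2^α*2^n*((a/(a+ρ))^α/(a+ρ)^n) = (a/((a+ρ)/2))^α/((a+ρ)/2)^n := by
        rw [Real.div_rpow (x := a) (y := (a+ρ)/2) (by positivity) (by positivity), Real.div_rpow (x := a+ρ) (by positivity) (by positivity),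
          Real.div_rpow (x := a+ρ) (by positivity) (by positivity), Real.div_rpow (x := a) (by positivity) (by positivity)]
        field_simp
      have h2 : (2:ℝ)^α ≤2 := by
        conv_rhs => rw [← Real.rpow_one 2]
        exact Real.rpow_le_rpow_of_exponent_le (by norm_num) a1
      calc _ ≤ (a/((a+ρ)/2))^α/((a+ρ)/2)^n := by
            have : (a+ρ)/2 ≤ ρ := by linarith
            gcongr
        _ = _ := e.symm
        _ ≤ _ := by gcongr
    have h23 : (2:ℝ)^n ≤3^n := by gcongr; norm_num
    have z0 :0 ≤ (a/(a+ρ))^α/(a+ρ)^n := by positivity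
    calc _ ≤ C*(2*(a/ρ)^α/ρ^n)+C/ρ^n*(2*(a/ρ)^α) := by
          gcongr
          · exact sub_nonneg.2 (sw_le hp x y)
          · exact H.size x y
      _ =4*C*((a/ρ)^α/ρ^n) := by ring
      _ ≤4*C*(2*2^n*((a/(a+ρ))^α/(a+ρ)^n)) := by gcongr
      _ =8*2^n*C*((a/(a+ρ))^α/(a+ρ)^n) := by ring
      _ ≤ _ := by gcongr; norm_num
  · rw [sub_zero]
    by_cases hz : sK K Φ x y =0
    · rw [hz, norm_zero]; positivity
    obtain ⟨rp, h2, h3⟩ := sK_lt hL H hz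
    refine (sK_le hp H x y).trans ?_
    have f1 :1/11 ≤ (a/(a+ρ))^α := by
      have :1/11 ≤ a/(a+ρ) := by rw [div_le_div_iff₀ (by norm_num) (by positivity)]; linarith
      refine this.trans ?_
      conv_lhs => rw [← Real.rpow_one (a/(a+ρ))]
      exact Real.rpow_le_rpow_of_exponent_ge (by positivity) (by rw [div_le_one (by positivity)]; linarith) a1
    have f2 :1/ρ^n ≤3^n/(a+ρ)^n := by
      rw [← Real.div_rpow (by norm_num) (by positivity), one_div, ← Real.inv_rpow rp.le]
      gcongr
      rw [inv_eq_one_div, div_le_div_iff₀ rp (by positivity)]; linarith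
    calc _ = C*(1/ρ^n) := by ring
      _ ≤ C*(3^n/(a+ρ)^n) := by gcongr
      _ =11*3^n*C*(1/11/(a+ρ)^n) := by ring
      _ ≤ _ := by gcongr
end supp
section supp2
variable {X : Type*} [MetricSpace X] [MeasurableSpace X] [OpensMeasurableSpace X]
  [SecondCountableTopology X] {σ : Measure X} [IsFiniteMeasure σ] {K : X → X → ℂ} {n C α : ℝ}
  {Φ : X → ℝ}
theorem grow {H : Set X} {Λ : ℝ} (hg : ∀ x ∉ H, ∀ R,0 < R → σ.real (ball x R) ≤ Λ*R^n)
    {x x0 : X} (h0 : x0 ∉ H) {R0 R : ℝ} (h : dist x x0 ≤2*R0) (hR : R0 ≤ R) (hp :0 < R0) :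
    σ.real (ball x R) ≤ Λ*3^n*R^n := by
  have : ball x R ⊆ ball x0 (3*R) := ball_subset_ball' (by linarith)
  refine (measureReal_mono this).trans ((hg x0 h0 (3*R) (by linarith)).trans (le_of_eq ?_))
  rw [Real.mul_rpow (by norm_num) (by linarith)]; ring
def kA' (n C α D θ Λ : ℝ) : ℝ := kA n C α D θ+Λ*3^n*sS n (α/2)
theorem sS_nn (n : ℝ) {β : ℝ} (h :0 < β) :0 ≤ sS n β := by
  have : (1/2 : ℝ)^β <1 := Real.rpow_lt_one (by norm_num) (by norm_num) h
  have :0 <1-(1/2 : ℝ)^β := by linarith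
  unfold sS; positivity
theorem frac_bm (x : X) {R β n : ℝ} (R0 :0 < R) (b0 :0 ≤ β) (n0 :0 ≤ n) :
    BM (fun y => (R/(R+dist x y))^β/(R+dist x y)^n) := by
  have m : Measurable fun y => dist x y := measurable_const.dist measurable_id
  refine ⟨((measurable_const.div (measurable_const.add m)).pow_const _).div ((measurable_const.add m).pow_const _),1/R^n, fun y => ?_⟩
  have r0 := dist_nonneg (x := x) (y := y)
  rw [Real.norm_of_nonneg (by positivity)]
  have : (R/(R+dist x y))^β ≤1 :=
    Real.rpow_le_one (by positivity) (by rw [div_le_one (by positivity)]; linarith) b0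
  gcongr; linarith
set_option maxHeartbeats 1000000 in
open Classical in
theorem mkKH (CKH : CK K n C α) {H : Set X} {Λ W0 δ D θ : ℝ} {ℓ : ℕ → ℝ} {b : X → ℂ} (Λ0 :0 ≤ Λ)
    (hg : ∀ x ∉ H, ∀ R,0 < R → σ.real (ball x R) ≤ Λ*R^n)
    (hW : ∀ x ∉ H, ∀ ε,0 < ε → ‖∫ y, (if ε < dist x y then K x y else 0)*b y ∂σ‖ ≤ W0)
    (bm : Measurable b) (b1 : ∀ x, ‖b x‖ ≤1) (d0 :0 < δ) (hδ : ∀ x, δ ≤ Φ x)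
    (hL : ∀ x y, Φ x ≤ Φ y+dist x y) (hne : Hᶜ.Nonempty) (hΦ : ∀ x, infDist x Hᶜ ≤ Φ x)
    (hl : ∀ j, ℓ j =2*ℓ (j+1)) (l0 : ∀ j,0 < ℓ j) (hD :1 ≤ D) (th :0 < θ) :
    KH σ (sK K Φ) Φ (sP Φ ℓ n (α/2)) ℓ b (((1:ℝ)/2)^(α/4)) (kA' n C α D θ Λ) (kW n C α Λ W0) D θ := by
  have a0 := CKH.a0; have C0 := CKH.C0; have n0 := CKH.n0; have a1 := CKH.a1
  have hp : ∀ x,0 ≤ Φ x := fun x => d0.le.trans (hδ x)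
  have mΦ : Measurable Φ := by
    have : LipschitzWith 1 Φ := LipschitzWith.of_le_add hL
    exact this.continuous.measurable
  have near : ∀ x, ∃ x0, x0 ∉ H ∧ dist x x0 ≤2*Φ x := fun x => by
    have : infDist x Hᶜ <2*Φ x := by have := hΦ x; have := hδ x; linarith
    obtain ⟨x0, h1, h2⟩ := (infDist_lt_iff hne).1 this
    exact ⟨x0, h1, h2.le⟩
  have S2 := sS_nn n (show 0 < α/2 by positivity)
  have kA0 :0 ≤ kA n C α D θ := by unfold kA; positivity
  have kA1 : kA n C α D θ ≤ kA' n C α D θ Λ := by unfold kA'; nlinarith [show 0 ≤ Λ*3^n*sS n (α/2) by positivity]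
  have Lp : ∀ j x y,0 < ℓ j+dist x y+Φ x+Φ y := fun j x y => by
    have := l0 j; have := hp x; have := hp y; positivity
  have P0 : ∀ j x y,0 ≤ sP Φ ℓ n (α/2) j x y := fun j x y => by
    have := l0 j; have := Lp j x y; unfold sP; positivity
  have bmk := sK_bm mΦ d0 hδ hL CKH
  have pbm : ∀ j, BM (fun z : X × X => sP Φ ℓ n (α/2) j z.1 z.2) := by
    intro j
    have mL : Measurable fun z : X × X => ℓ j+dist z.1 z.2+Φ z.1+Φ z.2 :=
      ((measurable_const.add measurable_dist).add (mΦ.comp measurable_fst)).add (mΦ.comp measurable_snd)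
    refine ⟨((measurable_const.div mL).pow_const _).div (mL.pow_const _),1/ℓ j^n, fun z => ?_⟩
    have := l0 j; have L := Lp j z.1 z.2
    have h1 : ℓ j ≤ ℓ j+dist z.1 z.2+Φ z.1+Φ z.2 := by
      have := hp z.1; have := hp z.2; have := dist_nonneg (x := z.1) (y := z.2); linarith
    rw [Real.norm_of_nonneg (P0 j z.1 z.2)]
    unfold sP
    have : (ℓ j/(ℓ j+dist z.1 z.2+Φ z.1+Φ z.2))^(α/2) ≤1 :=
      Real.rpow_le_one (by positivity) (by rw [div_le_one L]; exact h1) (by positivity)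
    gcongr
  refine ⟨bmk, sK_anti CKH, hp, ?_, ?_, ?_, pbm, P0, ?_, ?_, ?_, hl, l0, kA0.trans kA1, by positivity,
    Real.rpow_lt_one (by norm_num) (by norm_num) (by positivity), hD⟩
  · intro x y h
    by_contra hz
    exact absurd (sK_lt hL CKH hz).2.2 (not_lt.2 h)
  · intro j x x' y m h1 h2 h3
    refine (sK_far hp hL CKH hD (l0 j) h1 h2).trans ?_
    have L := Lp j x y
    have lj := l0 j
    have e : (ℓ j/(ℓ j+dist x y+Φ x+Φ y))^α/(ℓ j+dist x y+Φ x+Φ y)^n =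
        (ℓ j/(ℓ j+dist x y+Φ x+Φ y))^(α/2)*sP Φ ℓ n (α/2) j x y := by
      unfold sP
      rw [mul_div_assoc', ← Real.rpow_add (by positivity)]; ring_nf
    have g : (ℓ j/(ℓ j+dist x y+Φ x+Φ y))^(α/2) ≤ (((1:ℝ)/2)^(α/4))^m := by
      have h4 : (ℓ j/(ℓ j+dist x y+Φ x+Φ y))^2 ≤ (1/2)^m := by
        rw [div_pow, div_pow, one_pow, div_le_div_iff₀ (by positivity) (by positivity), one_mul]
        refine h3.trans (pow_le_pow_left₀ (by have := hp y; positivity) ?_ 2)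
        have := hp x; linarith
      calc _ = ((ℓ j/(ℓ j+dist x y+Φ x+Φ y))^2)^(α/4) := by
            rw [← Real.rpow_natCast, ← Real.rpow_mul (by positivity)]; congr 1; push_cast; ring
        _ ≤ ((1/2)^m)^(α/4) := by gcongr
        _ = _ := by rw [← Real.rpow_natCast, ← Real.rpow_natCast, ← Real.rpow_mul (by norm_num), ← Real.rpow_mul (by norm_num), mul_comm]
    rw [e]
    have hh : C*(1+64*2^n)*8^(α+n)*D ≤ kA' n C α D θ Λ := by
      refine le_trans ?_ kA1
      unfold kA
      have :0 ≤ C*(θ⁻¹+26*D)^(2*α+n) := by positivity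
      linarith
    have P0' := P0 j x y
    have kA2 := kA0.trans kA1
    calc _ ≤ kA' n C α D θ Λ*((((1:ℝ)/2)^(α/4))^m*sP Φ ℓ n (α/2) j x y) := by gcongr
      _ = _ := by ring
  · intro j x y h1 h2
    have P0' := P0 j x y
    have kA2 := kA0.trans kA1
    by_cases hz : sK K Φ x y =0
    · rw [hz, norm_zero]; positivity
    obtain ⟨h3, h4, h5⟩ := sK_lt hL CKH hz
    refine (sK_le hp CKH x y).trans (le_trans ?_ (mul_le_mul_of_nonneg_right kA1 P0'))
    have L := Lp j x y; have lj := l0 j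
    set c := θ⁻¹+26*D with hc
    have c1 :1 ≤ c := by
      have :0 < θ⁻¹ := by positivity
      linarith
    have L1 : ℓ j+dist x y+Φ x+Φ y ≤ c*dist x y := by
      have : ℓ j ≤ θ⁻¹*dist x y := by rw [inv_mul_eq_div, le_div_iff₀ th]; linarith
      nlinarith
    have L2 : ℓ j+dist x y+Φ x+Φ y ≤ c*ℓ j := by
      have :0 < θ⁻¹ := by positivity
      nlinarith
    have f1 :1/dist x y^n ≤ c^n/(ℓ j+dist x y+Φ x+Φ y)^n := by
      rw [div_le_div_iff₀ (by positivity) (by positivity), one_mul, ← Real.mul_rpow (by positivity) h3.le]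
      gcongr
    have f2 :1 ≤ c^(α/2)*(ℓ j/(ℓ j+dist x y+Φ x+Φ y))^(α/2) := by
      rw [← Real.mul_rpow (by positivity) (by positivity), mul_div_assoc']
      exact Real.one_le_rpow ((one_le_div L).2 L2) (by positivity)
    have f3 : c^n*c^(α/2) ≤ c^(2*α+n) := by
      rw [← Real.rpow_add (by positivity)]
      exact Real.rpow_le_rpow_of_exponent_le c1 (by linarith)
    calc C/dist x y^n = C*(1/dist x y^n)*1 := by ring
      _ ≤ C*(c^n/(ℓ j+dist x y+Φ x+Φ y)^n)*(c^(α/2)*(ℓ j/(ℓ j+dist x y+Φ x+Φ y))^(α/2)) := by gcongr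
      _ = C*(c^n*c^(α/2))*sP Φ ℓ n (α/2) j x y := by unfold sP; ring
      _ ≤ C*c^(2*α+n)*sP Φ ℓ n (α/2) j x y := by gcongr
      _ ≤ _ := by
        refine mul_le_mul_of_nonneg_right ?_ P0'
        unfold kA
        have :0 ≤ C*(1+64*2^n)*8^(α+n)*D := by positivity
        linarith
  · intro j x y
    unfold sP; rw [dist_comm, add_right_comm]
  · intro j x
    obtain ⟨x0, h1, h2⟩ := near x
    have lj := l0 j; have px := hp x
    have R0 :0 < ℓ j+Φ x := by positivity
    have sh := shell (σ := σ) (x := x) (β := α/2) R0 (show 0 ≤ Λ*3^n by positivity) (by positivity) n0.le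
      (fun R hR => grow hg h1 (by linarith) hR R0)
    have : kA' n C α D θ Λ ≥ Λ*3^n*sS n (α/2) := by unfold kA'; linarith
    refine le_trans ?_ (sh.trans this)
    refine integral_mono_of_nonneg (Filter.Eventually.of_forall (P0 j x)) ?_ (Filter.Eventually.of_forall fun y => ?_)
    · exact (frac_bm x R0 (by positivity) n0.le).int
    · have r0 := dist_nonneg (x := x) (y := y)
      have py := hp y
      have e : ℓ j+Φ x+dist x y ≤ ℓ j+dist x y+Φ x+Φ y := by linarith
      have e' : ℓ j ≤ ℓ j+Φ x := by linarith
      show (ℓ j/(ℓ j+dist x y+Φ x+Φ y))^(α/2)/(ℓ j+dist x y+Φ x+Φ y)^n ≤ ((ℓ j+Φ x)/(ℓ j+Φ x+dist x y))^(α/2)/(ℓ j+Φ x+dist x y)^n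
      gcongr
  · intro x
    obtain ⟨x0, h1, h2⟩ := near x
    have R0 :0 < Φ x := d0.trans_le (hδ x)
    have sh := shell (σ := σ) (x := x) (β := α) R0 (show 0 ≤ Λ*3^n by positivity) a0 n0.le
      (fun R hR => grow hg h1 h2 hR R0)
    have bb : BM b := ⟨bm,1, b1⟩
    have k1 : BM (fun y => sK K Φ x y) := ⟨bmk.m.comp measurable_prodMk_left, bmk.b.imp fun c h y => h (x, y)⟩
    have k2 : BM (fun y => if 8*Φ x < dist x0 y then K x0 y else 0) := by
      have mx : Measurable fun y => K x0 y := CKH.m.comp measurable_prodMk_left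
      have m : Measurable fun y => dist x0 y := measurable_const.dist measurable_id
      refine ⟨Measurable.ite (measurableSet_lt measurable_const m) mx measurable_const, C/(8*Φ x)^n, fun y => ?_⟩
      split_ifs with h
      · refine (CKH.size x0 y).trans ?_
        gcongr
      · rw [norm_zero]; positivity
    have e : ∫ y, sK K Φ x y*b y ∂σ = ∫ y, (sK K Φ x y-if 8*Φ x < dist x0 y then K x0 y else 0)*b y ∂σ +
        ∫ y, (if 8*Φ x < dist x0 y then K x0 y else 0)*b y ∂σ := by
      rw [← integral_add ((k1.sub k2).mul bb).int (k2.mul bb).int]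
      congr 1; funext y; ring
    rw [e, kW, add_comm W0]
    refine (norm_add_le _ _).trans (add_le_add ?_ (hW x0 h1 _ (by positivity)))
    have g0 : ∀ y,0 ≤ (Φ x/(Φ x+dist x y))^α/(Φ x+dist x y)^n := fun y => by positivity
    refine (norm_integral_le_integral_norm _).trans (le_trans ?_ (mul_le_mul_of_nonneg_left sh (by positivity)))
    rw [← integral_const_mul]
    refine integral_mono ((k1.sub k2).mul bb).norm.int ?_ fun y => ?_
    · exact (frac_bm x R0 a0.le n0.le).int.const_mul _
    · dsimp only
      rw [norm_mul]
      exact (mul_le_of_le_one_right (norm_nonneg _) (b1 y)).trans (sK_tb hp hL CKH y R0 h2)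
end supp2
section latt
open Classical in
theorem count (P Z : ℕ) (hP :0 < P) (A u : ℝ) (hu :0 ≤ u) :
    (((Finset.univ : Finset (Fin (P*Z))).filter fun t : Fin (P*Z) => ∃ p : ℤ, |A-(t : ℕ)-p*P| ≤ u).card : ℝ) ≤ Z*(2*u+1) := by
  set S := (Finset.univ : Finset (Fin (P*Z))).filter fun t : Fin (P*Z) => ∃ p : ℤ, |A-(t : ℕ)-p*P| ≤ u with hS
  have hs : ∀ t : Fin (P*Z), ∃ p : ℤ, t ∈ S → |A-(t : ℕ)-p*P| ≤ u := fun t => by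
    by_cases h : t ∈ S
    · obtain ⟨p, hp⟩ := (Finset.mem_filter.1 h).2; exact ⟨p, fun _ => hp⟩
    · exact ⟨0, fun h' => absurd h' h⟩
  choose p hp using hs
  have : S.card ≤ (Finset.range Z ×ˢ Finset.Icc ⌈A-u⌉ ⌊A+u⌋).card := by
    refine Finset.card_le_card_of_injOn (fun t => ((t : ℕ)/P, ((t : ℕ) : ℤ)+p t*P)) ?_ ?_
    · intro t ht
      have h := abs_le.1 (hp t ht)
      simp only [Finset.coe_product, mem_prod, Finset.mem_coe, Finset.mem_range, Finset.mem_Icc]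
      refine ⟨Nat.div_lt_of_lt_mul t.2, Int.ceil_le.2 ?_, Int.le_floor.2 ?_⟩ <;> push_cast <;> linarith [h.1, h.2]
    · intro t ht t' ht' h
      simp only [Prod.mk.injEq] at h
      obtain ⟨h1, h2⟩ := h
      have h3 : ((t : ℕ) : ℤ) % P = ((t' : ℕ) : ℤ) % P := by
        have := congrArg (fun z : ℤ => z % P) h2
        simpa [Int.add_mul_emod_self_right] using this
      have h4 : (t : ℕ) % P = (t' : ℕ) % P := by exact_mod_cast h3
      apply Fin.ext
      rw [← Nat.div_add_mod (t : ℕ) P, ← Nat.div_add_mod (t' : ℕ) P, h1, h4]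
  refine (Nat.cast_le.2 this).trans ?_
  rw [Finset.card_product, Finset.card_range, Int.card_Icc]
  push_cast
  refine mul_le_mul_of_nonneg_left ?_ (by positivity)
  have h1 : ((⌊A+u⌋ +1 - ⌈A-u⌉).toNat : ℝ) = ((max (⌊A+u⌋ +1 - ⌈A-u⌉) 0 : ℤ) : ℝ) := by
    rw [← Int.toNat_eq_max, Int.cast_natCast]
  rw [h1]; push_cast
  refine max_le ?_ (by linarith)
  have := Int.floor_le (A+u); have := Int.le_ceil (A-u); linarith
structure CO {X : Type*} [MetricSpace X] {d : ℕ} (e : X → Fin d → ℝ) (ℓ : ℕ → ℝ) : Prop where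
  le1 : ∀ x y i, |e x i-e y i| ≤ dist x y
  le2 : ∀ x y s, (∀ i, |e x i-e y i| ≤ s) → dist x y ≤ d*s
  bd : ∀ x y i, |e x i-e y i| ≤ ℓ 0
  d1 :1 ≤ d
  hl : ∀ j, ℓ j =2*ℓ (j+1)
  l0 : ∀ j,0 < ℓ j
variable {X : Type*} [MetricSpace X] [MeasurableSpace X] [OpensMeasurableSpace X]
  {d : ℕ} {e : X → Fin d → ℝ} {ℓ : ℕ → ℝ}
def lp {X : Type*} {d : ℕ} (e : X → Fin d → ℝ) (ℓ : ℕ → ℝ) (s : ℝ) (k : ℕ) (x : X) : Fin d → ℤ :=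
  if k =0 then 0 else fun i => ⌊(e x i-s)/ℓ k⌋
def ix {X : Type*} {d : ℕ} (e : X → Fin d → ℝ) (ℓ : ℕ → ℝ) (θ : ℝ) (k : ℕ) (x : X) : Fin d → ℤ :=
  fun i => ⌊e x i/(θ*ℓ k)⌋
def bdy {X : Type*} {d : ℕ} (e : X → Fin d → ℝ) (ℓ : ℕ → ℝ) (w : ℝ) (m : ℕ) (s : ℝ) (x : X) : Prop :=
  ∃ i, ∃ p : ℤ, |e x i-w-p*ℓ m| ≤ s
theorem CO.em (h : CO e ℓ) (i : Fin d) : Continuous fun x => e x i := by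
  have : LipschitzWith 1 fun x => e x i := LipschitzWith.of_dist_le_mul fun x y => by
    simpa [Real.dist_eq] using h.le1 x y i
  exact this.continuous
theorem CO.lpm (h : CO e ℓ) (s : ℝ) (k : ℕ) : Measurable (lp e ℓ s k) := by
  unfold lp
  split_ifs
  · exact measurable_const
  · exact measurable_pi_lambda _ fun i => Int.measurable_floor.comp (((h.em i).measurable.sub_const _).div_const _)
theorem floor_half (a : ℝ) : ⌊a/2⌋ = ⌊a⌋ /2 := by
  have := Int.floor_div_natCast a 2
  simpa using this
theorem CO.nest (h : CO e ℓ) (s : ℝ) (k : ℕ) : KM (lp e ℓ s (k+1)) (lp e ℓ s k) := by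
  intro x y hxy
  unfold lp at *
  split_ifs with hk
  · rfl
  · simp only [Nat.succ_ne_zero, if_false, Nat.add_eq_zero_iff, one_ne_zero, and_false] at hxy
    funext i
    have h1 := congrFun hxy i
    have e1 : ∀ u : ℝ, u/ℓ k = u/ℓ (k+1)/2 := fun u => by rw [h.hl k]; field_simp
    simp only [e1, floor_half]
    rw [h1]
theorem fl_lt {a b : ℝ} (m : ℕ) (h : |⌊a⌋ - ⌊b⌋| ≤ (m : ℤ)) : |a-b| ≤ m+1 := by
  have h' := abs_le.1 h
  have h1 : ((⌊a⌋ - ⌊b⌋ : ℤ) : ℝ) ≤ m := by exact_mod_cast h'.2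
  have h2 : (-m : ℝ) ≤ ((⌊a⌋ - ⌊b⌋ : ℤ) : ℝ) := by exact_mod_cast h'.1
  push_cast at h1 h2
  have := Int.floor_le a; have := Int.floor_le b; have := Int.lt_floor_add_one a; have := Int.lt_floor_add_one b
  exact abs_le.2 ⟨by linarith, by linarith⟩
theorem CO.dm (h : CO e ℓ) (s : ℝ) (k : ℕ) (x y : X) (hxy : lp e ℓ s k x = lp e ℓ s k y) :
    dist x y ≤ d*ℓ k := by
  unfold lp at hxy
  split_ifs at hxy with hk
  · subst hk; exact h.le2 x y _ (h.bd x y)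
  · refine h.le2 x y _ fun i => ?_
    have h1 := fl_lt 0 (a := (e x i-s)/ℓ k) (b := (e y i-s)/ℓ k) (by rw [congrFun hxy i]; simp)
    have l0 := h.l0 k
    rw [← sub_div, abs_div, abs_of_pos l0, div_le_iff₀ l0] at h1
    simpa using h1
theorem CO.bh (h : CO e ℓ) {θ : ℝ} (t0 :0 < θ) (th :8*d*θ ≤1) : BH ℓ θ (ix e ℓ θ) where
  m j := measurable_pi_lambda _ fun i => Int.measurable_floor.comp ((h.em i).measurable.div_const _)
  near j x y m hd i := by
    have l0 := h.l0 j
    have p :0 < θ*ℓ j := by positivity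
    have h1 : |e x i/(θ*ℓ j)-e y i/(θ*ℓ j)| ≤ m := by
      rw [← sub_div, abs_div, abs_of_pos p, div_le_iff₀ p]; exact (h.le1 x y i).trans hd
    have h2 := abs_le.1 h1
    unfold ix
    rw [abs_le]; constructor
    · have : ⌊e y i/(θ*ℓ j)⌋ ≤ ⌊e x i/(θ*ℓ j)+(m:ℤ)⌋ := Int.floor_mono (by push_cast; linarith)
      rw [Int.floor_add_intCast] at this; linarith
    · have : ⌊e x i/(θ*ℓ j)⌋ ≤ ⌊e y i/(θ*ℓ j)+(m:ℤ)⌋ := Int.floor_mono (by push_cast; linarith)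
      rw [Int.floor_add_intCast] at this; linarith
  back j x y m hn := by
    have l0 := h.l0 j
    have p :0 < θ*ℓ j := by positivity
    rw [mul_assoc]
    refine h.le2 x y _ fun i => ?_
    have h1 := fl_lt m (hn i)
    rwa [← sub_div, abs_div, abs_of_pos p, div_le_iff₀ p] at h1
  th0 := t0
  th := th
theorem CO.bdy (h : CO e ℓ) {w s : ℝ} {m : ℕ} {x z : X} (hs : dist z x ≤ s) (hne : lp e ℓ w m z ≠ lp e ℓ w m x) :
    bdy e ℓ w m s x := by
  unfold lp at hne
  split_ifs at hne with hm
  · exact absurd rfl hne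
  · obtain ⟨i, hi⟩ := Function.ne_iff.1 hne
    have l0 := h.l0 m
    have h1 := (h.le1 z x i).trans hs
    have h2 := abs_le.1 h1
    have key : ∀ a b : ℝ, ⌊a/ℓ m⌋ < ⌊b/ℓ m⌋ → a ≤ ⌊b/ℓ m⌋ * ℓ m ∧ ⌊b/ℓ m⌋ * ℓ m ≤ b := fun a b hab => by
      constructor
      · have := Int.floor_lt.1 hab; rw [div_lt_iff₀ l0] at this; exact this.le
      · have := Int.floor_le (b/ℓ m); rwa [le_div_iff₀ l0] at this
    rcases lt_or_gt_of_ne hi with h3 | h3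
    · obtain ⟨h4, h5⟩ := key _ _ h3
      exact ⟨i, _, abs_le.2 ⟨by linarith, by linarith⟩⟩
    · obtain ⟨h4, h5⟩ := key _ _ h3
      exact ⟨i, _, abs_le.2 ⟨by linarith, by linarith⟩⟩
theorem CO.bdy_meas (h : CO e ℓ) (w : ℝ) (m : ℕ) (s : ℝ) : MeasurableSet {x | BP.bdy e ℓ w m s x} := by
  have : {x | BP.bdy e ℓ w m s x} = ⋃ i, ⋃ p : ℤ, {x | |e x i-w-p*ℓ m| ≤ s} := by
    ext x; simp [BP.bdy]
  rw [this]
  refine MeasurableSet.iUnion fun i => MeasurableSet.iUnion fun p => ?_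
  exact measurableSet_le (((h.em i).sub continuous_const).sub continuous_const).abs.measurable measurable_const
open Classical in
theorem CO.frac (h : CO e ℓ) {N Z m : ℕ} (Z0 :0 < Z) (m1 :1 ≤ m) (mN : m ≤ N) {s hh : ℝ}
    (eh : hh = ℓ 1/((2^N*Z : ℕ) : ℝ)) (hs : hh ≤ s) (x : X) :
    ∑ t : Fin (2^N*Z), (if BP.bdy e ℓ ((t : ℕ)*hh) m s x then (1:ℝ) else 0) ≤3*d*(s/ℓ m)*((2^N*Z : ℕ) : ℝ) := by
  have l1 := h.l0 1
  have l2 := h.l0 m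
  have MM : (0:ℝ) < ((2^N*Z : ℕ) : ℝ) := by positivity
  have h0 :0 < hh := by rw [eh]; positivity
  obtain ⟨k, rfl⟩ : ∃ k, N = m-1+k := ⟨N-(m-1), by omega⟩
  set P : ℕ :=2^k*Z with hP
  have P0 :0 < P := by positivity
  have eM :2^(m-1+k)*Z = P*2^(m-1) := by rw [hP, pow_add]; ring
  have lm : ℓ m = hh*P := by
    have h1 := lpow h.hl 1 (m-1)
    rw [show 1+(m-1) = m by omega] at h1
    rw [eh, eM, h1]; push_cast; field_simp
  have one : ∀ i : Fin d, ∑ t : Fin (2^(m-1+k)*Z), (if ∃ p : ℤ, |e x i-(t : ℕ)*hh-p*ℓ m| ≤ s then (1:ℝ) else 0)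
      ≤3*(s/ℓ m)*((2^(m-1+k)*Z : ℕ) : ℝ) := by
    intro i
    have c := count P (2^(m-1)) P0 (e x i/hh) (s/hh) (div_nonneg (h0.le.trans hs) h0.le)
    rw [← eM] at c
    rw [Finset.sum_boole]
    have e1 : ∀ t : Fin (2^(m-1+k)*Z), (∃ p : ℤ, |e x i-(t : ℕ)*hh-p*ℓ m| ≤ s) ↔
        ∃ p : ℤ, |e x i/hh-(t : ℕ)-p*P| ≤ s/hh := fun t => by
      refine exists_congr fun p => ?_
      rw [le_div_iff₀ h0, ← abs_of_pos h0, ← abs_mul, abs_of_pos h0, lm]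
      have : (e x i/hh-(t : ℕ)-p*P)*hh = e x i-(t : ℕ)*hh-p*(hh*P) := by field_simp
      rw [this]
    simp only [e1]
    refine c.trans ?_
    have : s/hh ≥1 := by rw [ge_iff_le, le_div_iff₀ h0]; linarith
    have e2 :3*(s/ℓ m)*((2^(m-1+k)*Z : ℕ) : ℝ) = ((2^(m-1) : ℕ) : ℝ)*(3*(s/hh)) := by
      rw [eM, lm]; push_cast; field_simp
    rw [e2]
    refine mul_le_mul_of_nonneg_left ?_ (by positivity)
    linarith
  calc _ ≤ ∑ t : Fin (2^(m-1+k)*Z), ∑ i : Fin d, (if ∃ p : ℤ, |e x i-(t : ℕ)*hh-p*ℓ m| ≤ s then (1:ℝ) else 0) := by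
        refine Finset.sum_le_sum fun t _ => ?_
        have nn : ∀ i ∈ Finset.univ, (0:ℝ) ≤ (if ∃ p : ℤ, |e x i-(t : ℕ)*hh-p*ℓ m| ≤ s then (1:ℝ) else 0) := fun i _ => by split_ifs <;> norm_num
        split_ifs with hb
        · obtain ⟨i, hi⟩ := hb
          have := Finset.single_le_sum nn (Finset.mem_univ i)
          rwa [if_pos hi] at this
        · exact Finset.sum_nonneg nn
    _ = ∑ i : Fin d, ∑ t : Fin (2^(m-1+k)*Z), (if ∃ p : ℤ, |e x i-(t : ℕ)*hh-p*ℓ m| ≤ s then (1:ℝ) else 0) := Finset.sum_comm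
    _ ≤ ∑ i : Fin d,3*(s/ℓ m)*((2^(m-1+k)*Z : ℕ) : ℝ) := Finset.sum_le_sum fun i _ => one i
    _ = _ := by rw [Finset.sum_const, Finset.card_univ, Fintype.card_fin, nsmul_eq_mul]; ring
open Classical in
def gs {X : Type*} [MetricSpace X] {d : ℕ} (e : X → Fin d → ℝ) (ℓ : ℕ → ℝ) (r : ℕ) (w w' : ℝ) (k : ℕ) (x : X) : ℂ :=
  if ∃ x', lp e ℓ w k x' = lp e ℓ w k x ∧ ∃ m,1 ≤ m ∧ m+r ≤ k ∧ ∃ z, lp e ℓ w' m z ≠ lp e ℓ w' m x' ∧ dist z x'^2 < ℓ k*ℓ m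
  then 0 else 1
open Classical in
theorem CO.gs_frac (h : CO e ℓ) {N Z k r : ℕ} (Z0 :0 < Z) (kN : k < N) {hh w : ℝ}
    (eh : hh = ℓ 1/((2^N*Z : ℕ) : ℝ)) (x : X) :
    ∑ t : Fin (2^N*Z), ‖1-gs e ℓ r w ((t : ℕ)*hh) k x‖^2 ≤12*d*(d+1)*(3/4)^r*((2^N*Z : ℕ) : ℝ) := by
  set M : ℝ := ((2^N*Z : ℕ) : ℝ) with hM
  have M0 :0 < M := by positivity
  set S : ℕ → ℝ := fun m => (d+1)*(ℓ m*(3/4)^(k-m)) with hS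
  have lk : ∀ m, m ≤ k → ℓ k ≤ ℓ m*(3/4)^(k-m) ∧ ℓ k*ℓ m ≤ (ℓ m*(3/4)^(k-m))^2 := by
    intro m hm
    have h1 := lpow h.hl m (k-m)
    rw [Nat.add_sub_cancel' hm] at h1
    have lk0 := h.l0 k
    have a1 : (1:ℝ) ≤2^(k-m)*(3/4)^(k-m) := by rw [← mul_pow]; exact one_le_pow₀ (by norm_num)
    have a2 : (1:ℝ) ≤2^(k-m)*((3/4)^(k-m))^2 := by rw [← pow_mul, mul_comm (k-m) 2, pow_mul, ← mul_pow]; exact one_le_pow₀ (by norm_num)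
    rw [h1]
    constructor
    · calc ℓ k = ℓ k*1 := by ring
        _ ≤ ℓ k*(2^(k-m)*(3/4)^(k-m)) := by gcongr
        _ = _ := by ring
    · calc ℓ k*(2^(k-m)*ℓ k) = ℓ k^2*2^(k-m)*1 := by ring
        _ ≤ ℓ k^2*2^(k-m)*(2^(k-m)*((3/4)^(k-m))^2) := by gcongr
        _ = _ := by ring
  have hk : hh ≤ ℓ k := by
    have h1 : ℓ N ≤ ℓ k := lanti h.hl h.l0 kN.le
    have h2 := lpow h.hl 1 N
    have h3 : ℓ (1+N) ≤ ℓ N := lanti h.hl h.l0 (by omega)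
    have : hh ≤ ℓ (1+N) := by
      rw [eh, h2, div_le_iff₀ M0, hM]; push_cast
      have : (1:ℝ) ≤ Z := by exact_mod_cast Z0
      have := h.l0 (1+N)
      calc (2:ℝ)^N*ℓ (1+N) = ℓ (1+N)*(2^N*1) := by ring
        _ ≤ _ := by gcongr
    linarith
  have pt : ∀ t : Fin (2^N*Z), ‖1-gs e ℓ r w ((t : ℕ)*hh) k x‖^2 ≤
      ∑ m ∈ Finset.Icc 1 (k-r), if BP.bdy e ℓ ((t : ℕ)*hh) m (S m) x then (1:ℝ) else 0 := by
    intro t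
    have nn : ∀ m ∈ Finset.Icc 1 (k-r), (0:ℝ) ≤ if BP.bdy e ℓ ((t : ℕ)*hh) m (S m) x then (1:ℝ) else 0 := fun i _ => by split_ifs <;> norm_num
    unfold gs
    split_ifs with hb
    · obtain ⟨x', h1, m, m1, m2, z, h2, h3⟩ := hb
      have hm := lk m (by omega)
      have lm := h.l0 m
      have d1 : dist z x' ≤ ℓ m*(3/4)^(k-m) := le_of_lt (lt_of_pow_lt_pow_left₀ 2 (by positivity) (h3.trans_le hm.2))
      obtain ⟨i, p, hp⟩ := h.bdy d1 h2
      have d2 := (h.le1 x x' i).trans (h.dm w k x x' h1.symm)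
      have : BP.bdy e ℓ ((t : ℕ)*hh) m (S m) x := by
        refine ⟨i, p, ?_⟩
        have e1 : e x i-(t : ℕ)*hh-p*ℓ m = (e x i-e x' i)+(e x' i-(t : ℕ)*hh-p*ℓ m) := by ring
        rw [e1]
        refine (abs_add_le _ _).trans ((add_le_add d2 hp).trans ?_)
        have := mul_le_mul_of_nonneg_left hm.1 (show (0:ℝ) ≤ d by positivity)
        simp only [hS]; linarith
      have h5 := Finset.single_le_sum nn (Finset.mem_Icc.2 ⟨m1, show m ≤ k-r by omega⟩)
      rw [if_pos this] at h5
      simpa using h5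
    · simpa using Finset.sum_nonneg nn
  refine (Finset.sum_le_sum fun t _ => pt t).trans ?_
  rw [Finset.sum_comm]
  have fm : ∀ m ∈ Finset.Icc 1 (k-r), ∑ t : Fin (2^N*Z), (if BP.bdy e ℓ ((t : ℕ)*hh) m (S m) x then (1:ℝ) else 0) ≤
      3*d*(d+1)*M*(3/4)^(k-m) := by
    intro m hm
    rw [Finset.mem_Icc] at hm
    have lm := h.l0 m
    have l1 := (lk m (by omega)).1
    refine (h.frac Z0 hm.1 (by omega) eh (hk.trans (l1.trans ?_)) x).trans (le_of_eq ?_)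
    · simp only [hS]
      have :0 ≤ ℓ m*(3/4)^(k-m) := by positivity
      nlinarith [show (0:ℝ) ≤ d by positivity]
    · simp only [hS]; rw [← hM]; field_simp
  refine (Finset.sum_le_sum fm).trans ?_
  rw [← Finset.mul_sum]
  have geo : ∑ m ∈ Finset.Icc 1 (k-r), ((3:ℝ)/4)^(k-m) ≤4*(3/4)^r := by
    have : ∀ j : ℕ, ∑ m ∈ Finset.Icc 1 j, ((3:ℝ)/4)^(j+r-m) ≤4*(3/4)^r := by
      intro j
      induction j with
      | zero => simp; positivity
      | succ j ih =>
        rw [Finset.sum_Icc_succ_top (by omega), show j+1+r-(j+1) = r by omega]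
        have : ∑ m ∈ Finset.Icc 1 j, ((3:ℝ)/4)^(j+1+r-m) =3/4 * ∑ m ∈ Finset.Icc 1 j, ((3:ℝ)/4)^(j+r-m) := by
          rw [Finset.mul_sum]
          refine Finset.sum_congr rfl fun m hm => ?_
          rw [Finset.mem_Icc] at hm
          rw [show j+1+r-m = (j+r-m)+1 by omega, pow_succ]; ring
        rw [this]; linarith
    rcases le_or_gt r k with hr | hr
    · have := this (k-r); rwa [Nat.sub_add_cancel hr] at this
    · rw [show k-r =0 by omega]; simp; positivity
  calc _ ≤3*d*(d+1)*M*(4*(3/4)^r) := by gcongr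
    _ = _ := by ring
end latt
theorem consts (τ : ℝ) {η : ℝ} (η0 :0 < η) (d : ℕ) (hd :1 ≤ d) : ∃ (r : ℕ) (θ t : ℝ),0 < θ ∧ 0 < t ∧ 225*(d:ℝ)^2 <2^r ∧
    8*d*θ ≤1 ∧ (t*c2 τ d r+t⁻¹*c3 τ d r*(cC τ*((r+2)*(6*d^2*(4*d+3)*θ) +
      12*d*(d+1)*(3/4)^r)))*η⁻¹ ≤1/2 := by
  have hC := cC_pos τ
  have hE := cE_nn τ
  set a : ℝ :=2*3^d*cC τ+cE τ+1 with ha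
  set a' : ℝ :=2*3^d+cC τ with ha'
  have a0 :0 < a := by positivity
  have a0' :0 < a' := by positivity
  have l1 : Filter.Tendsto (fun r : ℕ => (8*a/η*a'*(cC τ*(12*d*(d+1)))*(4/3))*(((r+1 : ℕ) : ℝ)^3*(3/4 : ℝ)^(r+1))) Filter.atTop (nhds 0) := by
    have := (tendsto_pow_const_mul_const_pow_of_lt_one 3 (show (0:ℝ) ≤3/4 by norm_num) (by norm_num)).comp (Filter.tendsto_add_atTop_nat 1)
    simpa using this.const_mul (8*a/η*a'*(cC τ*(12*d*(d+1)))*(4/3))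
  have l2 : Filter.Tendsto (fun r : ℕ => (2:ℝ)^r) Filter.atTop Filter.atTop := tendsto_pow_atTop_atTop_of_one_lt (by norm_num)
  obtain ⟨r, h1, h2⟩ := ((l1.eventually_le_const (show 0 < η/8 by positivity)).and (l2.eventually_gt_atTop (225*(d:ℝ)^2))).exists
  have p2 := c2_pos τ d r
  have p3 := c3_pos τ d r
  set M : ℝ :=8*c2 τ d r/η*c3 τ d r*(cC τ*((r+2)*(6*d^2*(4*d+3)))) with hM
  have M0 :0 < M := by positivity
  refine ⟨r, min (1/(8*(d:ℝ))) (η/8/M), η/(8*c2 τ d r), by positivity, by positivity, h2, ?_, ?_⟩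
  · calc 8*d*min (1/(8*(d:ℝ))) (η/8/M) ≤8*d*(1/(8*(d:ℝ))) := by gcongr; exact min_le_left _ _
      _ =1 := by field_simp
  · set θ := min (1/(8*(d:ℝ))) (η/8/M)
    have e1 : M*θ ≤ η/8 := by
      calc M*θ ≤ M*(η/8/M) := by gcongr; exact min_le_right _ _
        _ = _ := by field_simp
    have e2 :8*c2 τ d r/η*c3 τ d r*(cC τ*(12*d*(d+1)*(3/4)^r)) ≤ η/8 := by
      refine le_trans ?_ h1
      have q2 : c2 τ d r ≤ a*(r+1)^2 := by
        unfold c2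
        have : (1:ℝ) ≤ ((r:ℝ)+1)^2 := one_le_pow₀ (by linarith [Nat.cast_nonneg (α := ℝ) r])
        have : cE τ+1 ≤ (cE τ+1)*((r:ℝ)+1)^2 := le_mul_of_one_le_right (by positivity) this
        rw [ha]; linarith
      have q3 : c3 τ d r ≤ a'*(r+1) := by
        unfold c3
        have := mul_nonneg hC.le (Nat.cast_nonneg (α := ℝ) r)
        rw [ha']; linarith
      calc _ ≤8*(a*(r+1)^2)/η*(a'*(r+1))*(cC τ*(12*d*(d+1)*(3/4)^r)) := by gcongr
        _ = _ := by push_cast; rw [pow_succ (3/4:ℝ) r]; ring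
    have e3 : η/(8*c2 τ d r)*c2 τ d r = η/8 := by field_simp
    have e4 : (η/(8*c2 τ d r))⁻¹ =8*c2 τ d r/η := by rw [inv_div]
    rw [e3, e4, ← div_eq_mul_inv, div_le_iff₀ η0]
    have :8*c2 τ d r/η*c3 τ d r*(cC τ*((r+2)*(6*d^2*(4*d+3)*θ)+12*d*(d+1)*(3/4)^r))
      = M*θ+8*c2 τ d r/η*c3 τ d r*(cC τ*(12*d*(d+1)*(3/4)^r)) := by rw [hM]; ring
    rw [this]; linarith
open Classical in
theorem ordst {Ω : Type*} [Fintype Ω] [Nonempty Ω] {η : ℝ} (η0 :0 < η) (η1 : η ≤1) (a : Ω → ℝ) :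
    ∃ m, η*Fintype.card Ω ≤ ∑ ω, (if a ω ≤ m then (1:ℝ) else 0) ∧
      ∀ v, η*Fintype.card Ω ≤ ∑ ω, (if a ω ≤ v then (1:ℝ) else 0) → m ≤ v := by
  have cp : (0:ℝ) < Fintype.card Ω := by exact_mod_cast Fintype.card_pos
  set S := Finset.univ.filter fun ω' => η*Fintype.card Ω ≤ ∑ ω, (if a ω ≤ a ω' then (1:ℝ) else 0) with hS
  have hne : S.Nonempty := by
    obtain ⟨w, -, hw⟩ := Finset.exists_max_image Finset.univ a Finset.univ_nonempty
    refine ⟨w, Finset.mem_filter.2 ⟨Finset.mem_univ _, ?_⟩⟩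
    rw [Finset.sum_congr rfl fun ω _ => if_pos (hw ω (Finset.mem_univ _))]
    simp only [Finset.sum_const, Finset.card_univ, nsmul_eq_mul, mul_one]
    nlinarith
  obtain ⟨w, hw, hm⟩ := Finset.exists_min_image S a hne
  refine ⟨a w, (Finset.mem_filter.1 hw).2, fun v hv => ?_⟩
  have hn : (Finset.univ.filter fun ω => a ω ≤ v).Nonempty := by
    by_contra h
    rw [Finset.not_nonempty_iff_eq_empty, Finset.filter_eq_empty_iff] at h
    rw [Finset.sum_congr rfl fun ω hω => if_neg (h hω)] at hv
    simp only [Finset.sum_const_zero] at hv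
    nlinarith
  obtain ⟨u, hu, hmu⟩ := Finset.exists_max_image _ a hn
  have hu' := (Finset.mem_filter.1 hu).2
  refine (hm u (Finset.mem_filter.2 ⟨Finset.mem_univ _, hv.trans ?_⟩)).trans hu'
  refine Finset.sum_le_sum fun ω _ => ?_
  by_cases h : a ω ≤ v
  · rw [if_pos h, if_pos (hmu ω (Finset.mem_filter.2 ⟨Finset.mem_univ _, h⟩))]
  · rw [if_neg h]; split_ifs <;> norm_num
section meas
variable {X : Type*} [MeasurableSpace X] {ι : Type*} [Countable ι] [MeasurableSpace ι] [DiscreteMeasurableSpace ι]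
  {σ : Measure X} [IsFiniteMeasure σ] {k : X → X → ℂ}
theorem nb_of_le {P : X → X → ℝ} (hk : BM (fun z : X × X => k z.1 z.2)) (hP : BM (fun z : X × X => P z.1 z.2))
    (h : ∀ x y, ‖k x y‖ ≤ P x y) (Ps : ∀ x y, P x y = P y x) {A : ℝ} (hA : ∀ x, ∫ y, P x y ∂σ ≤ A) : NB σ k A := by
  intro f g hf hg
  have P0 : ∀ x y,0 ≤ P x y := fun x y => (norm_nonneg _).trans (h x y)
  refine le_trans ?_ (schur_one hP P0 Ps hA hf.norm hg.norm)
  refine (norm_integral_le_integral_norm _).trans (integral_mono (fm_bm hk hf hg).norm.int ?_ fun z => ?_)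
  · exact (hP.mul ((hf.norm.snd.add hf.norm.fst).mul hg.norm.fst)).int
  · show ‖k z.1 z.2*(f z.2*g z.1)‖ ≤ _
    rw [norm_mul, norm_mul]
    have := norm_nonneg (f z.1)
    gcongr
    · exact P0 _ _
    · exact h _ _
    · linarith
theorem nb_iter {c N0 : ℝ} (h0 :0 ≤ N0) (hc :0 ≤ c) (h : NB σ k N0)
    (hs : ∀ N,0 ≤ N → NB σ k N → NB σ k (c+N/2)) : NB σ k (2*c) := by
  have : ∀ j : ℕ, NB σ k (2*c+N0*(1/2)^j) := by
    intro j
    induction j with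
    | zero =>
      intro f g hf hg
      refine (h f g hf hg).trans (mul_le_mul_of_nonneg_right (by simp; linarith) (add_nonneg (q_nonneg _) (q_nonneg _)))
    | succ j ih =>
      have := hs _ (by positivity) ih
      convert this using 1; rw [pow_succ]; ring
  intro f g hf hg
  have l : Filter.Tendsto (fun j : ℕ => (2*c+N0*(1/2 : ℝ)^j)*(q σ f+q σ g)) Filter.atTop (nhds ((2*c+N0*0)*(q σ f+q σ g))) :=
    (((_root_.tendsto_pow_atTop_nhds_zero_of_lt_one (by norm_num) (by norm_num)).const_mul N0).const_add _).mul_const _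
  have := ge_of_tendsto' l fun j => this j f g hf hg
  simpa using this
open Classical in
theorem stop_int {π : ℕ → X → ι} (hπ : ∀ k, Measurable (π k)) (hn : ∀ k, KM (π (k+1)) (π k)) {b : X → ℂ} (hb : BM b) {τ : ℝ} (N : ℕ) :
    MeasurableSet {x | ∃ i < N, ‖avg σ (π i) b x‖ < τ} ∧
    ‖∫ x, (if ∃ i < N, ‖avg σ (π i) b x‖ < τ then b x else 0) ∂σ‖ ≤ τ*σ.real {x | ∃ i < N, ‖avg σ (π i) b x‖ < τ} := by
  induction N with
  | zero => simp
  | succ N ih =>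
    obtain ⟨m, ih⟩ := ih
    set S := {x | ∃ i < N, ‖avg σ (π i) b x‖ < τ} with hS
    set D := {x | x ∉ S ∧ ‖avg σ (π N) b x‖ < τ} with hD
    have mD : MeasurableSet D := m.compl.inter (measurableSet_lt (avg_bm (hπ N) hb).norm.m measurable_const)
    have eq : {x | ∃ i < N+1, ‖avg σ (π i) b x‖ < τ} = S ∪ D := by
      ext x
      simp only [mem_setOf_eq, mem_union, hD, hS, Nat.lt_succ_iff_lt_or_eq]
      constructor
      · rintro ⟨i, h | rfl, hi⟩
        · exact Or.inl ⟨i, h, hi⟩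
        · by_cases h : ∃ j < i, ‖avg σ (π j) b x‖ < τ
          · exact Or.inl h
          · exact Or.inr ⟨h, hi⟩
      · rintro (⟨i, h, hi⟩ | ⟨-, h⟩)
        · exact ⟨i, Or.inl h, hi⟩
        · exact ⟨N, Or.inr rfl, h⟩
    have disj : Disjoint S D := disjoint_left.2 fun x h h' => h'.1 h
    refine ⟨eq ▸ m.union mD, ?_⟩
    rw [eq, measureReal_union disj mD, mul_add]
    have bD : BM (fun x => if x ∈ D then (1:ℂ) else 0) := (BM.const (1:ℂ)).ite (BM.const 0) mD
    have bS : BM (fun x => if ∃ i < N, ‖avg σ (π i) b x‖ < τ then b x else 0) := hb.ite (BM.const 0) m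
    have e1 : ∫ x, (if ∃ i < N+1, ‖avg σ (π i) b x‖ < τ then b x else 0) ∂σ
        = ∫ x, (if ∃ i < N, ‖avg σ (π i) b x‖ < τ then b x else 0) ∂σ + ∫ x, (if x ∈ D then (1:ℂ) else 0)*b x ∂σ := by
      rw [← integral_add bS.int (bD.mul hb).int]
      congr 1; funext x
      have h1 : (∃ i < N+1, ‖avg σ (π i) b x‖ < τ) ↔ x ∈ S ∪ D := by rw [← eq]; rfl
      have h2 : (∃ i < N, ‖avg σ (π i) b x‖ < τ) ↔ x ∈ S := Iff.rfl
      simp only [h1, h2, mem_union]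
      by_cases hs : x ∈ S
      · have : x ∉ D := fun h => h.1 hs
        simp [hs, this]
      · simp [hs]
    have kD : KM (π N) (fun x => if x ∈ D then (1:ℂ) else 0) := by
      have : ∀ x y, π N x = π N y → x ∈ D → y ∈ D := by
        intro x y h hx
        refine ⟨?_, ?_⟩
        · rintro ⟨i, hi, h'⟩
          exact hx.1 ⟨i, hi, by rwa [avg_km b x y (km_le hn hi.le x y h)]⟩
        · rw [← avg_km b x y h]; exact hx.2
      intro x y h
      have : x ∈ D ↔ y ∈ D := ⟨this x y h, this y x h.symm⟩
      simp only [this]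
    rw [e1, ← int_avg (hπ N) kD bD hb]
    refine (norm_add_le _ _).trans (add_le_add ih ?_)
    refine (norm_integral_le_integral_norm _).trans ?_
    have : τ*σ.real D = ∫ x, (if x ∈ D then τ else 0) ∂σ := by
      have : (fun x => if x ∈ D then τ else 0) = D.indicator fun _ => τ := by ext x; simp [indicator]
      rw [this, integral_indicator_const _ mD, smul_eq_mul, mul_comm]
    rw [this]
    refine integral_mono (bD.mul (avg_bm (hπ N) hb)).norm.int ((BM.const τ).ite (BM.const 0) mD).int fun x => ?_
    by_cases h : x ∈ D
    · simp [h]; exact h.2.le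
    · simp [h]
end meas
section asm
variable {X : Type*} [MetricSpace X] [MeasurableSpace X] [OpensMeasurableSpace X]
  [SecondCountableTopology X] {σ : Measure X} [IsFiniteMeasure σ] {K : X → X → ℂ} {n C α Λ W0 c0 : ℝ}
  {d : ℕ} {e : X → Fin d → ℝ} {ℓ : ℕ → ℝ} {b : X → ℂ} {H : Set X}
structure HY {X : Type*} [MetricSpace X] [MeasurableSpace X] (σ : Measure X) {d : ℕ} (K : X → X → ℂ)
    (e : X → Fin d → ℝ) (ℓ : ℕ → ℝ) (b : X → ℂ) (H : Set X) (n C α Λ W0 c0 : ℝ) : Prop where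
  ck : CK K n C α
  co : CO e ℓ
  L0 :0 ≤ Λ
  hg : ∀ x ∉ H, ∀ R,0 < R → σ.real (ball x R) ≤ Λ*R^n
  hW : ∀ x ∉ H, ∀ ε,0 < ε → ‖∫ y, (if ε < dist x y then K x y else 0)*b y ∂σ‖ ≤ W0
  bm : Measurable b
  b1 : ∀ x, ‖b x‖ ≤1
  mH : MeasurableSet H
  c00 :0 < c0
  pos :0 < σ.real univ
  big : c0*σ.real univ+σ.real H ≤ ‖∫ x, b x ∂σ‖
theorem HY.bb (hy : HY σ K e ℓ b H n C α Λ W0 c0) : BM b := ⟨hy.bm,1, hy.b1⟩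
theorem HY.c01 (hy : HY σ K e ℓ b H n C α Λ W0 c0) : c0 ≤1 := by
  have h1 : ‖∫ x, b x ∂σ‖ ≤1*σ.real univ := norm_integral_le_of_norm_le_const (Filter.Eventually.of_forall hy.b1)
  have := hy.big
  have :0 ≤ σ.real H := measureReal_nonneg
  have : c0*σ.real univ ≤1*σ.real univ := by linarith
  exact le_of_mul_le_mul_right this hy.pos
def mkTD (hy : HY σ K e ℓ b H n C α Λ W0 c0) (N : ℕ) (hN :1 ≤ N) (w : ℝ) : TD σ (Fin d → ℤ) where
  π := lp e ℓ w
  b := b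
  Tr k x := k < N ∧ ∀ i ≤ k, c0/2 ≤ ‖avg σ (lp e ℓ w i) b x‖
  τ := c0/2
  N := N
  mπ k := hy.co.lpm w k
  nest k := hy.co.nest w k
  bm := hy.bm
  b1 := hy.b1
  τ0 := half_pos hy.c00
  tr0 x := by
    refine ⟨hN, fun i hi => ?_⟩
    obtain rfl : i =0 := by omega
    have : lp e ℓ w 0 ⁻¹' {lp e ℓ w 0 x} = univ := by ext y; simp [lp]
    simp only [avg, this, Measure.restrict_univ, norm_mul, norm_inv]
    have h2 := hy.big
    have h3 := hy.pos
    have h5 := hy.c00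
    have h4 :0 ≤ σ.real H := measureReal_nonneg
    refine le_trans (b := c0) (by linarith) ?_
    rw [RCLike.norm_ofReal, abs_of_nonneg h3.le, inv_mul_eq_div, le_div_iff₀ h3]
    linarith
  anti k x h := ⟨by have := h.1; omega, fun i hi => h.2 i (by omega)⟩
  trk k x y h := by
    have : ∀ i ≤ k, avg σ (lp e ℓ w i) b x = avg σ (lp e ℓ w i) b y := fun i hi =>
      avg_km b x y (km_le (hy.co.nest w) hi x y h)
    refine propext (and_congr_right fun _ => forall₂_congr fun i hi => by rw [this i hi])
  low k x h := h.2 k le_rfl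
  trN x h := lt_irrefl _ h.1
open Classical in
theorem gs_sel (hy : HY σ K e ℓ b H n C α Λ W0 c0) (N : ℕ) (hN :1 ≤ N) (r : ℕ) (w w' : ℝ) :
    (mkTD hy N hN w).Sel (gs e ℓ r w w') where
  km k x y h := by
    have h : lp e ℓ w k x = lp e ℓ w k y := h
    simp only [gs, h]
  le k x := by unfold gs; split_ifs <;> simp
open Classical in
theorem gs_gd (hy : HY σ K e ℓ b H n C α Λ W0 c0) (N : ℕ) (hN :1 ≤ N) (r : ℕ) (w w' : ℝ) :
    GD ℓ r (mkTD hy N hN w') (gs e ℓ r w w') := by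
  intro k x m z h0 h1 h2 h3
  by_contra h
  exact h0 (if_pos ⟨x, rfl, m, h1, h2, z, h3, not_le.1 h⟩)
open Classical in
def Fs (σ : Measure X) (e : X → Fin d → ℝ) (ℓ : ℕ → ℝ) (b : X → ℂ) (H : Set X) (c0 : ℝ) (N : ℕ) (w : ℝ) : Set X :=
  {x | x ∉ H ∧ ¬ ∃ i < N, ‖avg σ (lp e ℓ w i) b x‖ < c0/2}
open Classical in
theorem HY.Fs (hy : HY σ K e ℓ b H n C α Λ W0 c0) (N : ℕ) (w : ℝ) :
    MeasurableSet (Fs σ e ℓ b H c0 N w) ∧ c0/2*σ.real univ ≤ σ.real (BP.Fs σ e ℓ b H c0 N w) := by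
  obtain ⟨m, h⟩ := stop_int (σ := σ) (hy.co.lpm w) (hy.co.nest w) hy.bb (τ := c0/2) N
  set S := {x | ∃ i < N, ‖avg σ (lp e ℓ w i) b x‖ < c0/2} with hS
  have eF : BP.Fs σ e ℓ b H c0 N w = Hᶜ ∩ Sᶜ := rfl
  have mF : MeasurableSet (BP.Fs σ e ℓ b H c0 N w) := by rw [eF]; exact hy.mH.compl.inter m.compl
  refine ⟨mF, ?_⟩
  have bS : BM (fun x => if ∃ i < N, ‖avg σ (lp e ℓ w i) b x‖ < c0/2 then b x else 0) := hy.bb.ite (BM.const 0) m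
  have bS' : BM (fun x => if ∃ i < N, ‖avg σ (lp e ℓ w i) b x‖ < c0/2 then 0 else b x) := (BM.const 0).ite hy.bb m
  have e1 : ∫ x, b x ∂σ = ∫ x, (if ∃ i < N, ‖avg σ (lp e ℓ w i) b x‖ < c0/2 then b x else 0) ∂σ
      + ∫ x, (if ∃ i < N, ‖avg σ (lp e ℓ w i) b x‖ < c0/2 then 0 else b x) ∂σ := by
    rw [← integral_add bS.int bS'.int]
    congr 1; funext x; split_ifs <;> simp
  have e2 : ‖∫ x, (if ∃ i < N, ‖avg σ (lp e ℓ w i) b x‖ < c0/2 then 0 else b x) ∂σ‖ ≤ σ.real Sᶜ := by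
    have : σ.real Sᶜ = ∫ x, Sᶜ.indicator (fun _ => (1:ℝ)) x ∂σ := by rw [integral_indicator_const _ m.compl]; simp
    rw [this]
    refine (norm_integral_le_integral_norm _).trans (integral_mono bS'.norm.int ((integrable_const 1).indicator m.compl) fun x => ?_)
    by_cases h : ∃ i < N, ‖avg σ (lp e ℓ w i) b x‖ < c0/2
    · simp only [if_pos h, norm_zero]; exact indicator_nonneg (fun _ _ => by norm_num) _
    · simp only [if_neg h]
      rw [indicator_of_mem (show x ∈ Sᶜ from h)]; exact hy.b1 x
  have e3 : σ.real Sᶜ ≤ σ.real (BP.Fs σ e ℓ b H c0 N w)+σ.real H := by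
    rw [eF]
    refine (measureReal_mono (fun x hx => ?_)).trans (measureReal_union_le _ _)
    by_cases h : x ∈ H
    · exact Or.inr h
    · exact Or.inl ⟨h, hx⟩
  have e4 := hy.big
  have e5 : σ.real S ≤ σ.real univ := measureReal_mono (subset_univ _)
  have e6 := norm_add_le (∫ x, (if ∃ i < N, ‖avg σ (lp e ℓ w i) b x‖ < c0/2 then b x else 0) ∂σ) (∫ x, (if ∃ i < N, ‖avg σ (lp e ℓ w i) b x‖ < c0/2 then 0 else b x) ∂σ)
  rw [← e1] at e6
  have e7 : c0/2*σ.real S ≤ c0/2*σ.real univ := mul_le_mul_of_nonneg_left e5 (half_pos hy.c00).le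
  linarith
open Classical in
theorem HY.step (hy : HY σ K e ℓ b H n C α Λ W0 c0) {r : ℕ} {θ t : ℝ} (th :0 < θ) (ht :0 < t) (hr :225*(d:ℝ)^2 <2^r)
    (th8 :8*d*θ ≤1) (hc : (t*c2 (c0/2) d r+t⁻¹*c3 (c0/2) d r*(cC (c0/2)*((r+2)*(6*d^2*(4*d+3)*θ) +
      12*d*(d+1)*(3/4)^r)))*(c0/4)⁻¹ ≤1/2) (N : ℕ) (hN :1 ≤ N) :
    ∃ Φ0 : X → ℝ, (∀ x y, Φ0 x ≤ Φ0 y+dist x y) ∧ (∀ x, infDist x Hᶜ ≤ Φ0 x) ∧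
      c0/4*σ.real univ ≤ σ.real {x | x ∉ H ∧ Φ0 x ≤0} ∧ Hᶜ.Nonempty ∧ ∀ δ,0 < δ →2*ℓ N ≤ δ →
      NB σ (sK K fun x => max (Φ0 x) δ) (2*(c1 (c0/2) (kW n C α Λ W0) (kA' n C α d θ Λ) ((1/2)^(α/4)) r*(c0/4)⁻¹)) := by
  obtain ⟨Z, hZ⟩ := exists_nat_ge θ⁻¹
  have Z0' : (0:ℝ) < Z := (inv_pos.2 th).trans_le hZ
  have Z0 :0 < Z := by exact_mod_cast Z0'
  have hco := hy.co
  set M :=2^N*Z with hM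
  have M0 :0 < M := by positivity
  have M0' : (0:ℝ) < (M:ℝ) := by exact_mod_cast M0
  set hh : ℝ := ℓ 1/((M : ℕ) : ℝ) with hhh
  haveI : Nonempty (Fin M) := ⟨⟨0, M0⟩⟩
  set w : Fin M → ℝ := fun ω => (ω : ℕ)*hh with hw
  set F : Fin M → Set X := fun ω => BP.Fs σ e ℓ b H c0 N (w ω) with hF
  have c00 := hy.c00
  have c01 := hy.c01
  have Fm : ∀ ω, MeasurableSet (F ω) := fun ω => (hy.Fs N (w ω)).1
  have Fb : ∀ ω, c0/2*σ.real univ ≤ σ.real (F ω) := fun ω => (hy.Fs N (w ω)).2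
  have Fne : ∀ ω, (F ω).Nonempty := fun ω => by
    by_contra h
    rw [not_nonempty_iff_eq_empty] at h
    have := Fb ω
    rw [h, measureReal_empty] at this
    have := mul_pos (half_pos c00) hy.pos
    linarith
  have FH : ∀ ω, F ω ⊆ Hᶜ := fun ω x hx => hx.1
  have Hne : Hᶜ.Nonempty := (Fne ⟨0, M0⟩).mono (FH _)
  have η0 :0 < c0/4 := by positivity
  have os := fun x => ordst η0 (by linarith) fun ω => infDist x (F ω)
  choose Φ0 hP hmin using os
  have lip : ∀ x y, Φ0 x ≤ Φ0 y+dist x y := fun x y => hmin x _ ((hP y).trans (Finset.sum_le_sum fun ω _ => by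
    by_cases h : infDist y (F ω) ≤ Φ0 y
    · rw [if_pos h, if_pos (infDist_le_infDist_add_dist.trans (by linarith))]
    · rw [if_neg h]; split_ifs <;> norm_num))
  have big : ∀ x, infDist x Hᶜ ≤ Φ0 x := fun x => by
    by_contra h
    have h0 := hP x
    rw [Finset.sum_eq_zero fun ω _ => if_neg fun h' => h ((infDist_le_infDist_of_subset (FH ω) (Fne ω)).trans h')] at h0
    have :0 < c0/4*(Fintype.card (Fin M) : ℝ) := by rw [Fintype.card_fin]; positivity
    linarith
  have cΦ : Continuous Φ0 := (LipschitzWith.of_le_add lip).continuous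
  refine ⟨Φ0, lip, big, ?_, Hne, ?_⟩
  · set A := {x | x ∉ H ∧ Φ0 x ≤0} with hA
    have mA : MeasurableSet A := hy.mH.compl.inter (measurableSet_le cΦ.measurable measurable_const)
    have b1 : ∀ ω, BM (fun x => if x ∈ F ω then (1:ℝ) else 0) := fun ω => (BM.const 1).ite (BM.const 0) (Fm ω)
    have i1 : ∀ (s : Set X), MeasurableSet s → ∫ x, (if x ∈ s then (1:ℝ) else 0) ∂σ = σ.real s := fun s hs => by
      have : (fun x => if x ∈ s then (1:ℝ) else 0) = s.indicator fun _ =>1 := by ext x; simp [indicator]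
      rw [this, integral_indicator_const _ hs]; simp
    have h1 : (M:ℝ)*(c0/2*σ.real univ) ≤ ∫ x, ∑ ω, (if x ∈ F ω then (1:ℝ) else 0) ∂σ := by
      rw [integral_finset_sum _ fun ω _ => (b1 ω).int]
      calc (M:ℝ)*(c0/2*σ.real univ) = ∑ ω : Fin M, c0/2*σ.real univ := by simp
        _ ≤ _ := Finset.sum_le_sum fun ω _ => by rw [i1 _ (Fm ω)]; exact Fb ω
    have bA : BM (fun x => if x ∈ A then (1:ℝ) else 0) := (BM.const 1).ite (BM.const 0) mA
    have h2 : ∫ x, ∑ ω, (if x ∈ F ω then (1:ℝ) else 0) ∂σ ≤ ∫ x, ((M:ℝ)*(if x ∈ A then (1:ℝ) else 0)+c0/4*M) ∂σ := by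
      refine integral_mono (BM.sum _ b1).int (((BM.const (M:ℝ)).mul bA).add (BM.const _)).int fun x => ?_
      show ∑ ω, (if x ∈ F ω then (1:ℝ) else 0) ≤ (M:ℝ)*(if x ∈ A then (1:ℝ) else 0)+c0/4*M
      by_cases hx : x ∈ A
      · rw [if_pos hx, mul_one]
        have : ∑ ω, (if x ∈ F ω then (1:ℝ) else 0) ≤ ∑ ω : Fin M, (1:ℝ) := Finset.sum_le_sum fun ω _ => by split_ifs <;> norm_num
        simp only [Finset.sum_const, Finset.card_univ, Fintype.card_fin, nsmul_eq_mul, mul_one] at this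
        have :0 ≤ c0/4*M := by positivity
        linarith
      · rw [if_neg hx, mul_zero, zero_add]
        by_contra h
        push Not at h
        apply hx
        refine ⟨fun hH => ?_, hmin x 0 ?_⟩
        · rw [Finset.sum_eq_zero fun ω _ => if_neg fun h' => FH ω h' hH] at h
          have :0 ≤ c0/4*M := by positivity
          linarith
        · rw [Fintype.card_fin]
          refine h.le.trans (Finset.sum_le_sum fun ω _ => ?_)
          by_cases h' : x ∈ F ω
          · rw [if_pos h', if_pos (infDist_zero_of_mem h').le]
          · rw [if_neg h']; split_ifs <;> norm_num
    have iA : ∫ x, (if x ∈ A then (1:ℝ) else 0) ∂σ = σ.real A := by convert i1 A mA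
    rw [integral_add ((BM.const (M:ℝ)).mul bA).int (BM.const _).int, integral_const_mul, iA, integral_const, smul_eq_mul] at h2
    have h3 : (M:ℝ)*(c0/4*σ.real univ) ≤ M*σ.real A := by nlinarith
    exact le_of_mul_le_mul_left h3 M0'
  · intro δ d0 hδ
    have KHH := mkKH (Φ := fun x => max (Φ0 x) δ) (θ := θ) (D := d) hy.ck hy.L0 hy.hg hy.hW hy.bm hy.b1 d0 (fun x => le_max_right _ _)
      (fun x y => max_le ((lip x y).trans (by linarith [le_max_left (Φ0 y) δ])) (by linarith [le_max_right (Φ0 y) δ, dist_nonneg (x := x) (y := y)]))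
      Hne (fun x => (big x).trans (le_max_left _ _)) hco.hl hco.l0 (by exact_mod_cast hco.d1) th
    obtain ⟨B, hB⟩ := KHH.bm.b
    have hc1 :0 ≤ c1 (c0/2) (kW n C α Λ W0) (kA' n C α d θ Λ) ((1/2)^(α/4)) r := by
      have := KHH.A0; have := KHH.g0; have := KHH.g1; have := cC_pos (c0/2); have := cE_nn (c0/2)
      have :0 <1-((1:ℝ)/2)^(α/4) := by linarith
      unfold c1; positivity
    refine nb_iter (N0 := |B| * σ.real univ) (by positivity) (by positivity) (nb_of_le (P := fun _ _ => |B|) KHH.bm (BM.const _)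
      (fun x y => (hB (x, y)).trans (le_abs_self _)) (fun _ _ => rfl) fun x => by rw [integral_const, smul_eq_mul, mul_comm]) ?_
    intro N' N0' hN'
    have ab := absorb (fun ω => mkTD hy N hN (w ω)) (fun ω k => {x | bdy e ℓ (w ω) (k+1) (d*(4*d+3)*(θ*ℓ k)) x})
      (fun ω => {x | infDist x (F ω) ≤ Φ0 x}) (fun ω ω' => gs e ℓ r (w ω) (w ω')) (τ := c0/2) (η := c0/4) (t := t)
      (pl :=6*d^2*(4*d+3)*θ) (pb :=12*d*(d+1)*(3/4)^r) (n := N) KHH (hco.bh th th8) ?_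
      (fun _ => rfl) (fun _ => rfl) (fun _ => rfl) (fun _ _ => gs_sel hy N hN r _ _) (fun _ _ => gs_gd hy N hN r _ _) hr
      (fun ω => measurableSet_le (continuous_infDist_pt _).measurable cΦ.measurable) η0 hP ?_ ?_ (by positivity) (by positivity) N0' hN' ht
    · intro f g hf hg
      refine (ab f g hf hg).trans (mul_le_mul_of_nonneg_right ?_ (add_nonneg (q_nonneg _) (q_nonneg _)))
      have := mul_le_mul_of_nonneg_left hc N0'
      linarith
    · intro ω f hf
      refine ⟨fun x y => by simp [mkTD, lp], fun k x y h => hco.dm _ _ _ _ h, ?_, fun k => hco.bdy_meas _ _ _, fun k x z h1 h2 => hco.bdy h1 h2⟩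
      intro i y s fy hnt hs hball
      have hyU : infDist y (F ω) ≤ Φ0 y := by by_contra h; exact fy (hf y h)
      obtain ⟨⟨h1, h2⟩, h3⟩ := hnt
      by_cases hi : i+1 < N
      · refine le_trans ?_ (hyU.trans (le_max_left _ _))
        refine (le_infDist (Fne ω)).2 fun z hz => ?_
        by_contra h
        push Not at h
        rw [dist_comm] at h
        apply h3
        refine ⟨hi, fun j hj => ?_⟩
        rcases Nat.lt_or_ge j (i+1) with h' | h'
        · exact h2 j (by omega)
        · obtain rfl : j = i+1 := by omega
          have hb' : lp e ℓ (w ω) (i+1) z = lp e ℓ (w ω) (i+1) y := hball z h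
          rw [← avg_km b z y hb']
          by_contra h4
          exact hz.2 ⟨i+1, hi, not_le.1 h4⟩
      · have : N = i+1 := by omega
        refine le_trans ?_ (le_max_right _ _)
        rw [hco.hl i] at hs
        rw [this] at hδ
        linarith
    · intro k x hk
      have lk := hco.l0 k
      have lk1 := hco.l0 (k+1)
      have d1 : (1:ℝ) ≤ d := by exact_mod_cast hco.d1
      have := hco.frac Z0 (show 1 ≤ k+1 by omega) (show k+1 ≤ N by omega) (s := d*(4*d+3)*(θ*ℓ k)) hhh (by
        have h1 : ℓ 1 ≤2^N*ℓ k := by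
          calc ℓ 1 ≤ ℓ 0 := lanti hco.hl hco.l0 (by omega)
            _ =2^k*ℓ (0+k) := lpow hco.hl 0 k
            _ ≤2^N*ℓ k := by rw [zero_add]; gcongr; norm_num
        rw [hhh, div_le_iff₀ M0']
        have h2 :1 ≤ θ*Z := by rw [inv_le_iff_one_le_mul₀ th] at hZ; linarith
        have h3 : (1:ℝ) ≤ d*(4*d+3) := by nlinarith
        calc ℓ 1 ≤2^N*ℓ k := h1
          _ ≤ (2^N*ℓ k)*((d*(4*d+3))*(θ*Z)) := le_mul_of_one_le_right (by positivity) (one_le_mul_of_one_le_of_one_le h3 h2)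
          _ = _ := by rw [hM]; push_cast; ring) x
      rw [Fintype.card_fin]
      refine this.trans (le_of_eq ?_)
      have e1 : (d*(4*d+3)*(θ*ℓ k))/ℓ (k+1) = d*(4*d+3)*θ*2 := by rw [hco.hl k]; field_simp
      rw [e1]; ring
    · intro j x ω hj
      rw [Fintype.card_fin]
      exact hco.gs_frac Z0 hj hhh x
end asm
section lim
variable {X : Type*} [MetricSpace X] [MeasurableSpace X] [OpensMeasurableSpace X]
  [SecondCountableTopology X] {σ : Measure X} [IsFiniteMeasure σ] {K : X → X → ℂ} {n C α Λ W0 c0 : ℝ}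
  {d : ℕ} {e : X → Fin d → ℝ} {ℓ : ℕ → ℝ} {b : X → ℂ} {H : Set X}
open Classical in
def tK {X : Type*} [MetricSpace X] (K : X → X → ℂ) (ε : ℝ) (x y : X) : ℂ := if ε < dist x y then K x y else 0
theorem tK_bm (ck : CK K n C α) {ε : ℝ} (e0 :0 < ε) : BM (fun z : X × X => tK K ε z.1 z.2) := by
  classical
  refine ⟨?_, C/ε^n, fun z => ?_⟩
  · unfold tK
    exact Measurable.ite (measurableSet_lt measurable_const measurable_dist) ck.m measurable_const
  · have := ck.C0; have := ck.n0.le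
    unfold tK
    split_ifs with h
    · refine (ck.size _ _).trans ?_; gcongr
    · rw [norm_zero]; positivity
theorem lip_max {Φ : X → ℝ} (h : ∀ x y, Φ x ≤ Φ y+dist x y) (δ : ℝ) (x y : X) :
    max (Φ x) δ ≤ max (Φ y) δ+dist x y :=
  max_le ((h x y).trans (by linarith [le_max_left (Φ y) δ])) (by linarith [le_max_right (Φ y) δ, dist_nonneg (x := x) (y := y)])
theorem sharp (hy : HY σ K e ℓ b H n C α Λ W0 c0) {L : X → ℝ} (lip : ∀ x y, L x ≤ L y+dist x y) (nn : ∀ x,0 ≤ L x) {B δ : ℝ} (d0 :0 < δ)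
    (h : NB σ (sK K fun x => max (L x) δ) B) (f g : X → ℂ) (hf : BM f) (hg : BM g)
    (sf : ∀ x, ¬ (x ∉ H ∧ L x ≤0) → f x =0) (sg : ∀ x, ¬ (x ∉ H ∧ L x ≤0) → g x =0) :
    ‖fm σ (tK K δ) f g‖ ≤ (B+C*2^(n+1)*(Λ*sS n 1))*(q σ f+q σ g) := by
  classical
  have ck := hy.ck
  have n0 := ck.n0; have C0 := ck.C0
  set G : Set X := {x | x ∉ H ∧ L x ≤0} with hG
  have mL : Measurable L := (LipschitzWith.of_le_add lip).continuous.measurable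
  have mG : MeasurableSet G := hy.mH.compl.inter (measurableSet_le mL measurable_const)
  have mGG : MeasurableSet {z : X × X | z.1 ∈ G ∧ z.2 ∈ G} := (measurable_fst mG).inter (measurable_snd mG)
  have bs := sK_bm (Φ := fun x => max (L x) δ) (mL.max measurable_const) d0 (fun x => le_max_right _ _) (lip_max lip δ) ck
  have bt := tK_bm ck d0
  set k' : X → X → ℂ := fun x y => if x ∈ G ∧ y ∈ G then tK K δ x y-sK K (fun x => max (L x) δ) x y else 0 with hk'
  have bk' : BM (fun z : X × X => k' z.1 z.2) := (bt.sub bs).ite (BM.const 0) mGG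
  set p : X → X → ℝ := fun x y => (δ/(δ+dist x y))^(1:ℝ)/(δ+dist x y)^n with hp
  have p0 : ∀ x y,0 ≤ p x y := fun x y => by positivity
  have bp : BM (fun z : X × X => p z.1 z.2) := by
    refine ⟨((measurable_const.div (measurable_const.add measurable_dist)).pow_const _).div ((measurable_const.add measurable_dist).pow_const _),1/δ^n, fun z => ?_⟩
    have r0 := dist_nonneg (x := z.1) (y := z.2)
    rw [Real.norm_of_nonneg (p0 _ _)]
    have : (δ/(δ+dist z.1 z.2))^(1:ℝ) ≤1 :=
      Real.rpow_le_one (by positivity) (by rw [div_le_one (by positivity)]; linarith) (by norm_num)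
    simp only [hp]
    gcongr; linarith
  have key : NB σ k' (C*2^(n+1)*(Λ*sS n 1)) := by
    refine nb_of_le (P := fun x y => if x ∈ G ∧ y ∈ G then C*2^(n+1)*p x y else 0) bk'
      (((BM.const _).mul bp).ite (BM.const 0) mGG) (fun x y => ?_) (fun x y => ?_) fun x => ?_
    · simp only [hk']
      by_cases hxy : x ∈ G ∧ y ∈ G
      · rw [if_pos hxy, if_pos hxy]
        have m1 : max (L x) δ = δ := max_eq_right (hxy.1.2.trans d0.le)
        have m2 : max (L y) δ = δ := max_eq_right (hxy.2.2.trans d0.le)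
        unfold tK sK sw
        simp only [m1, m2]
        have r0 := dist_nonneg (x := x) (y := y)
        by_cases hd : δ < dist x y
        · set ρ := dist x y with hρ
          have ρ0 :0 < ρ := d0.trans hd
          have :0 ≤1-δ*δ/ρ^2 := by rw [sub_nonneg, div_le_one (by positivity)]; nlinarith
          rw [if_pos hd, max_eq_right this]
          have e1 : K x y-K x y*((1-δ*δ/ρ^2 : ℝ) : ℂ) = K x y*((δ*δ/ρ^2 : ℝ) : ℂ) := by push_cast; ring
          rw [e1, norm_mul, Complex.norm_real, Real.norm_of_nonneg (by positivity)]
          have e2 : δ*δ/ρ^2 ≤2*(δ/(δ+ρ)) := by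
            rw [div_le_iff₀ (by positivity), ← mul_div_assoc, div_mul_eq_mul_div, le_div_iff₀ (by positivity)]
            have : δ*(δ+ρ) ≤2*ρ^2 := by nlinarith
            nlinarith
          have e3 : C/ρ^n ≤ C*2^n/(δ+ρ)^n := by
            rw [div_le_div_iff₀ (by positivity) (by positivity), mul_assoc, ← Real.mul_rpow (by norm_num) ρ0.le]
            gcongr; linarith
          calc _ ≤ C*2^n/(δ+ρ)^n*(2*(δ/(δ+ρ))) := mul_le_mul ((ck.size x y).trans e3) e2 (by positivity) (by positivity)
            _ = _ := by simp only [hp]; rw [Real.rpow_one, Real.rpow_add (by norm_num), Real.rpow_one]; ring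
        · rw [if_neg hd]
          have : K x y*((max 0 (1-δ*δ/dist x y^2) : ℝ) : ℂ) =0 := by
            rcases r0.eq_or_lt with h0 | h0
            · have := ck.size x y
              rw [← h0, Real.zero_rpow n0.ne', _root_.div_zero] at this
              rw [norm_le_zero_iff.1 this, zero_mul]
            · rw [max_eq_left, Complex.ofReal_zero, mul_zero]
              rw [sub_nonpos, le_div_iff₀ (by positivity)]; nlinarith
          rw [this, sub_zero, norm_zero]; exact mul_nonneg (by positivity) (p0 _ _)
      · rw [if_neg hxy, if_neg hxy, norm_zero]
    · simp only [hp, and_comm, dist_comm]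
    · by_cases hx : x ∈ G
      · have h1 := shell (β :=1) d0 hy.L0 (by norm_num) n0.le fun R hR => hy.hg x hx.1 R (d0.trans_le hR)
        refine le_trans (integral_mono ?_ ((BM.const (C*2^(n+1))).mul (frac_bm x d0 (by norm_num) n0.le)).int fun y => ?_) ((integral_const_mul _ _).le.trans (mul_le_mul_of_nonneg_left h1 (by positivity)))
        · have : BM fun y => C*2^(n+1)*p x y := (BM.const _).mul (frac_bm x d0 (by norm_num) n0.le)
          exact (this.ite (BM.const 0) (P := fun y => x ∈ G ∧ y ∈ G) (by simpa [hx] using mG)).int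
        · show (if x ∈ G ∧ y ∈ G then C*2^(n+1)*p x y else 0) ≤ C*2^(n+1)*p x y
          split_ifs
          · exact le_rfl
          · exact mul_nonneg (by positivity) (p0 _ _)
      · simp only [hx, false_and, if_false, integral_zero]
        have := sS_nn n (show (0:ℝ) <1 by norm_num); have := hy.L0
        positivity
  have e1 : fm σ (tK K δ) f g = fm σ (sK K fun x => max (L x) δ) f g+fm σ k' f g := by
    unfold fm
    rw [← integral_add (fm_bm bs hf hg).int (fm_bm bk' hf hg).int]
    congr 1; funext z
    simp only [hk']
    by_cases hz : z.1 ∈ G ∧ z.2 ∈ G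
    · rw [if_pos hz]; ring
    · rw [if_neg hz]
      have : f z.2*g z.1 =0 := by
        rw [not_and_or] at hz
        rcases hz with h | h
        · rw [sg _ h, mul_zero]
        · rw [sf _ h, zero_mul]
      rw [this]; ring
  rw [e1, add_mul]
  exact (norm_add_le _ _).trans (add_le_add (h f g hf hg) (key f g hf hg))
theorem HY.lim [CompactSpace X] (hy : HY σ K e ℓ b H n C α Λ W0 c0) {B : ℝ}
    (hs : ∀ N : ℕ,1 ≤ N → ∃ Φ0 : X → ℝ, (∀ x y, Φ0 x ≤ Φ0 y+dist x y) ∧ (∀ x, infDist x Hᶜ ≤ Φ0 x) ∧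
      c0/4*σ.real univ ≤ σ.real {x | x ∉ H ∧ Φ0 x ≤0} ∧ Hᶜ.Nonempty ∧ ∀ δ,0 < δ →2*ℓ N ≤ δ →
      NB σ (sK K fun x => max (Φ0 x) δ) B) :
    ∃ L : X → ℝ, (∀ x y, L x ≤ L y+dist x y) ∧ (∀ x,0 ≤ L x) ∧ c0/4*σ.real univ ≤ σ.real {x | x ∉ H ∧ L x ≤0} ∧
      ∀ δ,0 < δ → NB σ (sK K fun x => max (L x) δ) B := by
  choose Φ lip big vol hne nb using fun N : ℕ => hs (N+1) (by omega)
  have co := hy.co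
  have nn : ∀ N x,0 ≤ Φ N x := fun N x => infDist_nonneg.trans (big N x)
  have cont : ∀ N, Continuous (Φ N) := fun N => (LipschitzWith.of_le_add (lip N)).continuous
  have ub : ∀ N x, Φ N x ≤ d*ℓ 0 := by
    intro N x
    have : {x | x ∉ H ∧ Φ N x ≤0}.Nonempty := by
      by_contra h
      rw [not_nonempty_iff_eq_empty] at h
      have h1 := vol N
      rw [h, measureReal_empty] at h1
      have := mul_pos hy.c00 hy.pos
      linarith
    obtain ⟨y, -, hy'⟩ := this
    have := lip N x y
    have := co.le2 x y _ (co.bd x y)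
    linarith
  set F : ℕ → BoundedContinuousFunction X ℝ := fun N => BoundedContinuousFunction.mkOfCompact ⟨Φ N, cont N⟩ with hF
  have cpt := BoundedContinuousFunction.arzela_ascoli (Icc 0 (d*ℓ 0)) isCompact_Icc (range F)
    (by rintro _ x ⟨N, rfl⟩; exact ⟨nn N x, ub N x⟩)
    (equicontinuous_of_continuity_modulus (fun t => t) Filter.tendsto_id _ (by
      rintro x y ⟨_, N, rfl⟩
      show dist (Φ N x) (Φ N y) ≤ dist x y
      rw [Real.dist_eq, abs_le]
      have := lip N x y; have h2 := lip N y x; rw [dist_comm] at h2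
      constructor <;> linarith))
  obtain ⟨L, -, φ, hφ, hL⟩ := cpt.tendsto_subseq fun N => subset_closure (mem_range_self N)
  have unif : ∀ ε >0, ∀ᶠ j in Filter.atTop, ∀ x, |Φ (φ j) x-L x| ≤ ε := by
    intro ε he
    filter_upwards [(Metric.tendsto_nhds.1 hL) ε he] with j hj x
    exact ((BoundedContinuousFunction.dist_coe_le_dist x).trans hj.le)
  have pt : ∀ x, Filter.Tendsto (fun j => Φ (φ j) x) Filter.atTop (nhds (L x)) := fun x => by
    rw [Metric.tendsto_nhds]
    intro ε he
    filter_upwards [unif (ε/2) (half_pos he)] with j hj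
    rw [Real.dist_eq]; linarith [hj x]
  have lipL : ∀ x y, L x ≤ L y+dist x y := fun x y => le_of_tendsto_of_tendsto' (pt x) ((pt y).add_const _) fun j => lip _ x y
  refine ⟨L, lipL, fun x => ge_of_tendsto' (pt x) fun j => nn _ x, ?_, ?_⟩
  · set S : ℕ → Set X := fun m => {x | x ∉ H ∧ L x ≤1/((m:ℝ)+1)} with hS
    have mL : Measurable L := L.continuous.measurable
    have e1 : {x | x ∉ H ∧ L x ≤0} = ⋂ m, S m := by
      ext x
      simp only [hS, mem_setOf_eq, mem_iInter]
      refine ⟨fun h m => ⟨h.1, h.2.trans (by positivity)⟩, fun h => ⟨(h 0).1, ?_⟩⟩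
      exact ge_of_tendsto' tendsto_one_div_add_atTop_nhds_zero_nat fun m => (h m).2
    have t1 : Filter.Tendsto (fun m => σ (S m)) Filter.atTop (nhds (σ (⋂ m, S m))) := by
      refine tendsto_measure_iInter_atTop (fun m => (hy.mH.compl.inter (measurableSet_le mL measurable_const)).nullMeasurableSet) ?_ ⟨0, measure_ne_top _ _⟩
      intro m m' h x hx
      exact ⟨hx.1, hx.2.trans (one_div_le_one_div_of_le (by positivity) (by gcongr))⟩
    have t2 := (ENNReal.tendsto_toReal (measure_ne_top σ _)).comp t1
    rw [e1]
    refine ge_of_tendsto' t2 fun m => ?_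
    obtain ⟨j, hj⟩ := (unif (1/((m:ℝ)+1)) (by positivity)).exists
    refine (vol (φ j)).trans (measureReal_mono fun x hx => ⟨hx.1, ?_⟩)
    have := (abs_le.1 (hj x)).1
    have := hx.2
    linarith
  · intro δ d0 f g hf hg
    have l0 : Filter.Tendsto (fun j =>2*ℓ (φ j+1)) Filter.atTop (nhds 0) := by
      have h1 : ∀ j,2*ℓ (j+1) = ℓ 0*(1/2)^j := fun j => by
        rw [← co.hl j, lpow co.hl 0 j, zero_add, one_div, inv_pow]; field_simp
      have : Filter.Tendsto (fun j : ℕ =>2*ℓ (j+1)) Filter.atTop (nhds 0) := by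
        simp only [h1]
        simpa using (_root_.tendsto_pow_atTop_nhds_zero_of_lt_one (r := (1/2:ℝ)) (by norm_num) (by norm_num)).const_mul (ℓ 0)
      exact this.comp hφ.tendsto_atTop
    have bmk : ∀ j, BM (fun z : X × X => sK K (fun x => max (Φ (φ j) x) δ) z.1 z.2) := fun j =>
      sK_bm ((cont _).measurable.max measurable_const) d0 (fun x => le_max_right _ _) (lip_max (lip _) δ) hy.ck
    have t : Filter.Tendsto (fun j => fm σ (sK K fun x => max (Φ (φ j) x) δ) f g) Filter.atTop (nhds (fm σ (sK K fun x => max (L x) δ) f g)) := by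
      unfold fm
      refine tendsto_integral_of_dominated_convergence (fun z => C/(δ/2)^n*‖f z.2*g z.1‖) (fun j => (fm_bm (bmk j) hf hg).m.aestronglyMeasurable)
        ((BM.const _).mul (hf.snd.mul hg.fst).norm).int (fun j => Filter.Eventually.of_forall fun z => ?_) (Filter.Eventually.of_forall fun z => ?_)
      · rw [norm_mul]
        exact mul_le_mul_of_nonneg_right (sK_bd d0 (fun x => le_max_right _ _) (lip_max (lip _) δ) hy.ck _ _) (norm_nonneg _)
      · unfold sK sw
        refine (Filter.Tendsto.const_mul _ ((Complex.continuous_ofReal.tendsto _).comp ?_)).mul_const _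
        exact tendsto_const_nhds.max (tendsto_const_nhds.sub ((((pt z.1).max tendsto_const_nhds).mul ((pt z.2).max tendsto_const_nhds)).div_const _))
    refine le_of_tendsto t.norm ?_
    filter_upwards [l0.eventually_le_const d0] with j hj
    exact nb _ δ d0 hj f g hf hg
theorem mainA (d : ℕ) (hd :1 ≤ d) (n C α Λ W0 c0 : ℝ) (hc :0 < c0) : ∃ B : ℝ, ∀ (X : Type) [MetricSpace X] [MeasurableSpace X] [OpensMeasurableSpace X]
    [SecondCountableTopology X] [CompactSpace X] (σ : Measure X) [IsFiniteMeasure σ] (K : X → X → ℂ) (e : X → Fin d → ℝ) (ℓ : ℕ → ℝ) (b : X → ℂ) (H : Set X),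
    HY σ K e ℓ b H n C α Λ W0 c0 → ∃ G : Set X, MeasurableSet G ∧ Disjoint G H ∧ c0/4*σ.real univ ≤ σ.real G ∧
      ∀ δ,0 < δ → ∀ f g : X → ℂ, BM f → BM g → (∀ x ∉ G, f x =0) → (∀ x ∉ G, g x =0) → ‖fm σ (tK K δ) f g‖ ≤ B*(q σ f+q σ g) := by
  obtain ⟨r, θ, t, th, ht, hr, h8, hcc⟩ := consts (c0/2) (show 0 < c0/4 by positivity) d hd
  refine ⟨2*(c1 (c0/2) (kW n C α Λ W0) (kA' n C α d θ Λ) ((1/2)^(α/4)) r*(c0/4)⁻¹)+C*2^(n+1)*(Λ*sS n 1), fun X _ _ _ _ _ σ _ K e ℓ b H hy => ?_⟩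
  obtain ⟨L, lip, nn, vol, nb⟩ := hy.lim (fun N hN => hy.step th ht hr h8 hcc N hN)
  have mL : Measurable L := (LipschitzWith.of_le_add lip).continuous.measurable
  exact ⟨{x | x ∉ H ∧ L x ≤0}, hy.mH.compl.inter (measurableSet_le mL measurable_const), disjoint_left.2 fun x h => h.1, vol,
    fun δ d0 f g hf hg sf sg => sharp hy lip nn d0 (nb δ d0) f g hf hg sf sg⟩
end lim
open NNReal
theorem hol (p B η : ℝ) (hp :1 < p) (h0 :0 < η) : ∃ M : ℝ,1 ≤ M ∧ ∀ (X : Type) [MeasurableSpace X]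
    (ν : Measure X) (β : X → ℂ), ∫⁻ x, (‖β x‖₊ : ℝ≥0∞)^p ∂ν ≤ ENNReal.ofReal B*ν univ →
    ∀ A, MeasurableSet A → ν.withDensity (fun x => (‖β x‖₊ : ℝ≥0∞)) A
      ≤ ENNReal.ofReal M*ν A+ENNReal.ofReal η*ν univ := by
  have ht := (tendsto_rpow_neg_atTop (y := p-1) (by linarith)).mul_const B
  rw [zero_mul] at ht
  obtain ⟨M, hM, h1⟩ := ((ht.eventually (ge_mem_nhds h0)).and (Filter.eventually_ge_atTop 1)).exists
  have M0 :0 < M := by linarith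
  refine ⟨M, h1, fun X _ ν β hb A hA => ?_⟩
  rw [withDensity_apply _ hA]
  have key : ∀ x, (‖β x‖₊ : ℝ≥0∞) ≤ ENNReal.ofReal M+ENNReal.ofReal (M^(-(p-1)))*(‖β x‖₊ : ℝ≥0∞)^p := by
    intro x
    rw [← enorm_eq_nnnorm, ← ofReal_norm, ENNReal.ofReal_rpow_of_nonneg (norm_nonneg _) (by linarith), ← ENNReal.ofReal_mul (by positivity), ← ENNReal.ofReal_add M0.le (by positivity)]
    apply ENNReal.ofReal_le_ofReal
    rcases le_total ‖β x‖ M with h | h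
    · have :0 ≤ M^(-(p-1))*‖β x‖^p := by positivity
      linarith
    · have t0 :0 < ‖β x‖ := M0.trans_le h
      have : M^(-(p-1))*‖β x‖^p = ‖β x‖*(‖β x‖/M)^(p-1) := by
        rw [Real.div_rpow t0.le M0.le, Real.rpow_neg M0.le, Real.rpow_sub_one t0.ne']
        field_simp
      rw [this]
      have := Real.one_le_rpow ((one_le_div M0).2 h) (show 0 ≤ p-1 by linarith)
      nlinarith
  calc _ ≤ ∫⁻ x in A, (ENNReal.ofReal M+ENNReal.ofReal (M^(-(p-1)))*(‖β x‖₊ : ℝ≥0∞)^p) ∂ν := lintegral_mono key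
    _ = ENNReal.ofReal M*ν A+ENNReal.ofReal (M^(-(p-1))) * ∫⁻ x in A, (‖β x‖₊ : ℝ≥0∞)^p ∂ν := by
        rw [lintegral_add_left measurable_const, lintegral_const_mul' _ _ ENNReal.ofReal_ne_top]; simp
    _ ≤ ENNReal.ofReal M*ν A+ENNReal.ofReal (M^(-(p-1)))*(ENNReal.ofReal B*ν univ) := by
        gcongr; exact (setLIntegral_le_lintegral _ _).trans hb
    _ ≤ _ := by
        rw [← mul_assoc, ← ENNReal.ofReal_mul (by positivity)]; gcongr
theorem vit {X : Type} [MetricSpace X] [MeasurableSpace X] [OpensMeasurableSpace X]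
    [SecondCountableTopology X] (ν σ : Measure X) [IsFiniteMeasure σ] {n C Λ : ℝ} (n0 :0 < n) (C0 :0 < C) (L0 :0 < Λ)
    (hν : ∀ x r,0 < r → ν (ball x r) ≤ ENNReal.ofReal (C*r^n)) : ∃ A, MeasurableSet A ∧
      ν A ≤ ENNReal.ofReal (C*6^n/Λ)*σ univ ∧ ∀ x ∉ A, ∀ R,0 < R → σ.real (ball x R) ≤ Λ*R^n := by
  obtain ⟨u, hu, hd, hc⟩ := Vitali.exists_disjoint_subfamily_covering_enlargement_closedBall
    {a : X × ℝ | 0 < a.2 ∧ Λ*a.2^n < σ.real (ball a.1 a.2)} (fun a => a.1) (fun a => a.2)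
    ((σ.real univ/Λ)^(1/n)) (by
      rintro ⟨x, r⟩ ⟨r0, h⟩
      dsimp only at *
      have : r^n ≤ σ.real univ/Λ := by rw [le_div_iff₀ L0]; linarith [measureReal_mono (μ := σ) (subset_univ (ball x r))]
      rw [one_div, ← Real.rpow_rpow_inv r0.le n0.ne']
      gcongr) 5 (by norm_num)
  have uc : u.Countable := hd.countable_of_nonempty_interior fun a ha =>
    ⟨a.1, ball_subset_interior_closedBall (mem_ball_self (hu ha).1)⟩
  refine ⟨⋃ a ∈ u, closedBall a.1 (5*a.2), MeasurableSet.biUnion uc fun _ _ => isClosed_closedBall.measurableSet, ?_, fun x hx R R0 => ?_⟩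
  · have := uc.to_subtype
    calc _ ≤ ∑' a : u, ν (closedBall a.1.1 (5*a.1.2)) := measure_biUnion_le _ uc _
      _ ≤ ∑' a : u, ENNReal.ofReal (C*6^n/Λ)*σ (closedBall a.1.1 a.1.2) := by
          refine ENNReal.tsum_le_tsum fun a => ?_
          obtain ⟨r0, h⟩ := hu a.2
          calc _ ≤ ν (ball a.1.1 (6*a.1.2)) := measure_mono (closedBall_subset_ball (by linarith))
            _ ≤ _ := hν _ _ (by linarith)
            _ ≤ ENNReal.ofReal (C*6^n/Λ*σ.real (ball a.1.1 a.1.2)) := by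
                apply ENNReal.ofReal_le_ofReal
                rw [Real.mul_rpow (by norm_num) r0.le, div_mul_eq_mul_div, le_div_iff₀ L0]
                have :0 < C*6^n := by positivity
                nlinarith
            _ ≤ _ := by
                rw [ENNReal.ofReal_mul (by positivity), ofReal_measureReal]
                gcongr; exact ball_subset_closedBall
      _ = ENNReal.ofReal (C*6^n/Λ)*σ (⋃ a ∈ u, closedBall a.1 a.2) := by
          rw [ENNReal.tsum_mul_left, measure_biUnion uc hd fun _ _ => isClosed_closedBall.measurableSet]
      _ ≤ _ := by gcongr; exact subset_univ _
  · by_contra! h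
    obtain ⟨b, hb, hs⟩ := hc (x, R) ⟨R0, h⟩
    exact hx (mem_biUnion hb (hs (mem_closedBall_self R0.le)))
open NNReal
theorem tR {X : Type} [MeasurableSpace X] (ν σ : Measure X) [IsFiniteMeasure ν] {x y : ℝ} (hx :0 ≤ x) (hy :0 ≤ y) {A B D : Set X}
    (h : σ D ≤ ENNReal.ofReal x*ν A+ENNReal.ofReal y*ν B) : σ.real D ≤ x*ν.real A+y*ν.real B := by
  have := ENNReal.toReal_mono (by finiteness) h
  rwa [ENNReal.toReal_add (by finiteness) (by finiteness), ENNReal.toReal_mul, ENNReal.toReal_mul, ENNReal.toReal_ofReal hx, ENNReal.toReal_ofReal hy] at this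
theorem fm_den {X : Type} [MeasurableSpace X] (ν : Measure X) [IsFiniteMeasure ν] (w : X → ℝ≥0) (hw : Measurable w) (k : X → X → ℂ) (f g : X → ℂ)
    [IsFiniteMeasure (ν.withDensity fun x => w x)] :
    fm (ν.withDensity fun x => w x) k f g = fm ν k (fun x => w x*f x) (fun x => w x*g x) := by
  unfold fm
  have := prod_withDensity (μ := ν) (ν := ν) (f := fun x => (w x : ℝ≥0∞)) (g := fun x => (w x : ℝ≥0∞)) hw.coe_nnreal_ennreal hw.coe_nnreal_ennreal
  rw [this]
  have h2 := integral_withDensity_eq_integral_smul (μ := ν.prod ν) (f := fun z : X × X => w z.1*w z.2) ((hw.comp measurable_fst).mul (hw.comp measurable_snd)) (fun z => k z.1 z.2*(f z.2*g z.1))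
  simp only [ENNReal.coe_mul] at h2
  rw [h2]
  congr 1; ext z
  rw [NNReal.smul_def, Complex.real_smul]; push_cast; ring
theorem mainB (p B₁ : ℝ) (hp :1 < p) : ∃ M : ℝ,1 ≤ M ∧ ∀ (d : ℕ) (n C₀ C α s B₂ : ℝ),1 ≤ d →0 < n →0 < C₀ →0 < s →0 < B₂ →
    ∃ c : ℝ,0 < c ∧ ∃ B : ℝ,0 < B ∧ ∃ W : ℝ,0 < W ∧ ∀ (X : Type) [MetricSpace X] [MeasurableSpace X] [OpensMeasurableSpace X]
    [SecondCountableTopology X] [CompactSpace X] (ν : Measure X) [IsFiniteMeasure ν] (K : X → X → ℂ) (e : X → Fin d → ℝ) (ℓ : ℕ → ℝ) (β : X → ℂ) (E A : Set X),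
    CK K n C α → CO e ℓ → Measurable β →0 < ν.real univ → (∀ x r,0 < r → ν (ball x r) ≤ ENNReal.ofReal (C₀*r^n)) →
    ‖∫ x, β x ∂ν‖ = ν.real univ → ∫⁻ x, (‖β x‖₊ : ℝ≥0∞)^p ∂ν ≤ ENNReal.ofReal B₁*ν univ → MeasurableSet E → MeasurableSet A →
    ∫⁻ x in E, (‖β x‖₊ : ℝ≥0∞) ∂ν ≤ ENNReal.ofReal (1/(16*M)) * ∫⁻ x, (‖β x‖₊ : ℝ≥0∞) ∂ν →
    ENNReal.ofReal (W^s)*ν A ≤ ENNReal.ofReal B₂*ν univ →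
    (∀ x, x ∉ E → x ∉ A → ∀ ε,0 < ε → ‖∫ y, tK K ε x y*β y ∂ν‖ ≤ W) →
    ∃ G : Set X, MeasurableSet G ∧ Disjoint G E ∧ c*ν.real univ ≤ ν.real G ∧
      ∀ δ,0 < δ → ∀ f g : X → ℂ, BM f → BM g → (∀ x ∉ G, f x =0) → (∀ x ∉ G, g x =0) → ‖fm ν (tK K δ) f g‖ ≤ B*(q ν f+q ν g) := by
  obtain ⟨M, M1, hM⟩ := hol p B₁ (1/16) hp (by norm_num)
  have M0 :0 < M := by linarith
  refine ⟨M, M1, fun d n C₀ C α s B₂ d1 n0 C00 s0 B20 => ?_⟩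
  obtain ⟨M', M1', hM'⟩ := hol p B₁ (1/(4*M)/8) hp (by positivity)
  have M0' :0 < M' := by linarith
  obtain ⟨B, hB⟩ := mainA d d1 n C α (32*M*M*(C₀*6^n)) ((16*M*B₂)^(1/s)) (1/(4*M)) (by positivity)
  refine ⟨1/(4*M)/8/M', by positivity,8 * |B| +1, by positivity, (16*M*B₂)^(1/s), by positivity,
    fun X _ _ _ _ _ ν _ K e ℓ β E A ck co mb pos gr hi hL mE mA hE hA hW => ?_⟩
  have mw : Measurable fun x => ‖β x‖₊ := mb.nnnorm
  have hol1 := hM X ν β hL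
  have hol2 := hM' X ν β hL
  set σ := ν.withDensity (fun x => (‖β x‖₊ : ℝ≥0∞)) with hσ
  have fin : IsFiniteMeasure σ := ⟨(hol1 univ MeasurableSet.univ).trans_lt (by finiteness)⟩
  have h1 : ∀ D, MeasurableSet D → σ.real D ≤ M*ν.real D+1/16*ν.real univ := fun D hD => tR ν σ M0.le (by norm_num) (hol1 D hD)
  have int : ∀ f : X → ℂ, ∫ x, f x ∂σ = ∫ x, (‖β x‖ : ℂ)*f x ∂ν := fun f => by
    rw [hσ, integral_withDensity_eq_integral_smul mw]
    congr 1
  have hb : ∀ x, (‖β x‖ : ℂ)*(β x/‖β x‖) = β x := fun x => by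
    by_cases h : β x =0
    · simp [h]
    · have : (‖β x‖ : ℂ) ≠ 0 := by simpa using h
      field_simp
  have hib : ‖∫ x, β x/‖β x‖ ∂σ‖ = ν.real univ := by rw [int]; simp_rw [hb]; exact hi
  have b1 : ∀ x, ‖β x/‖β x‖‖ ≤1 := fun x => by
    rw [norm_div, Complex.norm_real, norm_norm]; exact div_self_le_one _
  have sge : ν.real univ ≤ σ.real univ := by
    rw [← hib]
    simpa using norm_integral_le_of_norm_le_const (μ := σ) (Filter.Eventually.of_forall b1)
  have sle : σ.real univ ≤2*M*ν.real univ := by have := h1 univ MeasurableSet.univ; nlinarith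
  obtain ⟨V, mV, hV, hg⟩ := vit ν σ n0 C00 (show 0 <32*M*M*(C₀*6^n) by positivity) gr
  have e1 : σ.real E ≤1/8*ν.real univ := by
    have := tR σ σ (x :=1/(16*M)) (y :=0) (A := univ) (B := univ) (D := E) (by positivity) le_rfl (by
      rw [withDensity_apply _ mE, hσ, withDensity_apply _ MeasurableSet.univ, setLIntegral_univ]; simpa using hE)
    rw [zero_mul, _root_.add_zero] at this
    calc _ ≤ _ := this
      _ ≤1/(16*M)*(2*M*ν.real univ) := by gcongr
      _ = _ := by field_simp; norm_num
  have e2 : σ.real A ≤1/8*ν.real univ := by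
    rw [← Real.rpow_mul (by positivity), one_div, inv_mul_cancel₀ s0.ne', Real.rpow_one] at hA
    have h3 := ENNReal.toReal_mono (by finiteness) hA
    rw [ENNReal.toReal_mul, ENNReal.toReal_mul, ENNReal.toReal_ofReal (by positivity), ENNReal.toReal_ofReal (by positivity)] at h3
    have h4 :16*M*ν.real A ≤ ν.real univ := le_of_mul_le_mul_left (by unfold Measure.real; linarith) B20
    linarith [h1 A mA]
  have e3 : σ.real V ≤1/8*ν.real univ := by
    have h3 := tR σ ν (y :=0) (B := univ) (by positivity) le_rfl (hV.trans (le_self_add (b := _)))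
    have : C₀*6^n/(32*M*M*(C₀*6^n)) =1/(32*M*M) := by
      have :0 < C₀*6^n := by positivity
      field_simp
    rw [this, zero_mul, _root_.add_zero] at h3
    have : M*ν.real V ≤1/16*ν.real univ := by
      calc _ ≤ M*(1/(32*M*M)*(2*M*ν.real univ)) := by gcongr; exact h3.trans (by gcongr)
        _ = _ := by field_simp; norm_num
    linarith [h1 V mV]
  have mU : MeasurableSet {x | ‖β x‖ <1/8} := measurableSet_lt mb.norm measurable_const
  have e4 : σ.real {x | ‖β x‖ <1/8} ≤1/8*ν.real univ := by
    have := tR ν σ (x :=1/8) (y :=0) (A := univ) (B := univ) (D := {x | ‖β x‖ <1/8}) (by norm_num) le_rfl (by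
      rw [withDensity_apply _ mU]
      calc _ ≤ ∫⁻ x in {x | ‖β x‖ <1/8}, ENNReal.ofReal (1/8) ∂ν := by
            refine setLIntegral_mono measurable_const fun x hx => ?_
            rw [← enorm_eq_nnnorm, ← ofReal_norm]; exact ENNReal.ofReal_le_ofReal (le_of_lt hx)
        _ ≤ _ := by rw [setLIntegral_const]; refine le_add_right ?_; gcongr; exact subset_univ _)
    linarith
  obtain ⟨G, mG, dG, vG, bG⟩ := hB X σ K e ℓ (fun x => β x/‖β x‖) (E ∪ A ∪ V ∪ {x | ‖β x‖ <1/8})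
    { ck := ck, co := co, L0 := by positivity
      hg := fun x hx => hg x fun h => hx (Or.inl (Or.inr h))
      hW := fun x hx ε e0 => by
        rw [int]
        have : ∀ y, (‖β y‖ : ℂ)*((if ε < dist x y then K x y else 0)*(β y/‖β y‖)) = tK K ε x y*β y := fun y => by
          rw [mul_left_comm, hb]; unfold tK; split_ifs <;> rfl
        simp_rw [this]
        exact hW x (fun h => hx (Or.inl (Or.inl (Or.inl h)))) (fun h => hx (Or.inl (Or.inl (Or.inr h)))) ε e0
      bm := by fun_prop
      b1 := b1
      mH := ((mE.union mA).union mV).union mU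
      c00 := by positivity
      pos := by linarith
      big := by
        rw [hib]
        have u1 := measureReal_union_le (μ := σ) (E ∪ A ∪ V) {x | ‖β x‖ <1/8}
        have u2 := measureReal_union_le (μ := σ) (E ∪ A) V
        have u3 := measureReal_union_le (μ := σ) E A
        have :1/(4*M)*σ.real univ ≤1/2*ν.real univ := by
          calc _ ≤1/(4*M)*(2*M*ν.real univ) := by gcongr
            _ = _ := by field_simp; norm_num
        linarith }
  have dH : ∀ x ∈ G, x ∉ E ∧ 1/8 ≤ ‖β x‖ := fun x hx => by
    have := disjoint_left.1 dG hx
    simp only [mem_union, not_or, mem_setOf_eq, not_lt] at this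
    exact ⟨this.1.1.1, this.2⟩
  refine ⟨G, mG, disjoint_left.2 fun x hx => (dH x hx).1, ?_, fun δ d0 f g hf hg sf sg => ?_⟩
  · have := tR ν σ M0'.le (by positivity) (hol2 G mG)
    rw [div_mul_eq_mul_div, div_le_iff₀ M0']
    have :1/(4*M)/4*ν.real univ ≤1/(4*M)/4*σ.real univ := by gcongr
    linarith
  · have sc : ∀ f : X → ℂ, BM f → (∀ x ∉ G, f x =0) → BM (fun x => f x/‖β x‖) ∧ (∀ x ∉ G, f x/‖β x‖ =0) ∧ q σ (fun x => f x/‖β x‖) ≤8*q ν f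
        ∧ (fun x => (‖β x‖₊ : ℂ)*(f x/‖β x‖)) = f := by
      intro f hf sf
      have le : ∀ x, ‖f x/‖β x‖‖ ≤8*‖f x‖ := fun x => by
        by_cases hx : x ∈ G
        · rw [norm_div, Complex.norm_real, norm_norm, div_le_iff₀ (by linarith [(dH x hx).2])]
          nlinarith [(dH x hx).2, norm_nonneg (f x)]
        · simp [sf x hx]
      have hm := hf.m
      have hbm : BM (fun x => f x/‖β x‖) := BM.of_le (by fun_prop) ((BM.const (8 : ℝ)).mul hf.norm) le
      have eq : ∀ x, ‖β x‖*‖f x/‖β x‖‖ = ‖f x‖ := fun x => by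
        by_cases hx : x ∈ G
        · rw [norm_div, Complex.norm_real, norm_norm, mul_div_cancel₀ _ (by linarith [(dH x hx).2])]
        · simp [sf x hx]
      refine ⟨hbm, fun x hx => by simp [sf x hx], ?_, ?_⟩
      · unfold q
        rw [hσ, integral_withDensity_eq_integral_smul mw, ← integral_const_mul]
        have h8 : ∀ x, ‖β x‖₊ • ‖f x/‖β x‖‖^2 ≤8*‖f x‖^2 := fun x => by
          rw [NNReal.smul_def, coe_nnnorm, smul_eq_mul, sq, ← mul_assoc, eq]
          nlinarith [le x, norm_nonneg (f x)]
        refine integral_mono (Integrable.mono' ((BM.const (8 : ℝ)).mul hf.norm.pow).int (mw.smul hbm.norm.pow.m).aestronglyMeasurable (Filter.Eventually.of_forall fun x => ?_)) ((BM.const (8 : ℝ)).mul hf.norm.pow).int h8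
        rw [Real.norm_of_nonneg (by positivity)]; exact h8 x
      · ext x
        by_cases hx : x ∈ G
        · have : (‖β x‖ : ℂ) ≠ 0 := by exact_mod_cast (by linarith [(dH x hx).2] : ‖β x‖ ≠ 0)
          rw [coe_nnnorm]; field_simp
        · simp [sf x hx]
    obtain ⟨f1, f2, f3, f4⟩ := sc f hf sf
    obtain ⟨g1, g2, g3, g4⟩ := sc g hg sg
    have := bG δ d0 _ _ f1 g1 f2 g2
    rw [hσ, fm_den ν _ mw, f4, g4] at this
    have a0 := q_nonneg (σ := ν) f
    have a1 := q_nonneg (σ := ν) g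
    have a2 := q_nonneg (σ := σ) (fun x => f x/‖β x‖)
    have a3 := q_nonneg (σ := σ) (fun x => g x/‖β x‖)
    calc _ ≤ _ := this
      _ ≤ |B| * (8*q ν f+8*q ν g) := by gcongr; exact le_abs_self _
      _ ≤ _ := by nlinarith
end BP
set_option linter.all false
set_option autoImplicit false
namespace BP
open NNReal
variable {d : ℕ} {K : Pt d → Pt d → ℂ} {n C α : ℝ}
theorem Kcont (h : IsCZKernel K n C α) (n0 :0 < n) (a0 :0 < α) :
    ContinuousOn (fun z : Pt d × Pt d => K z.1 z.2) {z | z.1 ≠ z.2} := by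
  rintro ⟨x, y⟩ hxy
  have D0 :0 < dist x y := dist_pos.2 hxy
  refine ContinuousAt.continuousWithinAt ?_
  rw [ContinuousAt, tendsto_iff_norm_sub_tendsto_zero]
  have F : Filter.Tendsto (fun z : Pt d × Pt d => C*dist y z.2^α/dist z.1 y^(n+α)+C*dist x z.1^α/dist x y^(n+α)) (nhds (x, y)) (nhds 0) := by
    have c1 : ContinuousAt (fun z : Pt d × Pt d => C*dist y z.2^α/dist z.1 y^(n+α)+C*dist x z.1^α/dist x y^(n+α)) (x, y) := by
      refine ContinuousAt.add (ContinuousAt.div (continuousAt_const.mul (ContinuousAt.rpow_const (by fun_prop) (Or.inr a0.le))) (ContinuousAt.rpow_const (by fun_prop) (Or.inl D0.ne')) (by positivity))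
        (ContinuousAt.div_const (continuousAt_const.mul (ContinuousAt.rpow_const (by fun_prop) (Or.inr a0.le))) _)
    simpa [ContinuousAt, Real.zero_rpow a0.ne'] using c1
  have e1 : ∀ᶠ z : Pt d × Pt d in nhds (x, y),4*dist x z.1 < dist x y :=
    ContinuousAt.eventually_lt (by fun_prop) continuousAt_const (by simpa using D0)
  have e2 : ∀ᶠ z : Pt d × Pt d in nhds (x, y),4*dist y z.2 < dist x y :=
    ContinuousAt.eventually_lt (by fun_prop) continuousAt_const (by simpa using D0)
  refine squeeze_zero' (Filter.Eventually.of_forall fun _ => norm_nonneg _) ?_ F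
  filter_upwards [e1, e2] with z h1 h2
  have t := dist_triangle x z.1 y
  have h3 := h.smooth_fst x z.1 y hxy (by linarith [dist_nonneg (x := x) (y := z.1)])
  have h4 := h.smooth_snd z.1 y z.2 (dist_pos.1 (by linarith)) (by linarith)
  calc _ = ‖(K z.1 y-K z.1 z.2)+(K x y-K z.1 y)‖ := by rw [← norm_neg]; congr 1; ring
    _ ≤ _ := (norm_add_le _ _).trans (add_le_add h4 h3)
theorem mkCK (h : IsCZKernel K n C α) (n0 :0 < n) (C0 :0 < C) (a0 :0 < α) (a1 : α ≤1) (an : ∀ x y, K x y = - K y x) : CK K n C α where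
  m := by
    classical
    have := (Kcont h n0 a0).measurable_piecewise (g := fun _ =>0) continuousOn_const (isClosed_eq continuous_fst continuous_snd).measurableSet.compl
    convert this using 1
    ext z
    by_cases hz : z.1 = z.2
    · rw [piecewise_eq_of_notMem _ _ _ (by simpa using hz), hz]
      exact CharZero.eq_neg_self_iff.1 (an _ _)
    · rw [piecewise_eq_of_mem _ _ _ hz]
  anti := an
  size x y := by
    by_cases hz : x = y
    · rw [hz, CharZero.eq_neg_self_iff.1 (an y y)]; simp [Real.zero_rpow n0.ne']
    · exact h.size x y hz
  sm x x' y hxy h2 := (h.smooth_fst x x' y hxy h2).trans (le_of_eq (by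
    have := dist_pos.2 hxy
    rw [Real.div_rpow dist_nonneg this.le, Real.rpow_add this]; field_simp))
  n0 := n0
  C0 := C0
  a0 := a0
  a1 := a1
theorem eL {X : Type} [MeasurableSpace X] (ν : Measure X) [IsFiniteMeasure ν] {f : X → ℂ} (hf : BM f) : eLpNorm f 2 ν = ENNReal.ofReal (√(q ν f)) := by
  obtain ⟨M, hM⟩ := hf.b
  have : MemLp f 2 ν := MemLp.of_bound hf.m.aestronglyMeasurable M (Filter.Eventually.of_forall hM)
  rw [this.eLpNorm_eq_integral_rpow_norm (by norm_num) (by norm_num), Real.sqrt_eq_rpow]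
  simp [q]
variable {lm : Measure (Pt d)} [IsFiniteMeasure lm] {ε B : ℝ}
theorem l2a (ck : CK K n C α) (e0 :0 < ε) (B0 :0 < B)
    (h : ∀ f g : Pt d → ℂ, BM f → BM g → ‖fm lm (tK K ε) f g‖ ≤ B*(q lm f+q lm g)) {f : Pt d → ℂ} (hf : BM f) :
    eLpNorm (fun x => ∫ y, tK K ε x y*f y ∂lm) 2 lm ≤ ENNReal.ofReal (2*B)*eLpNorm f 2 lm := by
  have kb := tK_bm ck e0
  set T : Pt d → ℂ := fun x => ∫ y, tK K ε x y*f y ∂lm with hT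
  obtain ⟨D, hD⟩ := (kb.mul hf.snd).b
  have Tb : BM T := ⟨((kb.mul hf.snd).m.stronglyMeasurable.integral_prod_right' (ν := lm)).measurable, D*lm.real univ,
    fun x => norm_integral_le_of_norm_le_const (Filter.Eventually.of_forall fun y => hD (x, y))⟩
  have gb : BM (fun x => ((1/(2*B) : ℝ) : ℂ)*(starRingEnd ℂ) (T x)) := (BM.const _).mul Tb.conj
  have h1 := h f _ hf gb
  have e1 : fm lm (tK K ε) f (fun x => ((1/(2*B) : ℝ) : ℂ)*(starRingEnd ℂ) (T x)) = ((1/(2*B)*q lm T : ℝ) : ℂ) := by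
    unfold fm q
    rw [integral_prod _ (fm_bm kb hf gb).int, Complex.ofReal_mul, ← integral_complex_ofReal, ← integral_const_mul]
    congr 1; ext x
    dsimp only
    simp_rw [← mul_assoc]
    rw [integral_mul_const, integral_mul_const]
    change T x*_*_ = _
    rw [mul_right_comm, Complex.mul_conj']; push_cast; ring
  have e2 : q lm (fun x => ((1/(2*B) : ℝ) : ℂ)*(starRingEnd ℂ) (T x)) = (1/(2*B))^2*q lm T := by
    unfold q
    rw [← integral_const_mul]
    congr 1; ext x
    rw [norm_mul, Complex.norm_real, RCLike.norm_conj, mul_pow, Real.norm_of_nonneg (by positivity)]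
  have P0 := q_nonneg (σ := lm) T
  rw [e1, e2, Complex.norm_real, Real.norm_of_nonneg (by positivity)] at h1
  have h2 : q lm T ≤ (2*B)^2*q lm f := by
    have :1/(2*B)*q lm T-B*((1/(2*B))^2*q lm T) = q lm T/(4*B) := by field_simp; ring
    have h3 : q lm T/(4*B) ≤ B*q lm f := by linarith
    rw [div_le_iff₀ (by positivity)] at h3
    linarith
  rw [eL lm Tb, eL lm hf, ← ENNReal.ofReal_mul (by positivity)]
  apply ENNReal.ofReal_le_ofReal
  rw [← Real.sqrt_sq (show 0 ≤2*B by positivity), ← Real.sqrt_mul (by positivity)]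
  exact Real.sqrt_le_sqrt h2
theorem l2b (ck : CK K n C α) (e0 :0 < ε) (B0 :0 < B)
    (h : ∀ f g : Pt d → ℂ, BM f → BM g → ‖fm lm (tK K ε) f g‖ ≤ B*(q lm f+q lm g)) {f : Pt d → ℂ} (hf : AEStronglyMeasurable f lm) :
    eLpNorm (fun x => ∫ y, tK K ε x y*f y ∂lm) 2 lm ≤ ENNReal.ofReal (2*B)*eLpNorm f 2 lm := by
  classical
  by_cases ht : eLpNorm f 2 lm = ⊤
  · rw [ht, ENNReal.mul_top (by simpa using B0)]; exact le_top
  obtain ⟨g, gm, fg⟩ := hf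
  have : (fun x => ∫ y, tK K ε x y*f y ∂lm) = fun x => ∫ y, tK K ε x y*g y ∂lm := by
    ext x; exact integral_congr_ae (fg.mono fun y hy => by dsimp only; rw [hy])
  rw [this, eLpNorm_congr_ae fg]
  rw [eLpNorm_congr_ae fg] at ht
  have gi : Integrable g lm := MemLp.integrable (q :=2) (by norm_num) ⟨gm.aestronglyMeasurable, lt_top_iff_ne_top.2 ht⟩
  have kb := tK_bm ck e0
  obtain ⟨D, hD⟩ := kb.b
  have gb : ∀ N : ℕ, BM (fun x => if ‖g x‖ ≤ N then g x else 0) := fun N =>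
    ⟨Measurable.ite (measurableSet_le gm.measurable.norm measurable_const) gm.measurable measurable_const, N, fun x => by
      split_ifs with h
      · exact h
      · simp⟩
  have le : ∀ (N : ℕ) x, ‖if ‖g x‖ ≤ N then g x else 0‖ ≤ ‖g x‖ := fun N x => by split_ifs <;> simp
  have lim := Lp.eLpNorm_lim_le_liminf_eLpNorm (μ := lm) (p :=2) (f := fun (N : ℕ) x => ∫ y, tK K ε x y*(if ‖g y‖ ≤ N then g y else 0) ∂lm)
    (fun N => ((kb.mul (gb N).snd).m.stronglyMeasurable.integral_prod_right' (ν := lm)).aestronglyMeasurable)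
    (fun x => ∫ y, tK K ε x y*g y ∂lm) (Filter.Eventually.of_forall fun x => by
      refine tendsto_integral_of_dominated_convergence (fun y => D*‖g y‖) (fun N => ?_) (gi.norm.const_mul D) (fun N => Filter.Eventually.of_forall fun y => ?_) (Filter.Eventually.of_forall fun y => ?_)
      · exact ((kb.mul (gb N).snd).m.comp measurable_prodMk_left).aestronglyMeasurable
      · rw [norm_mul]
        exact mul_le_mul (hD (x, y)) (le N y) (norm_nonneg _) ((norm_nonneg _).trans (hD (x, y)))
      · refine tendsto_const_nhds.congr' ?_
        obtain ⟨N0, hN⟩ := exists_nat_ge ‖g y‖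
        filter_upwards [Filter.eventually_ge_atTop N0] with N hN0
        rw [if_pos (hN.trans (by exact_mod_cast hN0))])
  refine lim.trans (Filter.liminf_le_of_frequently_le' (Filter.Frequently.of_forall fun N => (l2a ck e0 B0 h (gb N)).trans ?_))
  gcongr 1
  exact eLpNorm_mono (le N)
theorem tT (ν : Measure (Pt d)) (f : Pt d → ℂ) (x : Pt d) : truncT ν K ε f x = ∫ y, tK K ε x y*f y ∂ν := by
  classical
  unfold truncT
  rw [← integral_indicator (measurableSet_lt measurable_const (by fun_prop))]
  congr 1; ext y
  simp only [indicator, tK, mem_setOf_eq, ite_mul, zero_mul]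
theorem l2c (ck : CK K n C α) (kc : ContinuousOn (fun z : Pt d × Pt d => K z.1 z.2) {z | z.1 ≠ z.2}) (e0 :0 < ε) (B0 :0 < B)
    (h : ∀ f g : Pt d → ℂ, BM f → BM g → ‖fm lm (tK K ε) f g‖ ≤ B*(q lm f+q lm g)) (f : Pt d → ℂ) :
    eLpNorm (truncT lm K ε f) 2 lm ≤ ENNReal.ofReal (2*B)*eLpNorm f 2 lm := by
  classical
  let S : {x : Pt d // Integrable (fun y => tK K ε x y*f y) lm} → Set (Pt d) := fun x => {y | ε < dist x.1 y ∧ K x.1 y ≠ 0}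
  have So : ∀ x, IsOpen (S x) := fun x => by
    have c : ContinuousOn (K x.1) {y | ε < dist x.1 y} := kc.comp (f := fun y => (x.1, y)) (by fun_prop)
      fun y hy => dist_pos.1 (e0.trans hy)
    exact c.isOpen_inter_preimage (isOpen_lt continuous_const (by fun_prop)) isOpen_compl_singleton
  obtain ⟨T, Tc, hT⟩ := TopologicalSpace.isOpen_iUnion_countable S So
  have mS : ∀ x, AEStronglyMeasurable f (lm.restrict (S x)) := fun x => by
    have m1 : AEStronglyMeasurable (fun y => (K x.1 y)⁻¹*(tK K ε x.1 y*f y)) (lm.restrict (S x)) :=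
      ((ck.m.comp measurable_prodMk_left).inv.aestronglyMeasurable).mul x.2.1.restrict
    refine m1.congr ((ae_restrict_iff' (So x).measurableSet).2 (Filter.Eventually.of_forall fun y hy => ?_))
    dsimp only
    rw [tK, if_pos hy.1, inv_mul_cancel_left₀ hy.2]
  have mU : AEStronglyMeasurable ((⋃ x, S x).indicator f) lm := by
    rw [aestronglyMeasurable_indicator_iff (isOpen_iUnion So).measurableSet, ← hT]
    have := Tc.to_subtype
    rw [biUnion_eq_iUnion]
    exact AEStronglyMeasurable.iUnion fun x => mS x
  calc _ ≤ eLpNorm (fun x => ∫ y, tK K ε x y*(⋃ x, S x).indicator f y ∂lm) 2 lm := by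
        refine eLpNorm_mono fun x => ?_
        rw [tT]
        by_cases hx : Integrable (fun y => tK K ε x y*f y) lm
        · refine le_of_eq (congrArg _ (integral_congr_ae (Filter.Eventually.of_forall fun y => ?_)))
          dsimp only
          by_cases hy : y ∈ ⋃ x, S x
          · rw [indicator_of_mem hy]
          · have : tK K ε x y =0 := by
              by_contra h0
              refine hy (mem_iUnion.2 ⟨⟨x, hx⟩, ?_⟩)
              unfold tK at h0
              split_ifs at h0 with h1
              · exact ⟨h1, h0⟩
              · exact absurd rfl h0
            rw [this, zero_mul, zero_mul]
        · rw [integral_undef hx, norm_zero]; exact norm_nonneg _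
    _ ≤ _ := l2b ck e0 B0 h mU
    _ ≤ _ := by
        gcongr 1
        exact eLpNorm_mono fun x => norm_indicator_le_norm_self _ _
end BP
set_option linter.all false
set_option autoImplicit false
namespace BP
open NNReal
theorem fm_tr {d : ℕ} {μ : Measure (Pt d)} {S : Set (Pt d)} (hS : MeasurableSet S) [IsFiniteMeasure (μ.comap ((↑) : S → Pt d))]
    {G : Set S} (mG : MeasurableSet G) {k : Pt d → Pt d → ℂ} {B : ℝ}
    (h : ∀ f g : S → ℂ, BM f → BM g → (∀ x ∉ G, f x =0) → (∀ x ∉ G, g x =0) →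
      ‖fm (μ.comap ((↑) : S → Pt d)) (fun x y => k x.1 y.1) f g‖ ≤ B*(q (μ.comap ((↑) : S → Pt d)) f+q (μ.comap ((↑) : S → Pt d)) g)) (f g : Pt d → ℂ) (hf : BM f) (hg : BM g) :
    ‖fm (μ.restrict ((↑) '' G)) k f g‖ ≤ B*(q (μ.restrict ((↑) '' G)) f+q (μ.restrict ((↑) '' G)) g) := by
  classical
  set ν := μ.comap ((↑) : S → Pt d) with hν
  have me := MeasurableEmbedding.subtype_coe hS
  have lm : μ.restrict ((↑) '' G) = (ν.restrict G).map ((↑) : S → Pt d) := by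
    have h1 : ((↑) : S → Pt d) ⁻¹' ((↑) '' G) = G := preimage_image_eq _ Subtype.val_injective
    rw [← h1, ← me.restrict_map, h1, map_comap_subtype_coe hS, Measure.restrict_restrict (me.measurableSet_image.2 mG), inter_eq_left.2 (by rintro _ ⟨x, _, rfl⟩; exact x.2)]
  have cb : ∀ f : Pt d → ℂ, BM f → BM (G.indicator fun x : S => f x) := fun f hf =>
    BM.of_le ((hf.m.comp measurable_subtype_coe).indicator mG) (g := fun x => ‖f x‖) ⟨hf.norm.m.comp measurable_subtype_coe, hf.norm.b.imp fun C hC x => hC _⟩ fun x => norm_indicator_le_norm_self _ _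
  have eq : ∀ f : Pt d → ℂ, q (μ.restrict ((↑) '' G)) f = q ν (G.indicator fun x : S => f x) := fun f => by
    unfold q
    rw [lm, me.integral_map, ← integral_indicator mG]
    congr 1; ext x
    by_cases hx : x ∈ G <;> simp [hx]
  have e2 : fm (μ.restrict ((↑) '' G)) k f g = fm ν (fun x y => k x.1 y.1) (G.indicator fun x : S => f x) (G.indicator fun x : S => g x) := by
    unfold fm
    rw [lm, Measure.map_prod_map _ _ me.measurable me.measurable, (me.prodMap me).integral_map, Measure.prod_restrict, ← integral_indicator (mG.prod mG)]
    congr 1; ext z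
    by_cases h1 : z.1 ∈ G <;> by_cases h2 : z.2 ∈ G <;> simp [indicator, h1, h2]
  rw [e2, eq, eq]
  exact h _ _ (cb f hf) (cb g hg) (fun x hx => indicator_of_notMem hx _) (fun x hx => indicator_of_notMem hx _)
theorem mkCO {d : ℕ} (d1 :1 ≤ d) (Q : Cube d) (hQ :0 < Q.side) : CO (fun (x : Q.toSet) i => x.1 i) (fun k => Q.side/2^k) where
  le1 x y i := by
    have := PiLp.norm_apply_le (x.1-y.1) i
    rw [← dist_eq_norm] at this
    exact this
  le2 x y s h := by
    have s0 :0 ≤ s := (abs_nonneg _).trans (h ⟨0, d1⟩)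
    rw [Subtype.dist_eq, EuclideanSpace.dist_eq]
    refine Real.sqrt_le_iff.2 ⟨by positivity, ?_⟩
    have d1' : (1 : ℝ) ≤ d := by exact_mod_cast d1
    calc _ ≤ ∑ i : Fin d, s^2 := Finset.sum_le_sum fun i _ => by
          rw [Real.dist_eq]; exact pow_le_pow_left₀ (abs_nonneg _) (h i) 2
      _ = d*s^2 := by simp
      _ ≤ _ := by rw [mul_pow]; gcongr; nlinarith
  bd x y i := by
    have h1 := abs_le.1 (x.2 i)
    have h2 := abs_le.1 (y.2 i)
    simp only [pow_zero, div_one]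
    rw [abs_le]
    constructor <;> linarith
  d1 := d1
  hl j := by rw [pow_succ]; field_simp
  l0 j := by positivity
theorem Qcompact {d : ℕ} (Q : Cube d) : IsCompact Q.toSet := by
  refine isCompact_of_isClosed_isBounded ?_ ?_
  · simp only [Cube.toSet, setOf_forall]
    exact isClosed_iInter fun i => isClosed_le (by fun_prop) continuous_const
  · refine (isBounded_closedBall (x := Q.center) (r := √(∑ i : Fin d, (Q.side/2)^2))).subset fun x hx => ?_
    rw [mem_closedBall, EuclideanSpace.dist_eq]
    refine Real.sqrt_le_sqrt (Finset.sum_le_sum fun i _ => ?_)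
    rw [Real.dist_eq]; exact pow_le_pow_left₀ (abs_nonneg _) (hx i) 2
end BP
/-- **Big pieces via maximal truncations.**
For an antisymmetric CZ kernel and an `L^q(μ)`-admissible test function `bQ` on a cube `Q`,
there is `c₁ = c₁(q, B₁) > 0` such that: if `∫_{E_Q} |bQ| dμ ≤ c₁ ∫_Q |bQ| dμ` and the maximal
truncation `T_{μ,*} bQ` satisfies a weak type `L^s` bound on `Q ∖ E_Q`, then there is a big
piece `G ⊆ Q ∖ E_Q` with `μ(G) ≥ c μ(Q)` on which `T` restricted to `μ⌊G` is bounded on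
`L²(μ⌊G)` (uniformly in the truncation parameter `ε`). -/
theorem big_pieces_via_maximal_truncations (q B₁ : ℝ) (hq : 1 < q) (hB₁ : 0 < B₁) :
    ∃ c₁ : ℝ, 0 < c₁ ∧
      ∀ (d : ℕ) (n C₀ C α s B₂ : ℝ), 0 < n → n ≤ d → 0 < C₀ → 0 < C → 0 < α → α ≤ 1 →
        0 < s → 0 < B₂ →
      ∃ c : ℝ, 0 < c ∧ ∃ Cb : ℝ≥0∞, Cb < ∞ ∧
        ∀ μ : Measure (Pt d), HasDegree μ n C₀ →
        ∀ K : Pt d → Pt d → ℂ, IsCZKernel K n C α → (∀ x y, K x y = - K y x) →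
        ∀ Q : Cube d, 0 < Q.side →
        ∀ bQ : Pt d → ℂ, IsAdmissible μ Q q B₁ bQ →
        ∀ E : Set (Pt d),
          (∫⁻ x in E, (‖bQ x‖₊ : ℝ≥0∞) ∂μ
              ≤ ENNReal.ofReal c₁ * ∫⁻ x in Q.toSet, (‖bQ x‖₊ : ℝ≥0∞) ∂μ) →
          (∀ lam : ℝ, 0 < lam →
            ENNReal.ofReal (lam ^ s) *
                μ {x | x ∈ Q.toSet \ E ∧ ENNReal.ofReal lam < maxT μ K 0 bQ x}
              ≤ ENNReal.ofReal B₂ * μ Q.toSet) →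
          ∃ G : Set (Pt d), G ⊆ Q.toSet \ E ∧
            ENNReal.ofReal c * μ Q.toSet ≤ μ G ∧
            ∀ ε : ℝ, 0 < ε → ∀ f : Pt d → ℂ,
              eLpNorm (truncT (μ.restrict G) K ε f) 2 (μ.restrict G)
                ≤ Cb * eLpNorm f 2 (μ.restrict G) := by
  obtain ⟨M, M1, hM⟩ := BP.mainB q B₁ hq
  refine ⟨1/(16*M), by positivity, fun d n C₀ C α s B₂ n0 nd C00 C0 a0 a1 s0 B20 => ?_⟩
  have d1 :1 ≤ d := by
    rcases Nat.eq_zero_or_pos d with h | h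
    · subst h; simp at nd; linarith
    · exact h
  obtain ⟨c, c0, B, B0, W, W0, hm⟩ := hM d n C₀ C α s B₂ d1 n0 C00 s0 B20
  refine ⟨c, c0, ENNReal.ofReal (2*B), by finiteness, fun μ hμ K hK an Q hQ bQ ⟨b1, b2, b3⟩ E hE hw => ?_⟩
  by_cases hz : μ Q.toSet =0
  · exact ⟨∅, empty_subset _, by simp [hz], fun ε _ f => by simp⟩
  have ck := BP.mkCK hK n0 C0 a0 a1 an
  have cQ := BP.Qcompact Q
  have mQ := cQ.isClosed.measurableSet
  have lf : IsLocallyFiniteMeasure μ := ⟨fun x => ⟨ball x 1, ball_mem_nhds x one_pos, (hμ x 1 one_pos).trans_lt (by finiteness)⟩⟩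
  have fQ : μ Q.toSet ≠ ⊤ := cQ.measure_lt_top.ne
  have cs : CompactSpace Q.toSet := isCompact_iff_compactSpace.1 cQ
  set ν := μ.comap ((↑) : Q.toSet → Pt d) with hν
  have na : ∀ t : Set Q.toSet, ν t = μ ((↑) '' t) := comap_subtype_coe_apply mQ μ
  have nu : ν univ = μ Q.toSet := by rw [na]; simp
  have fin : IsFiniteMeasure ν := ⟨by rw [nu]; exact cQ.measure_lt_top⟩
  have bi : Integrable bQ (μ.restrict Q.toSet) := by
    by_contra h
    rw [integral_undef h] at b2
    exact (ENNReal.toReal_pos hz fQ).ne (by exact_mod_cast b2)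
  obtain ⟨β, mβ, hβ⟩ := bi.1
  have cg : ∀ p : ℝ, ∫⁻ x, (‖β x.1‖₊ : ℝ≥0∞)^p ∂ν = ∫⁻ x in Q.toSet, (‖bQ x‖₊ : ℝ≥0∞)^p ∂μ := fun p => by
    rw [lintegral_subtype_comap mQ fun x => (‖β x‖₊ : ℝ≥0∞)^p]
    exact lintegral_congr_ae (hβ.mono fun x hx => by dsimp only; rw [hx])
  have cg1 := cg 1
  simp only [ENNReal.rpow_one] at cg1
  have tr : ∀ ε (x : Q.toSet), ∫ y : Q.toSet, BP.tK (fun x y : Q.toSet => K x.1 y.1) ε x y*β y.1 ∂ν = truncT μ K ε bQ x.1 := fun ε x => by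
    rw [BP.tT, ← setIntegral_eq_integral_of_forall_compl_eq_zero (s := Q.toSet) (fun y hy => by rw [b1 y hy, mul_zero])]
    refine (integral_subtype_comap mQ fun y => BP.tK K ε x.1 y*β y).trans ?_
    exact integral_congr_ae (hβ.mono fun y hy => by dsimp only; rw [hy])
  obtain ⟨G, mG, dG, vG, hG⟩ := hm Q.toSet ν (fun x y => K x.1 y.1) _ _ (fun x => β x.1) ((↑) ⁻¹' toMeasurable μ E)
    (toMeasurable ν {x | x.1 ∉ E ∧ ENNReal.ofReal W < maxT μ K 0 bQ x.1})
    { m := ck.m.comp (measurable_subtype_coe.prodMap measurable_subtype_coe)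
      anti := fun x y => an _ _
      size := fun x y => ck.size _ _
      sm := fun x x' y hxy h => ck.sm _ _ _ (fun h => hxy (Subtype.ext h)) h
      n0 := n0, C0 := C0, a0 := a0, a1 := a1 } (BP.mkCO d1 Q hQ) (mβ.measurable.comp measurable_subtype_coe)
    (by rw [Measure.real, nu]; exact ENNReal.toReal_pos hz fQ)
    (fun x r r0 => by
      rw [na]
      refine (measure_mono ?_).trans (hμ x.1 r r0)
      rintro _ ⟨y, hy, rfl⟩; exact hy)
    (by
      rw [integral_subtype_comap mQ, ← integral_congr_ae hβ, b2, Complex.norm_real, Measure.real, nu]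
      exact Real.norm_of_nonneg ENNReal.toReal_nonneg)
    (by rw [nu, cg]; exact b3) (measurable_subtype_coe (measurableSet_toMeasurable _ _)) (measurableSet_toMeasurable _ _)
    (by
      rw [cg1]
      refine le_trans ?_ hE
      rw [← Measure.restrict_toMeasurable_of_sFinite E, ← setLIntegral_map (measurableSet_toMeasurable _ _) (f := fun x => (‖β x‖₊ : ℝ≥0∞)) (by have := mβ.measurable; fun_prop) measurable_subtype_coe, map_comap_subtype_coe mQ,
        ← lintegral_congr_ae (f := fun x => (‖bQ x‖₊ : ℝ≥0∞)) (ae_restrict_of_ae (hβ.mono fun x hx => by dsimp only; rw [hx]))]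
      exact lintegral_mono' (Measure.restrict_mono_measure Measure.restrict_le_self _) le_rfl)
    (by
      rw [nu, measure_toMeasurable, na]
      refine le_trans ?_ (hw W W0)
      gcongr
      rintro _ ⟨y, hy, rfl⟩; exact ⟨⟨y.2, hy.1⟩, hy.2⟩)
    (fun x hx hA ε e0 => by
      rw [tr]
      have h1 : ¬ (x.1 ∉ E ∧ ENNReal.ofReal W < maxT μ K 0 bQ x.1) := fun h => hA (subset_toMeasurable _ _ h)
      have h2 := not_lt.1 fun h => h1 ⟨fun h => hx (subset_toMeasurable _ _ h), h⟩
      have h3 : (‖truncT μ K ε bQ x.1‖₊ : ℝ≥0∞) ≤ ENNReal.ofReal W := (le_iSup₂_of_le ε e0 le_rfl).trans h2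
      rwa [← enorm_eq_nnnorm, ← ofReal_norm, ENNReal.ofReal_le_ofReal_iff W0.le] at h3)
  refine ⟨(↑) '' G, ?_, ?_, fun ε e0 f => ?_⟩
  · rintro _ ⟨x, hx, rfl⟩
    exact ⟨x.2, fun h => disjoint_left.1 dG hx (subset_toMeasurable _ _ h)⟩
  · have := ENNReal.ofReal_le_ofReal vG
    rwa [ENNReal.ofReal_mul c0.le, ofReal_measureReal, ofReal_measureReal, nu, na] at this
  · have : IsFiniteMeasure (μ.restrict (((↑) : Q.toSet → Pt d) '' G)) := ⟨by rw [Measure.restrict_apply_univ, ← na]; finiteness⟩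
    exact BP.l2c ck (BP.Kcont hK n0 a0) e0 B0 (BP.fm_tr mQ mG (hG ε e0)) f
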